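/- arXiv:math/0501063 — 2 statements merged into one kernel-verified Lean document; each statement's English description precedes it below -/
import Mathlib

section
/- Let (R, m) be a complete Noetherian local ring, M a finitely generated R-module of dimension n, and a, b ideals with Att(H_a^n(M)) ⊆ Att(H_b^n(M)). Then there exists a surjective R-module homomorphism H_b^n(M) → H_a^n(M). -/
noncomputable section

universe u

open CategoryTheory

/-- The `i`-th local cohomology of a module with respect to an ideal. -/
abbrev LC {R : Type u} [CommRing R] (J : Ideal R) (i : ℕ) (M : Type u)
    [AddCommGroup M] [Module R M] : ModuleCat.{u} R :=
  (localCohomology J i).obj (ModuleCat.of R M)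

/-- Attached primes of a module: primes of the form `Ann(T/U)`. -/
def Att (R : Type u) [CommRing R] (T : Type u) [AddCommGroup T] [Module R T] :
    Set (Ideal R) :=
  { p | p.IsPrime ∧ ∃ U : Submodule R T, p = Module.annihilator R (T ⧸ U) }

/-- Krull dimension of a module, as the Krull dimension of its support. -/
def mdim (R : Type u) [CommRing R] (M : Type u) [AddCommGroup M] [Module R M] :
    WithBot ℕ∞ :=
  Order.krullDim (Module.support R M)

/-- Cohomological dimension of `M` with respect to `J`:
the supremum of the `i` with `H_J^i(M) ≠ 0` (`⊥` if there are none). -/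
def cohDim (R : Type u) [CommRing R] (J : Ideal R) (M : Type u)
    [AddCommGroup M] [Module R M] : WithBot ℕ∞ :=
  sSup { x | ∃ i : ℕ, x = (i : ℕ∞) ∧ Nontrivial (LC J i M) }

section PartA
set_option autoImplicit false
open CategoryTheory Opposite

namespace LHV
variable {R : Type u} [CommRing R]

/-- precomposition with a chain map -/
def lyMap {K L : ChainComplex (ModuleCat.{u} R) ℕ} (φ : K ⟶ L) (Y : ModuleCat.{u} R) :
    L.linearYonedaObj R Y ⟶ K.linearYonedaObj R Y :=
  (HomologicalComplex.unopFunctor _ _).map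
    (((((linearYoneda R (ModuleCat.{u} R)).obj Y).rightOp.mapHomologicalComplex _).map φ)).op

lemma lyMap_f {K L : ChainComplex (ModuleCat.{u} R) ℕ} (φ : K ⟶ L) (Y : ModuleCat.{u} R) (n : ℕ)
    (f : L.X n ⟶ Y) : ((lyMap φ Y).f n).hom f = φ.f n ≫ f := rfl

lemma isoExt_nat {X X' : ModuleCat.{u} R} (g : X ⟶ X') (P : ProjectiveResolution X)
    (P' : ProjectiveResolution X') (φ : P.complex ⟶ P'.complex)
    (comm : φ.f 0 ≫ P'.π.f 0 = P.π.f 0 ≫ g) (n : ℕ) (Y : ModuleCat.{u} R) :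
    ((Ext R (ModuleCat.{u} R) n).map g.op).app Y ≫ (P.isoExt (R := R) n Y).hom =
      (P'.isoExt (R := R) n Y).hom ≫ HomologicalComplex.homologyMap (lyMap φ Y) n := by
  have h := ProjectiveResolution.isoLeftDerivedObj_inv_naturality g P P' φ comm
    ((linearYoneda R (ModuleCat.{u} R)).obj Y).rightOp n
  have h2 := congrArg Quiver.Hom.unop h
  rw [unop_comp, unop_comp] at h2
  have h3 := HomologicalComplex.homologyOp_hom_naturality (lyMap φ Y) n
  have h4 := congrArg Quiver.Hom.unop h3
  have h4' : HomologicalComplex.homologyMap (lyMap φ Y) n ≫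
      (HomologicalComplex.homologyUnop ((((linearYoneda R (ModuleCat.{u} R)).obj Y).rightOp.mapHomologicalComplex _).obj P.complex) n).hom
     = (HomologicalComplex.homologyUnop ((((linearYoneda R (ModuleCat.{u} R)).obj Y).rightOp.mapHomologicalComplex _).obj P'.complex) n).hom ≫
      (HomologicalComplex.homologyMap (((((linearYoneda R (ModuleCat.{u} R)).obj Y).rightOp.mapHomologicalComplex _).map φ)) n).unop := h4.symm
  have h5 : ((Ext R (ModuleCat.{u} R) n).map g.op).app Y ≫ (P.isoLeftDerivedObj ((linearYoneda R (ModuleCat.{u} R)).obj Y).rightOp n).inv.unop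
     = (P'.isoLeftDerivedObj ((linearYoneda R (ModuleCat.{u} R)).obj Y).rightOp n).inv.unop ≫
     (HomologicalComplex.homologyMap (((((linearYoneda R (ModuleCat.{u} R)).obj Y).rightOp.mapHomologicalComplex _).map φ)) n).unop := h2
  have e1 : (P.isoExt (R := R) n Y).hom ≫ (HomologicalComplex.homologyUnop ((((linearYoneda R (ModuleCat.{u} R)).obj Y).rightOp.mapHomologicalComplex _).obj P.complex) n).hom = (P.isoLeftDerivedObj ((linearYoneda R (ModuleCat.{u} R)).obj Y).rightOp n).inv.unop := by
    exact (Category.assoc _ _ _).trans ((congrArg _ (Iso.inv_hom_id _)).trans (Category.comp_id _))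
  have e2 : (P'.isoExt (R := R) n Y).hom ≫ (HomologicalComplex.homologyUnop ((((linearYoneda R (ModuleCat.{u} R)).obj Y).rightOp.mapHomologicalComplex _).obj P'.complex) n).hom = (P'.isoLeftDerivedObj ((linearYoneda R (ModuleCat.{u} R)).obj Y).rightOp n).inv.unop := by
    exact (Category.assoc _ _ _).trans ((congrArg _ (Iso.inv_hom_id _)).trans (Category.comp_id _))
  have key : ∀ {A B C D E F : ModuleCat.{u} R} (x : A ⟶ B) (y : B ⟶ C) (z : A ⟶ D) (w : D ⟶ C)
      (i : C ≅ E) (v : D ⟶ F) (q : F ⟶ E) (y' : B ⟶ E) (z' : A ⟶ F), w ≫ i.hom = v ≫ q → y ≫ i.hom = y' →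
      z ≫ v = z' → x ≫ y' = z' ≫ q → x ≫ y = z ≫ w := by
    intro A B C D E F x y z w i v q y' z' h1 h2 h3 h4
    rw [← cancel_mono i.hom, Category.assoc, Category.assoc, h1, h2, h4, ← h3, Category.assoc]
  exact key _ _ _ _ _ _ _ _ _ h4' e1 e2 h5

open Abelian CochainComplex HomComplex

lemma extMk_zero_iff0 {X Y : ModuleCat.{u} R} (P : ProjectiveResolution X)
    (f : P.complex.X 0 ⟶ Y) (m : ℕ) (hm : 0 + 1 = m)
    (hf : P.complex.d m 0 ≫ f = 0) : P.extMk f m hm hf = 0 ↔ f = 0 := by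
  constructor
  · intro h
    rw [← P.extEquivCohomologyClass.apply_eq_iff_eq, ProjectiveResolution.extEquivCohomologyClass_extMk, ProjectiveResolution.extEquivCohomologyClass_zero,
      CohomologyClass.mk_eq_zero_iff] at h
    rw [Cocycle.toSingleMk_mem_coboundaries_iff _ _ _ _ _ 1 (by simp)] at h
    obtain ⟨g, hg⟩ := h
    rw [← cancel_epi (P.cochainComplexXIso (-(0:ℕ)) 0 rfl).hom]
    rw [← hg]
    have : Limits.IsZero (P.cochainComplex.X 1) := P.cochainComplex.isZero_of_isStrictlyLE 0 1 (by lia)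
    simp [this.eq_of_src g 0]
  · rintro rfl
    simp

/-- cycles as cocycles -/
def cyc {X : ModuleCat.{u} R} (P : ProjectiveResolution X) (Y : ModuleCat.{u} R) (n : ℕ) :
    ((P.complex.linearYonedaObj R Y).cycles n) →ₗ[R] (P.complex.X n ⟶ Y) :=
  ((P.complex.linearYonedaObj R Y).iCycles n).hom

lemma cyc_d {X : ModuleCat.{u} R} (P : ProjectiveResolution X) (Y : ModuleCat.{u} R) (n : ℕ)
    (z : (P.complex.linearYonedaObj R Y).cycles n) : P.complex.d (n+1) n ≫ cyc P Y n z = 0 :=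
  congrArg (fun q => ModuleCat.Hom.hom q z) ((P.complex.linearYonedaObj R Y).iCycles_d n (n+1))

/-- cycles to Ext -/
def cycToExt {X : ModuleCat.{u} R} (P : ProjectiveResolution X) (Y : ModuleCat.{u} R) (n : ℕ) :
    ((P.complex.linearYonedaObj R Y).cycles n) →ₗ[R] Abelian.Ext.{u} X Y n where
  toFun z := P.extMk (cyc P Y n z) (n+1) rfl (cyc_d P Y n z)
  map_add' x y := by
    rw [ProjectiveResolution.add_extMk]
    congr 1
    exact map_add _ _ _
  map_smul' r x := by
    rw [RingHom.id_apply, Ext.smul_eq_comp_mk₀, ProjectiveResolution.extMk_comp_mk₀]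
    congr 1
    rw [map_smul]
    rw [Linear.comp_smul, Category.comp_id]

lemma cycToExt_apply {X : ModuleCat.{u} R} (P : ProjectiveResolution X) (Y : ModuleCat.{u} R) (n : ℕ)
    (z : (P.complex.linearYonedaObj R Y).cycles n) :
    cycToExt P Y n z = P.extMk (cyc P Y n z) (n+1) rfl (cyc_d P Y n z) := rfl

lemma cycToExt_surj {X : ModuleCat.{u} R} (P : ProjectiveResolution X) (Y : ModuleCat.{u} R) (n : ℕ) :
    Function.Surjective (cycToExt P Y n) := by
  intro α
  obtain ⟨f, hf, rfl⟩ := P.extMk_surjective α (n+1) rfl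
  let K := P.complex.linearYonedaObj R Y
  obtain ⟨z, hz⟩ : ∃ z : K.cycles n, (K.iCycles n).hom z = f := by
    let l : ModuleCat.of R (ULift.{u} R) ⟶ K.X n := ModuleCat.ofHom
      (((LinearMap.toSpanSingleton R (P.complex.X n ⟶ Y) f)).comp ULift.moduleEquiv.toLinearMap)
    have hl : l ≫ K.d n (n+1) = 0 := by
      ext1
      refine LinearMap.ext fun r => ?_
      change P.complex.d (n+1) n ≫ (r.down • f) = 0
      rw [Linear.comp_smul, hf, smul_zero]
    refine ⟨(K.liftCycles l (n+1) (by simp) hl).hom ⟨1⟩, ?_⟩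
    have := congrArg (fun q => ModuleCat.Hom.hom q (⟨1⟩ : ULift R)) (K.liftCycles_i l (n+1) (by simp) hl)
    refine this.trans ?_
    exact one_smul R (f : P.complex.X n ⟶ Y)
  refine ⟨z, ?_⟩
  simp only [cycToExt, LinearMap.coe_mk, AddHom.coe_mk]
  congr 1

lemma cycToExt_ker {X : ModuleCat.{u} R} (P : ProjectiveResolution X) (Y : ModuleCat.{u} R) (n : ℕ) :
    LinearMap.ker ((P.complex.linearYonedaObj R Y).homologyπ n).hom = LinearMap.ker (cycToExt P Y n) := by
  let K := P.complex.linearYonedaObj R Y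
  have hex : ∀ i, (ComplexShape.up ℕ).prev n = i → ∀ z : K.cycles n, (K.homologyπ n).hom z = 0 ↔ ∃ g : K.X i, (K.toCycles i n).hom g = z := by
    intro i hi z
    have := ShortComplex.exact_of_g_is_cokernel (ShortComplex.mk _ _ (K.toCycles_comp_homologyπ i n)) (K.homologyIsCokernel i n hi)
    constructor
    · intro h; exact (ShortComplex.moduleCat_exact_iff _).1 this z h
    · rintro ⟨g, rfl⟩
      exact congrArg (fun q => ModuleCat.Hom.hom q g) (K.toCycles_comp_homologyπ i n)
  have hinj : Function.Injective (K.iCycles n).hom := by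
    exact (ModuleCat.mono_iff_injective (K.iCycles n)).1 inferInstance
  have htc : ∀ i (g : K.X i), (K.iCycles n).hom ((K.toCycles i n).hom g) = (K.d i n).hom g := fun i g =>
    congrArg (fun q => ModuleCat.Hom.hom q g) (K.toCycles_i i n)
  ext z
  rw [LinearMap.mem_ker, LinearMap.mem_ker]
  cases n with
  | zero =>
    rw [hex _ rfl]
    rw [cycToExt_apply, extMk_zero_iff0]
    constructor
    · rintro ⟨g, rfl⟩
      refine (htc _ g).trans ?_
      rw [K.shape _ _ (by simp)]; rfl
    · intro h
      refine ⟨0, ?_⟩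
      rw [map_zero]
      exact hinj ((map_zero _).trans h.symm)
  | succ n =>
    rw [hex n (by simp)]
    rw [cycToExt_apply, ProjectiveResolution.extMk_eq_zero_iff _ _ _ _ _ n rfl]
    constructor
    · rintro ⟨g, rfl⟩
      refine ⟨g, (htc _ g).symm⟩
    · rintro ⟨g, hg⟩
      refine ⟨g, hinj ((htc _ g).trans hg)⟩

/-- homology to Ext -/
def homToExt {X : ModuleCat.{u} R} (P : ProjectiveResolution X) (Y : ModuleCat.{u} R) (n : ℕ) :
    ((P.complex.linearYonedaObj R Y).homology n) ≃ₗ[R] Abelian.Ext.{u} X Y n :=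
  (LinearMap.quotKerEquivOfSurjective ((P.complex.linearYonedaObj R Y).homologyπ n).hom
    ((ModuleCat.epi_iff_surjective _).1 inferInstance)).symm ≪≫ₗ
  Submodule.quotEquivOfEq _ _ (cycToExt_ker P Y n) ≪≫ₗ
  LinearMap.quotKerEquivOfSurjective _ (cycToExt_surj P Y n)

lemma homToExt_π {X : ModuleCat.{u} R} (P : ProjectiveResolution X) (Y : ModuleCat.{u} R) (n : ℕ)
    (z : (P.complex.linearYonedaObj R Y).cycles n) :
    homToExt P Y n (((P.complex.linearYonedaObj R Y).homologyπ n).hom z) = cycToExt P Y n z := by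
  simp only [homToExt, LinearEquiv.trans_apply]
  have : (LinearMap.quotKerEquivOfSurjective ((P.complex.linearYonedaObj R Y).homologyπ n).hom
    ((ModuleCat.epi_iff_surjective _).1 inferInstance)).symm (((P.complex.linearYonedaObj R Y).homologyπ n).hom z) = Submodule.Quotient.mk z := by
    rw [LinearEquiv.symm_apply_eq]; rfl
  rw [this]
  rfl

/-- old to new Ext -/
def oldNew (X Y : ModuleCat.{u} R) (n : ℕ) :
    (((_root_.Ext R (ModuleCat.{u} R) n).obj (op X)).obj Y) ≃ₗ[R] Abelian.Ext.{u} X Y n :=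
  ((projectiveResolution X).isoExt (R := R) n Y).toLinearEquiv ≪≫ₗ homToExt _ Y n

lemma oldNew_nat {X X' : ModuleCat.{u} R} (g : X ⟶ X') (Y : ModuleCat.{u} R) (n : ℕ)
    (x : (((_root_.Ext R (ModuleCat.{u} R) n).obj (op X')).obj Y)) :
    oldNew X Y n ((((_root_.Ext R (ModuleCat.{u} R) n).map g.op).app Y).hom x) =
      (Ext.mk₀ g).comp (oldNew X' Y n x) (zero_add n) := by
  let P := projectiveResolution X
  let P' := projectiveResolution X'
  let φ := ProjectiveResolution.lift g P P'
  have comm : φ.f 0 ≫ P'.π.f 0 = P.π.f 0 ≫ g := by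
    exact ProjectiveResolution.lift_commutes_zero g P P'
  have h := congrArg (fun q => ModuleCat.Hom.hom q x) (isoExt_nat g P P' φ comm n Y)
  change homToExt P Y n (((P.isoExt (R := R) n Y).hom).hom ((((_root_.Ext R (ModuleCat.{u} R) n).map g.op).app Y).hom x)) = (Ext.mk₀ g).comp (homToExt P' Y n ((P'.isoExt (R := R) n Y).hom.hom x)) (zero_add n)
  refine (congrArg _ h).trans ?_
  change homToExt P Y n ((HomologicalComplex.homologyMap (lyMap φ Y) n).hom ((P'.isoExt (R := R) n Y).hom.hom x)) = _
  generalize (P'.isoExt (R := R) n Y).hom.hom x = y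
  obtain ⟨z, rfl⟩ := (ModuleCat.epi_iff_surjective ((P'.complex.linearYonedaObj R Y).homologyπ n)).1 inferInstance y
  have h2 := congrArg (fun q => ModuleCat.Hom.hom q z) (HomologicalComplex.homologyπ_naturality (lyMap φ Y) n)
  refine (congrArg _ h2).trans ?_
  have h3 := homToExt_π P Y n ((HomologicalComplex.cyclesMap (lyMap φ Y) n).hom z)
  refine h3.trans ?_
  have h4 := homToExt_π P' Y n z
  refine Eq.trans ?_ (congrArg (fun w => (Ext.mk₀ g).comp w (zero_add n)) h4.symm)
  rw [cycToExt_apply, cycToExt_apply]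
  let Φ : ProjectiveResolution.Hom P P' g := ⟨φ, comm⟩
  rw [ProjectiveResolution.mk₀_comp_extMk _ _ _ _ Φ]
  congr 1
  exact congrArg (fun q => ModuleCat.Hom.hom q z) (HomologicalComplex.cyclesMap_i (lyMap φ Y) n)
end LHV
end PartA

section PartB
set_option autoImplicit false
open CategoryTheory Opposite Abelian Limits

namespace LHV
variable {R : Type u} [CommRing R]

section colim
variable (D : ℕᵒᵖᵒᵖ ⥤ ModuleCat.{u} R) (G : ℕ → Type u) [∀ t, AddCommGroup (G t)] [∀ t, Module R (G t)]
  (f : ∀ s t, s ≤ t → G s →ₗ[R] G t) (e : ∀ t, D.obj (op (op t)) ≃ₗ[R] G t)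
  (he : ∀ (s t : ℕ) (h : s ≤ t) (x : D.obj (op (op s))), e t ((D.map (homOfLE h).op.op).hom x) = f s t h (e s x))
/-- cocone -/
def colDesc : (colimit D : ModuleCat.{u} R) →ₗ[R] Module.DirectLimit G f :=
    (colimit.desc D { pt := ModuleCat.of R (Module.DirectLimit G f), ι :=
      { app := fun t => ModuleCat.ofHom ((Module.DirectLimit.of R ℕ G f t.unop.unop).comp (e t.unop.unop).toLinearMap)
        naturality := by
          intro s t h
          ext x
          change Module.DirectLimit.of R ℕ G f t.unop.unop (e t.unop.unop ((D.map h).hom x)) = Module.DirectLimit.of R ℕ G f s.unop.unop (e s.unop.unop x)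
          have := he s.unop.unop t.unop.unop (leOfHom h.unop.unop) x
          refine (congrArg _ this).trans ?_
          rw [Module.DirectLimit.of_f] } }).hom

lemma colDesc_ι (t : ℕᵒᵖᵒᵖ) (y : D.obj t) : colDesc D G f e he ((colimit.ι D t).hom y) =
    Module.DirectLimit.of R ℕ G f t.unop.unop (e t.unop.unop y) :=
  congrArg (fun q => ModuleCat.Hom.hom q y) (colimit.ι_desc (F := D) _ t)

/-- lift -/
def colLift : Module.DirectLimit G f →ₗ[R] (colimit D : ModuleCat.{u} R) :=
    (Module.DirectLimit.lift R ℕ G f (fun t => ((colimit.ι D (op (op t))).hom).comp (e t).symm.toLinearMap) (by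
      intro s t h x
      obtain ⟨y, rfl⟩ := (e s).surjective x
      simp only [LinearMap.comp_apply, LinearEquiv.coe_coe, LinearEquiv.symm_apply_apply]
      rw [← he, LinearEquiv.symm_apply_apply]
      exact congrArg (fun q => ModuleCat.Hom.hom q y) (colimit.w D (homOfLE h).op.op)))

lemma colLift_of (t : ℕ) (y : D.obj (op (op t))) : colLift D G f e he (Module.DirectLimit.of R ℕ G f t (e t y)) =
   (colimit.ι D (op (op t))).hom y := by
  rw [colLift, Module.DirectLimit.lift_of]
  simp

/-- colimit as a direct limit -/
def colimEquiv : (colimit D : ModuleCat.{u} R) ≃ₗ[R] Module.DirectLimit G f :=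
  LinearEquiv.ofLinearMap
    (colDesc D G f e he) (colLift D G f e he)
    (by
      apply Module.DirectLimit.hom_ext
      intro t
      ext x
      obtain ⟨y, rfl⟩ := (e t).surjective x
      simp only [LinearMap.comp_apply, colLift_of, LinearMap.id_apply]
      exact colDesc_ι D G f e he (op (op t)) y)
    (by
      suffices h : ∀ g : (colimit D : ModuleCat.{u} R) →ₗ[R] (colimit D : ModuleCat.{u} R), ModuleCat.ofHom g = 𝟙 (colimit D) → g = LinearMap.id by
        refine h _ ?_
        refine colimit.hom_ext (F := D) ?_
        intro t
        ext y
        exact (congrArg (colLift D G f e he) (colDesc_ι D G f e he t y)).trans (colLift_of D G f e he t.unop.unop y)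
      intro g hg
      exact congrArg ModuleCat.Hom.hom hg)
end colim

/-- quotient map between powers -/
def qmap (a : Ideal R) {s t : ℕ} (h : s ≤ t) : ModuleCat.of R (R ⧸ a ^ t) ⟶ ModuleCat.of R (R ⧸ a ^ s) :=
  ModuleCat.ofHom <| Submodule.mapQ _ _ LinearMap.id (Ideal.pow_le_pow_right h)

/-- Ext of the quotient -/
abbrev EX (a : Ideal R) (i : ℕ) (M : Type u) [AddCommGroup M] [Module R M] (t : ℕ) : Type u :=
  Abelian.Ext.{u} (ModuleCat.of R (R ⧸ a ^ t)) (ModuleCat.of R M) i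

/-- transition -/
def trans (a : Ideal R) (i : ℕ) (M : Type u) [AddCommGroup M] [Module R M] (s t : ℕ) (h : s ≤ t) :
    EX a i M s →ₗ[R] EX a i M t :=
  Ext.precompOfLinear (Ext.mk₀ (qmap a h)) R (ModuleCat.of R M) (zero_add i)

lemma trans_apply (a : Ideal R) (i : ℕ) (M : Type u) [AddCommGroup M] [Module R M] (s t : ℕ) (h : s ≤ t) (x : EX a i M s) :
    trans a i M s t h x = (Ext.mk₀ (qmap a h)).comp x (zero_add i) := rfl

lemma qmap_refl (a : Ideal R) (s : ℕ) : qmap a (le_refl s) = 𝟙 _ := by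
  ext1; refine LinearMap.ext fun x => ?_; obtain ⟨x, rfl⟩ := Ideal.Quotient.mk_surjective x; rfl

lemma qmap_comp (a : Ideal R) {s t v : ℕ} (h : s ≤ t) (h' : t ≤ v) : qmap a h' ≫ qmap a h = qmap a (h.trans h') := by
  ext1; refine LinearMap.ext fun x => ?_; obtain ⟨x, rfl⟩ := Ideal.Quotient.mk_surjective x; rfl

instance (a : Ideal R) (i : ℕ) (M : Type u) [AddCommGroup M] [Module R M] :
    DirectedSystem (EX a i M) (fun s t h => trans a i M s t h) where
  map_self s x := by
    rw [trans_apply, qmap_refl, Ext.mk₀_id_comp]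
  map_map s t v h h' x := by
    rw [trans_apply, trans_apply, trans_apply, Ext.mk₀_comp_mk₀_assoc, qmap_comp]

/-- local cohomology -/
def HL (a : Ideal R) (i : ℕ) (M : Type u) [AddCommGroup M] [Module R M] : Type u :=
  Module.DirectLimit (EX a i M) (trans a i M)

section
variable (a : Ideal R) (i : ℕ) (M : Type u) [AddCommGroup M] [Module R M]

instance : AddCommGroup (HL a i M) := inferInstanceAs (AddCommGroup (Module.DirectLimit (EX a i M) (trans a i M)))
instance : Module R (HL a i M) := inferInstanceAs (Module R (Module.DirectLimit (EX a i M) (trans a i M)))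

/-- comparison -/
def LCequiv : ((localCohomology a i).obj (ModuleCat.of R M)) ≃ₗ[R] HL a i M :=
  (colimitObjIsoColimitCompEvaluation (localCohomology.diagram (localCohomology.idealPowersDiagram a) i) (ModuleCat.of R M)).toLinearEquiv ≪≫ₗ
  colimEquiv _ (EX a i M) (trans a i M) (fun t => oldNew (ModuleCat.of R (R ⧸ a ^ t)) (ModuleCat.of R M) i) (by
    intro s t h x
    exact oldNew_nat (qmap a h) (ModuleCat.of R M) i x)
end
end LHV
end PartB

section PartC
set_option autoImplicit false
open CategoryTheory Opposite Abelian Limits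

namespace LHV
variable {R : Type u} [CommRing R]

section
lemma ext_assoc1 {X Y Z T : ModuleCat.{u} R} {p q r : ℕ} (α : Abelian.Ext.{u} X Y 0) (β : Abelian.Ext.{u} Y Z p)
   (γ : Abelian.Ext.{u} Z T q) (h : p + q = r) : (α.comp β (zero_add p)).comp γ h = α.comp (β.comp γ h) (zero_add r) :=
  Abelian.Ext.comp_assoc α β γ (zero_add p) h (by lia)

variable {a : Ideal R} {i j : ℕ} {M N P : Type u} [AddCommGroup M] [Module R M]
  [AddCommGroup N] [Module R N] [AddCommGroup P] [Module R P]

/-- canonical map -/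
def HL.of (t : ℕ) : EX a i M t →ₗ[R] HL a i M := Module.DirectLimit.of R ℕ (EX a i M) (trans a i M) t

lemma HL.of_trans {s t : ℕ} (h : s ≤ t) (x : EX a i M s) : HL.of t (trans a i M s t h x) = HL.of s x :=
  Module.DirectLimit.of_f

lemma HL.exists_of (x : HL a i M) : ∃ t y, HL.of (a := a) (i := i) (M := M) t y = x :=
  Module.DirectLimit.exists_of x

lemma HL.of_zero {t : ℕ} {y : EX a i M t} (h : HL.of (a := a) (i := i) (M := M) t y = 0) :
    ∃ s, ∃ h : t ≤ s, trans a i M t s h y = 0 := by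
  obtain ⟨s, hs, h⟩ := Module.DirectLimit.of.zero_exact h
  exact ⟨s, hs, h⟩

/-- postcomposition -/
def HL.post (a : Ideal R) (i j : ℕ) {n : ℕ} (β : Abelian.Ext.{u} (ModuleCat.of R M) (ModuleCat.of R N) n) (h : i + n = j) :
    HL a i M →ₗ[R] HL a j N :=
  Module.DirectLimit.map (fun t => Ext.postcompOfLinear β R _ h) (by
    intro s t hst
    ext x
    change (((Ext.mk₀ (qmap a hst)).comp x (zero_add i)).comp β h) = (Ext.mk₀ (qmap a hst)).comp (x.comp β h) (zero_add j)
    rw [ext_assoc1])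

lemma HL.post_of {n : ℕ} (β : Abelian.Ext.{u} (ModuleCat.of R M) (ModuleCat.of R N) n) (h : i + n = j)
   (t : ℕ) (y : EX a i M t) : HL.post a i j β h (HL.of t y) = HL.of t (y.comp β h) :=
  Module.DirectLimit.map_apply_of _ _ _

/-- functoriality -/
def HL.map (a : Ideal R) (i : ℕ) (g : M →ₗ[R] N) : HL a i M →ₗ[R] HL a i N :=
  HL.post a i i (Ext.mk₀ (ModuleCat.ofHom g)) (add_zero i)

lemma HL.map_of (g : M →ₗ[R] N) (t : ℕ) (y : EX a i M t) :
   HL.map a i g (HL.of t y) = HL.of t (y.comp (Ext.mk₀ (ModuleCat.ofHom g)) (add_zero i)) := HL.post_of _ _ _ _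

lemma HL.map_id : HL.map a i (LinearMap.id : M →ₗ[R] M) = LinearMap.id := by
  ext x; obtain ⟨t, y, rfl⟩ := HL.exists_of x
  rw [HL.map_of]
  erw [ModuleCat.ofHom_id]
  simp

lemma HL.map_comp (g : M →ₗ[R] N) (h : N →ₗ[R] P) : HL.map a i (h ∘ₗ g) = HL.map a i h ∘ₗ HL.map a i g := by
  ext x; obtain ⟨t, y, rfl⟩ := HL.exists_of x
  rw [LinearMap.comp_apply, HL.map_of, HL.map_of, HL.map_of, ModuleCat.ofHom_comp, ← Ext.mk₀_comp_mk₀]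
  rw [Ext.comp_assoc_of_third_deg_zero]

lemma HL.map_smul (g : M →ₗ[R] N) (r : R) : HL.map a i (r • g) = r • HL.map a i g := by
  ext x; obtain ⟨t, y, rfl⟩ := HL.exists_of x
  rw [LinearMap.smul_apply, HL.map_of, HL.map_of]
  have : ModuleCat.ofHom (r • g) = r • ModuleCat.ofHom g := rfl
  rw [this, Ext.mk₀_smul, Ext.comp_smul, _root_.map_smul]

lemma HL.map_zero : HL.map a i (0 : M →ₗ[R] N) = 0 := by
  rw [← zero_smul R (0 : M →ₗ[R] N), HL.map_smul, zero_smul]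

/-- functoriality for equivalences -/
def HL.congr (a : Ideal R) (i : ℕ) (e : M ≃ₗ[R] N) : HL a i M ≃ₗ[R] HL a i N :=
  LinearEquiv.ofLinearMap (HL.map a i e) (HL.map a i e.symm)
    (by rw [← HL.map_comp]; simp [HL.map_id])
    (by rw [← HL.map_comp]; simp [HL.map_id])

lemma HL.smul_eq_zero_of (r : R) (h : ∀ m : M, r • m = 0) (x : HL a i M) : r • x = 0 := by
  have : r • (LinearMap.id : M →ₗ[R] M) = 0 := by ext m; simpa using h m
  have h2 := HL.map_smul (a := a) (i := i) (LinearMap.id : M →ₗ[R] M) r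
  rw [this, HL.map_zero, HL.map_id] at h2
  simpa using (LinearMap.congr_fun h2 x).symm

lemma HL.torsion (x : HL a i M) : ∃ t : ℕ, ∀ r ∈ a ^ t, r • x = 0 := by
  obtain ⟨t, y, rfl⟩ := HL.exists_of x
  refine ⟨t, fun r hr => ?_⟩
  have h : r • 𝟙 (ModuleCat.of R (R ⧸ a ^ t)) = 0 := by
    ext1; refine LinearMap.ext fun x => ?_
    obtain ⟨x, rfl⟩ := Ideal.Quotient.mk_surjective x
    change r • (Ideal.Quotient.mk (a ^ t) x) = 0
    rw [← Ideal.Quotient.mk_eq_mk, ← Submodule.Quotient.mk_smul, Submodule.Quotient.mk_eq_zero]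
    exact Ideal.mul_mem_right _ _ hr
  rw [← _root_.map_smul]
  have : r • y = (Ext.mk₀ (r • 𝟙 (ModuleCat.of R (R ⧸ a ^ t)))).comp y (zero_add i) := by
    rw [Ext.mk₀_smul, Ext.smul_comp, Ext.mk₀_id_comp]
  rw [this, h, Ext.mk₀_zero, Ext.zero_comp, _root_.map_zero]

/-- short exact -/
structure SES {A B C : Type u} [AddCommGroup A] [Module R A] [AddCommGroup B] [Module R B] [AddCommGroup C] [Module R C]
  (f : A →ₗ[R] B) (g : B →ₗ[R] C) : Prop where
  inj : Function.Injective f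
  surj : Function.Surjective g
  ex : Function.Exact f g

variable {A B C : Type u} [AddCommGroup A] [Module R A] [AddCommGroup B] [Module R B] [AddCommGroup C] [Module R C]
  {f : A →ₗ[R] B} {g : B →ₗ[R] C}

/-- short complex -/
abbrev SES.sc (S : SES f g) : ShortComplex (ModuleCat.{u} R) :=
  ShortComplex.mk (ModuleCat.ofHom f) (ModuleCat.ofHom g) (by
    rw [← ModuleCat.ofHom_comp, S.ex.linearMap_comp_eq_zero]; rfl)

lemma SES.se (S : SES f g) : S.sc.ShortExact :=
  ModuleCat.shortComplex_shortExact _ S.ex S.inj S.surj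

/-- connecting map -/
def SES.δ (S : SES f g) (a : Ideal R) (i : ℕ) : HL a i C →ₗ[R] HL a (i + 1) A :=
  HL.post a i (i + 1) S.se.extClass rfl

lemma SES.δ_of (S : SES f g) (t : ℕ) (y : EX a i C t) : S.δ a i (HL.of t y) = HL.of t (y.comp S.se.extClass rfl) :=
  HL.post_of _ _ _ _

lemma SES.ex₁ (S : SES f g) : Function.Exact (S.δ a i) (HL.map a (i+1) f) := by
  intro x
  constructor
  · intro h
    obtain ⟨t, y, rfl⟩ := HL.exists_of x
    rw [HL.map_of] at h
    obtain ⟨s, hs, h⟩ := HL.of_zero h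
    rw [trans_apply, ← ext_assoc1] at h
    obtain ⟨z, hz⟩ := Ext.covariant_sequence_exact₁ _ S.se _ h rfl
    refine ⟨HL.of s z, ?_⟩
    rw [SES.δ_of, hz, ← trans_apply, HL.of_trans]
  · rintro ⟨x, rfl⟩
    obtain ⟨t, y, rfl⟩ := HL.exists_of x
    rw [SES.δ_of, HL.map_of]
    erw [Ext.comp_assoc_of_third_deg_zero, S.se.extClass_comp]
    simp

lemma SES.ex₂ (S : SES f g) : Function.Exact (HL.map a i f) (HL.map a i g) := by
  intro x
  constructor
  · intro h
    obtain ⟨t, y, rfl⟩ := HL.exists_of x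
    rw [HL.map_of] at h
    obtain ⟨s, hs, h⟩ := HL.of_zero h
    rw [trans_apply, ← ext_assoc1] at h
    obtain ⟨z, hz⟩ := Ext.covariant_sequence_exact₂ _ S.se _ h
    refine ⟨HL.of s z, ?_⟩
    rw [HL.map_of]
    erw [hz]
    rw [← trans_apply, HL.of_trans]
  · rintro ⟨x, rfl⟩
    rw [← LinearMap.comp_apply, ← HL.map_comp, S.ex.linearMap_comp_eq_zero, HL.map_zero]; rfl

lemma SES.ex₃ (S : SES f g) : Function.Exact (HL.map a i g) (S.δ a i) := by
  intro x
  constructor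
  · intro h
    obtain ⟨t, y, rfl⟩ := HL.exists_of x
    rw [SES.δ_of] at h
    obtain ⟨s, hs, h⟩ := HL.of_zero h
    rw [trans_apply, ← ext_assoc1] at h
    obtain ⟨z, hz⟩ := Ext.covariant_sequence_exact₃ _ S.se _ _ h
    refine ⟨HL.of s z, ?_⟩
    rw [HL.map_of]
    erw [hz]
    rw [← trans_apply, HL.of_trans]
  · rintro ⟨x, rfl⟩
    obtain ⟨t, y, rfl⟩ := HL.exists_of x
    rw [HL.map_of, SES.δ_of]
    erw [Ext.comp_assoc_of_second_deg_zero, S.se.comp_extClass]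
    simp

lemma HL.injective_vanish [Module.Injective R M] (x : HL a (i+1) M) : x = 0 := by
  obtain ⟨t, y, rfl⟩ := HL.exists_of x
  have : CategoryTheory.Injective (ModuleCat.of R M) := Module.injective_object_of_injective_module R M
  rw [Ext.eq_zero_of_injective y, _root_.map_zero]

end

/-- torsion submodule -/
def Gam (a : Ideal R) (M : Type u) [AddCommGroup M] [Module R M] : Submodule R M where
  carrier := {m | ∃ t : ℕ, ∀ r ∈ a ^ t, r • m = 0}
  zero_mem' := ⟨0, fun r _ => smul_zero r⟩
  add_mem' := by
    rintro x y ⟨t, ht⟩ ⟨s, hs⟩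
    refine ⟨t + s, fun r hr => ?_⟩
    rw [smul_add, ht r (Ideal.pow_le_pow_right (by lia) hr), hs r (Ideal.pow_le_pow_right (by lia) hr), add_zero]
  smul_mem' := by
    rintro c x ⟨t, ht⟩
    exact ⟨t, fun r hr => by rw [smul_comm, ht r hr, smul_zero]⟩

section
variable {a : Ideal R} {M N : Type u} [AddCommGroup M] [Module R M] [AddCommGroup N] [Module R N]

lemma mem_Gam {m : M} : m ∈ Gam a M ↔ ∃ t : ℕ, ∀ r ∈ a ^ t, r • m = 0 := Iff.rfl

/-- evaluation at one in level t -/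
def ev0 (a : Ideal R) (M : Type u) [AddCommGroup M] [Module R M] (t : ℕ) : EX a 0 M t →ₗ[R] M where
  toFun x := (Ext.linearEquiv₀ (R := R) x).hom (Ideal.Quotient.mk _ 1)
  map_add' x y := by rw [map_add]; rfl
  map_smul' r x := by rw [map_smul]; rfl

lemma ev0_mk₀ (t : ℕ) (g : ModuleCat.of R (R ⧸ a ^ t) ⟶ ModuleCat.of R M) : ev0 a M t (Ext.mk₀ g) = g.hom (Ideal.Quotient.mk _ 1) := by
  simp only [ev0, LinearMap.coe_mk, AddHom.coe_mk]
  rw [show Ext.linearEquiv₀ (R := R) (Ext.mk₀ g) = g from (Ext.linearEquiv₀ (R := R)).apply_symm_apply g]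

lemma EX0_surj (t : ℕ) (x : EX a 0 M t) : ∃ g, Ext.mk₀ g = x := ⟨Ext.linearEquiv₀ (R := R) x, by simp⟩

/-- evaluation -/
def HL.ev (a : Ideal R) (M : Type u) [AddCommGroup M] [Module R M] : HL a 0 M →ₗ[R] M :=
  Module.DirectLimit.lift R ℕ _ _ (ev0 a M) (by
    intro s t h x
    obtain ⟨g, rfl⟩ := EX0_surj s x
    rw [trans_apply, Ext.mk₀_comp_mk₀, ev0_mk₀, ev0_mk₀]
    rfl)

lemma HL.ev_of (t : ℕ) (g : ModuleCat.of R (R ⧸ a ^ t) ⟶ ModuleCat.of R M) : HL.ev a M (HL.of t (Ext.mk₀ g)) = g.hom (Ideal.Quotient.mk _ 1) :=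
  (Module.DirectLimit.lift_of _ _ _).trans (ev0_mk₀ t g)

lemma HL.ev_map (g : M →ₗ[R] N) (x : HL a 0 M) : HL.ev a N (HL.map a 0 g x) = g (HL.ev a M x) := by
  obtain ⟨t, y, rfl⟩ := HL.exists_of x
  obtain ⟨q, rfl⟩ := EX0_surj t y
  rw [HL.map_of, Ext.mk₀_comp_mk₀, HL.ev_of, HL.ev_of]
  rfl

lemma HL.ev_injective : Function.Injective (HL.ev a M) := by
  rw [injective_iff_map_eq_zero]
  intro x hx
  obtain ⟨t, y, rfl⟩ := HL.exists_of x
  obtain ⟨q, rfl⟩ := EX0_surj t y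
  rw [HL.ev_of] at hx
  have : q = 0 := by
    ext1
    refine LinearMap.ext fun x => ?_
    obtain ⟨x, rfl⟩ := Ideal.Quotient.mk_surjective x
    have : Ideal.Quotient.mk (a ^ t) x = x • Ideal.Quotient.mk (a ^ t) 1 := by
      rw [← Ideal.Quotient.mk_eq_mk, ← Ideal.Quotient.mk_eq_mk, ← Submodule.Quotient.mk_smul]; simp
    rw [this]
    refine (_root_.map_smul q.hom x _).trans ?_
    rw [hx, smul_zero]; rfl
  rw [this, Ext.mk₀_zero, _root_.map_zero]

lemma HL.range_ev : LinearMap.range (HL.ev a M) = Gam a M := by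
  apply le_antisymm
  · rintro _ ⟨x, rfl⟩
    obtain ⟨t, h⟩ := HL.torsion x
    exact ⟨t, fun r hr => by rw [← _root_.map_smul, h r hr, _root_.map_zero]⟩
  · rintro m ⟨t, ht⟩
    let q : (R ⧸ a ^ t) →ₗ[R] M := Submodule.liftQ (a ^ t) (LinearMap.toSpanSingleton R M m) (by
      intro r hr; simpa using ht r hr)
    refine ⟨HL.of t (Ext.mk₀ (ModuleCat.ofHom q)), ?_⟩
    rw [HL.ev_of]
    change q (Submodule.Quotient.mk 1) = m
    simp only [q]
    rw [Submodule.liftQ_apply]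
    simp
end
end LHV
end PartC

section PartD
set_option autoImplicit false
open CategoryTheory Opposite Abelian Limits

namespace LHV
variable {R : Type u} [CommRing R]

lemma exists_inj_embed (M : Type u) [AddCommGroup M] [Module R M] :
    ∃ (J : Type u) (_ : AddCommGroup J) (_ : Module R J) (_ : Module.Injective R J) (f : M →ₗ[R] J), Function.Injective f := by
  let I : ModuleCat.{u} R := CategoryTheory.Injective.under (ModuleCat.of R M)
  let f : ModuleCat.of R M ⟶ I := CategoryTheory.Injective.ι (ModuleCat.of R M)
  have hf : Mono f := inferInstanceAs (Mono (CategoryTheory.Injective.ι (ModuleCat.of R M)))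
  refine ⟨I, inferInstance, inferInstance, ?_, f.hom, ?_⟩
  · have : CategoryTheory.Injective (ModuleCat.of R I) :=
      inferInstanceAs (CategoryTheory.Injective (CategoryTheory.Injective.under (ModuleCat.of R M)))
    exact Module.injective_module_of_injective_object R _
  · exact (ModuleCat.mono_iff_injective _).1 hf

/-- quotient short exact sequence -/
lemma SES.quot {M : Type u} [AddCommGroup M] [Module R M] (N : Submodule R M) : SES N.subtype N.mkQ :=
  ⟨N.injective_subtype, N.mkQ_surjective, by rw [LinearMap.exact_iff]; simp⟩

lemma SES.ofInj {A M : Type u} [AddCommGroup M] [Module R M] [AddCommGroup A] [Module R A] (f : A →ₗ[R] M)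
    (hf : Function.Injective f) : SES f (LinearMap.range f).mkQ :=
  ⟨hf, Submodule.mkQ_surjective _, by rw [LinearMap.exact_iff]; simp⟩

lemma SES.ofSurj {A M : Type u} [AddCommGroup M] [Module R M] [AddCommGroup A] [Module R A] (f : A →ₗ[R] M)
    (hf : Function.Surjective f) : SES (LinearMap.ker f).subtype f :=
  ⟨Submodule.injective_subtype _, hf, by rw [LinearMap.exact_iff]; simp⟩

section AR
variable [IsNoetherianRing R]

/-- extension with control of torsion -/
lemma ar_extend (a : Ideal R) {L J : Type u} [AddCommGroup L] [Module R L] [Module.Finite R L] [AddCommGroup J] [Module R J]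
    [Module.Injective R J] (N : Submodule R L) (φ : N →ₗ[R] J) (t : ℕ) (h : ∀ r ∈ a ^ t, r • φ = 0) :
    ∃ ψ : L →ₗ[R] J, (∀ x : N, ψ x = φ x) ∧ ∃ s : ℕ, ∀ r ∈ a ^ s, r • ψ = 0 := by
  obtain ⟨k, hk⟩ := a.exists_pow_inf_eq_pow_smul N
  let W : Submodule R L := a ^ (t + k) • ⊤
  have hW : ∀ x : N, (x : L) ∈ W → φ x = 0 := by
    intro x hx
    have h1 : (x : L) ∈ a ^ (t + k) • (⊤ : Submodule R L) ⊓ N := ⟨hx, x.2⟩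
    rw [hk _ (by lia), Nat.add_sub_cancel] at h1
    have h2 : (x : L) ∈ a ^ t • N := Submodule.smul_mono le_rfl inf_le_right h1
    have h3 : x ∈ a ^ t • (⊤ : Submodule R N) := by
      have : (a ^ t • (⊤ : Submodule R N)).map N.subtype = a ^ t • N := by
        rw [Submodule.map_smul'', Submodule.map_top, Submodule.range_subtype]
      rw [← this] at h2
      obtain ⟨y, hy, hyx⟩ := h2
      rwa [← Subtype.ext hyx]
    refine Submodule.smul_induction_on h3 ?_ ?_
    · intro r hr n _
      rw [map_smul]
      exact LinearMap.congr_fun (h r hr) n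
    · intro x y hx hy; rw [map_add, hx, hy, add_zero]
  let W' : Submodule R N := W.comap N.subtype
  let f : (N ⧸ W') →ₗ[R] (L ⧸ W) := W'.mapQ W N.subtype le_rfl
  have hf : Function.Injective f := by
    rw [← LinearMap.ker_eq_bot, Submodule.ker_mapQ]
    rw [Submodule.mkQ_map_self]
  let g : (N ⧸ W') →ₗ[R] J := W'.liftQ φ (by intro x hx; exact hW x hx)
  obtain ⟨q, hq⟩ := Module.Injective.out f hf g
  refine ⟨q ∘ₗ W.mkQ, fun x => ?_, t + k, fun r hr => ?_⟩
  · exact hq (W'.mkQ x)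
  · ext x
    rw [LinearMap.smul_apply, ← map_smul, LinearMap.comp_apply, Submodule.mkQ_apply]
    have : (Submodule.Quotient.mk (r • x) : L ⧸ W) = 0 := by
      rw [Submodule.Quotient.mk_eq_zero]
      exact Submodule.smul_mem_smul hr trivial
    rw [this, map_zero]; rfl

lemma Gam_injective (c : Ideal R) (J : Type u) [AddCommGroup J] [Module R J] [Module.Injective R J] :
    Module.Injective R (Gam c J) := by
  apply Module.Baer.injective
  intro I g
  have hfg : ∃ t : ℕ, ∀ r ∈ c ^ t, r • g = 0 := by
    have h1 : ∀ s : Finset I, ∃ t : ℕ, ∀ x ∈ s, ∀ r ∈ c ^ t, r • g x = 0 := by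
      classical
      intro s
      induction s using Finset.induction_on with
      | empty => exact ⟨0, by simp⟩
      | insert x s _ ih =>
        obtain ⟨t, ht⟩ := ih
        obtain ⟨v, hv⟩ := (g x).2
        refine ⟨t + v, fun y hy r hr => ?_⟩
        rcases Finset.mem_insert.1 hy with rfl | hy
        · exact Subtype.ext (hv r (Ideal.pow_le_pow_right (by lia) hr))
        · exact ht y hy r (Ideal.pow_le_pow_right (by lia) hr)
    obtain ⟨s, hs⟩ := (Module.Finite.fg_top : (⊤ : Submodule R I).FG)
    obtain ⟨t, ht⟩ := h1 s
    refine ⟨t, fun r hr => ?_⟩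
    refine LinearMap.ext_on hs ?_
    intro x hx
    exact ht x hx r hr
  obtain ⟨t, ht⟩ := hfg
  obtain ⟨ψ, h1, s, hs⟩ := ar_extend c I ((Gam c J).subtype ∘ₗ g) t (by
    intro r hr
    rw [← LinearMap.comp_smul, ht r hr, LinearMap.comp_zero])
  refine ⟨LinearMap.codRestrict _ ψ (fun x => ⟨s, fun r hr => LinearMap.congr_fun (hs r hr) x⟩), ?_⟩
  intro x hx
  exact Subtype.ext (h1 ⟨x, hx⟩)

end AR

/-- torsion modules -/
def Tor (c : Ideal R) (X : Type u) [AddCommGroup X] [Module R X] : Prop := ∀ x : X, x ∈ Gam c X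

lemma Tor.quot {c : Ideal R} {X : Type u} [AddCommGroup X] [Module R X] (h : Tor c X) (N : Submodule R X) : Tor c (X ⧸ N) := by
  intro x
  obtain ⟨x, rfl⟩ := N.mkQ_surjective x
  obtain ⟨t, ht⟩ := h x
  exact ⟨t, fun r hr => by rw [← map_smul, ht r hr, map_zero]⟩

lemma Tor_Gam (c : Ideal R) (X : Type u) [AddCommGroup X] [Module R X] : Tor c (Gam c X) := by
  rintro ⟨x, t, ht⟩
  exact ⟨t, fun r hr => Subtype.ext (ht r hr)⟩

lemma Tor.embed [IsNoetherianRing R] {c : Ideal R} {X : Type u} [AddCommGroup X] [Module R X] (h : Tor c X) :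
    ∃ (J : Type u) (_ : AddCommGroup J) (_ : Module R J) (_ : Module.Injective R J) (f : X →ₗ[R] J), Function.Injective f ∧ Tor c J := by
  obtain ⟨J, _, _, _, f, hf⟩ := exists_inj_embed (R := R) X
  refine ⟨Gam c J, inferInstance, inferInstance, Gam_injective c J, LinearMap.codRestrict _ f ?_, ?_, Tor_Gam c J⟩
  · intro x
    obtain ⟨t, ht⟩ := h x
    exact ⟨t, fun r hr => by rw [← map_smul, ht r hr, map_zero]⟩
  · intro x y hxy
    exact hf (congrArg Subtype.val hxy)

/-- HL in degree 0 as Gam -/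
def HL.zeroEquiv (a : Ideal R) (M : Type u) [AddCommGroup M] [Module R M] : HL a 0 M ≃ₗ[R] Gam a M :=
  LinearEquiv.ofInjective (HL.ev a M) HL.ev_injective ≪≫ₗ LinearEquiv.ofEq _ _ HL.range_ev

lemma HL.zeroEquiv_coe (a : Ideal R) (M : Type u) [AddCommGroup M] [Module R M] (x : HL a 0 M) :
   (HL.zeroEquiv a M x : M) = HL.ev a M x := rfl

section
variable {a b c : Ideal R} {i : ℕ} {A B C : Type u} [AddCommGroup A] [Module R A] [AddCommGroup B] [Module R B] [AddCommGroup C] [Module R C]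
  {f : A →ₗ[R] B} {g : B →ₗ[R] C}

lemma HL.map_zero_surj (g : B →ₗ[R] C) (h : ∀ x ∈ Gam a C, ∃ y ∈ Gam a B, g y = x) : Function.Surjective (HL.map a 0 g) := by
  intro x
  have hx : HL.ev a C x ∈ Gam a C := by rw [← HL.range_ev]; exact ⟨x, rfl⟩
  obtain ⟨y, hy, hyx⟩ := h _ hx
  rw [← HL.range_ev] at hy
  obtain ⟨z, rfl⟩ := hy
  refine ⟨z, HL.ev_injective ?_⟩
  rw [HL.ev_map, hyx]

/-- H^1(A)=0 if H^1(B)=0 and Gam is onto -/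
lemma SES.vanish1 (S : SES f g) (h : ∀ x ∈ Gam a C, ∃ y ∈ Gam a B, g y = x) (hB : Subsingleton (HL a 1 B)) :
    Subsingleton (HL a 1 A) := by
  refine subsingleton_of_forall_eq 0 fun x => ?_
  obtain ⟨y, rfl⟩ := ((S.ex₁ (a := a) (i := 0)) x).1 (Subsingleton.elim _ _)
  obtain ⟨z, rfl⟩ := HL.map_zero_surj g h y
  exact (S.ex₃ (a := a) (i := 0)).apply_apply_eq_zero z

lemma SES.vanishA (S : SES f g) (hC : Subsingleton (HL a i C)) (hB : Subsingleton (HL a (i+1) B)) :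
    Subsingleton (HL a (i+1) A) := by
  refine subsingleton_of_forall_eq 0 fun x => ?_
  obtain ⟨y, rfl⟩ := ((S.ex₁ (a := a) (i := i)) x).1 (Subsingleton.elim _ _)
  rw [Subsingleton.elim y 0, _root_.map_zero]

lemma SES.vanishB (S : SES f g) (hC : Subsingleton (HL a i C)) (hA : Subsingleton (HL a i A)) :
    Subsingleton (HL a i B) := by
  refine subsingleton_of_forall_eq 0 fun x => ?_
  obtain ⟨y, rfl⟩ := ((S.ex₂ (a := a) (i := i)) x).1 (Subsingleton.elim _ _)
  rw [Subsingleton.elim y 0, _root_.map_zero]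

lemma SES.vanishC (S : SES f g) (hB : Subsingleton (HL a i B)) (hA : Subsingleton (HL a (i+1) A)) :
    Subsingleton (HL a i C) := by
  refine subsingleton_of_forall_eq 0 fun x => ?_
  obtain ⟨y, rfl⟩ := ((S.ex₃ (a := a) (i := i)) x).1 (Subsingleton.elim _ _)
  rw [Subsingleton.elim y 0, _root_.map_zero]

lemma HL.surj_of (S : SES f g) (hA : Subsingleton (HL a (i+1) A)) : Function.Surjective (HL.map a i g) := fun x =>
  ((S.ex₃ (a := a) (i := i)) x).1 (Subsingleton.elim _ _)

lemma HL.inj_sub [Module.Injective R A] : Subsingleton (HL a (i+1) A) :=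
  subsingleton_of_forall_eq 0 fun x => HL.injective_vanish x

lemma Tor.vanish [IsNoetherianRing R] {X : Type u} [AddCommGroup X] [Module R X] (h : Tor a X) (i : ℕ) : Subsingleton (HL a (i+1) X) := by
  induction i generalizing X with
  | zero =>
    obtain ⟨J, _, _, _, f, hf, hJ⟩ := h.embed
    refine (SES.ofInj f hf).vanish1 ?_ HL.inj_sub
    intro x _
    obtain ⟨y, rfl⟩ := Submodule.mkQ_surjective _ x
    exact ⟨y, hJ y, rfl⟩
  | succ i ih =>
    obtain ⟨J, _, _, _, f, hf, hJ⟩ := h.embed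
    exact (SES.ofInj f hf).vanishA (ih (hJ.quot _)) HL.inj_sub

/-- independence of the ideal on torsion modules -/
lemma indep [IsNoetherianRing R] (hab : ∀ (Y : Type u) [AddCommGroup Y] [Module R Y], Tor c Y → Gam a Y = Gam b Y)
    {X : Type u} [AddCommGroup X] [Module R X] (h : Tor c X) (i : ℕ) : Nonempty (HL a i X ≃ₗ[R] HL b i X) := by
  have e0 : ∀ (Y : Type u) [AddCommGroup Y] [Module R Y], Tor c Y → ∃ e : HL a 0 Y ≃ₗ[R] HL b 0 Y, ∀ x, HL.ev b Y (e x) = HL.ev a Y x := by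
    intro Y _ _ hY
    refine ⟨HL.zeroEquiv a Y ≪≫ₗ LinearEquiv.ofEq _ _ (hab Y hY) ≪≫ₗ (HL.zeroEquiv b Y).symm, fun x => ?_⟩
    rw [← HL.zeroEquiv_coe]
    simp only [LinearEquiv.trans_apply, LinearEquiv.apply_symm_apply]
    rfl
  have shift : ∀ (a : Ideal R) (i : ℕ) {X J : Type u} [AddCommGroup X] [Module R X] [AddCommGroup J] [Module R J] [Module.Injective R J]
    (f : X →ₗ[R] J) (hf : Function.Injective f), Nonempty ((HL a i (J ⧸ LinearMap.range f) ⧸ (LinearMap.range (HL.map a i (LinearMap.range f).mkQ))) ≃ₗ[R] HL a (i+1) X) := by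
    intro a i X J _ _ _ _ _ f hf
    have hs : Function.Surjective ((SES.ofInj f hf).δ a i) := fun x =>
      ((SES.ofInj f hf).ex₁ (a := a) (i := i) x).1 (HL.injective_vanish _)
    refine ⟨Submodule.quotEquivOfEq _ _ ?_ ≪≫ₗ LinearMap.quotKerEquivOfSurjective _ hs⟩
    exact ((LinearMap.exact_iff.1 ((SES.ofInj f hf).ex₃ (a := a) (i := i)))).symm
  induction i generalizing X with
  | zero => exact ⟨(e0 X h).choose⟩
  | succ i ih =>
    obtain ⟨J, _, _, _, f, hf, hJ⟩ := h.embed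
    obtain ⟨ea⟩ := shift a i f hf
    obtain ⟨eb⟩ := shift b i f hf
    cases i with
    | zero =>
      obtain ⟨e, he⟩ := e0 _ (hJ.quot (LinearMap.range f))
      obtain ⟨e', he'⟩ := e0 _ hJ
      refine ⟨ea.symm ≪≫ₗ Submodule.Quotient.equiv _ _ e ?_ ≪≫ₗ eb⟩
      have key : ∀ x, e (HL.map a 0 (LinearMap.range f).mkQ x) = HL.map b 0 (LinearMap.range f).mkQ (e' x) := by
        intro x
        apply HL.ev_injective
        rw [he, HL.ev_map, HL.ev_map, he']
      ext y
      constructor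
      · rintro ⟨_, ⟨x, rfl⟩, rfl⟩
        exact ⟨e' x, (key x).symm⟩
      · rintro ⟨x, rfl⟩
        refine ⟨_, ⟨e'.symm x, rfl⟩, ?_⟩
        refine (key _).trans ?_
        rw [LinearEquiv.apply_symm_apply]
    | succ i =>
      obtain ⟨e⟩ := ih (hJ.quot (LinearMap.range f))
      have tr : ∀ a : Ideal R, LinearMap.range (HL.map a (i+1) (LinearMap.range f).mkQ) = ⊥ := by
        intro a
        rw [LinearMap.range_eq_bot]
        ext x
        rw [HL.injective_vanish x, _root_.map_zero]; rfl
      refine ⟨ea.symm ≪≫ₗ Submodule.Quotient.equiv _ _ e ?_ ≪≫ₗ eb⟩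
      rw [tr, tr, Submodule.map_bot]

lemma Gam_eq_of_radical [IsNoetherianRing R] (hab : (a ⊔ c).radical = (b ⊔ c).radical) (Y : Type u) [AddCommGroup Y] [Module R Y] (hY : Tor c Y) :
    Gam a Y = Gam b Y := by
  have main : ∀ a b : Ideal R, b ≤ (a ⊔ c).radical → Gam a Y ≤ Gam b Y := by
    rintro a b hab y ⟨t, ht⟩
    obtain ⟨s, hs⟩ := hY y
    obtain ⟨k, hk⟩ := Ideal.exists_pow_le_of_le_radical_of_fg hab (IsNoetherian.noetherian b)
    have h1 : ∀ r ∈ (a ⊔ c) ^ (t + s), r • y = 0 := by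
      intro r hr
      have := Ideal.sup_pow_add_le_pow_sup_pow hr
      obtain ⟨u, hu, v, hv, rfl⟩ := Submodule.mem_sup.1 this
      rw [add_smul, ht u hu, hs v hv, add_zero]
    refine ⟨k * (t + s), fun r hr => h1 r ?_⟩
    rw [pow_mul] at hr
    exact Ideal.pow_right_mono hk _ hr
  apply le_antisymm
  · exact main a b (le_trans (le_trans le_sup_left Ideal.le_radical) hab.ge)
  · exact main b a (le_trans (le_trans le_sup_left Ideal.le_radical) hab.le)
end

section Hom

lemma hom_flat_injective (F J : Type u) [AddCommGroup F] [Module R F] [Module.Flat R F] [AddCommGroup J] [Module R J] [Module.Injective R J] :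
    Module.Injective R (F →ₗ[R] J) := by
  constructor
  intro X Y _ _ _ _ f hf g
  have h1 : Function.Injective (f.rTensor F) := Module.Flat.rTensor_preserves_injective_linearMap f hf
  obtain ⟨h, hh⟩ := Module.Injective.out (f.rTensor F) h1 (TensorProduct.lift g)
  refine ⟨TensorProduct.curry h, fun x => ?_⟩
  ext m
  exact hh (TensorProduct.tmul R x m)

lemma hom_exact {A B C J : Type u} [AddCommGroup A] [Module R A] [AddCommGroup B] [Module R B] [AddCommGroup C] [Module R C]
    {f : A →ₗ[R] B} {g : B →ₗ[R] C} [AddCommGroup J] [Module R J] [Module.Injective R J] (S : Function.Exact f g) :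
    Function.Exact (g.lcomp R J) (f.lcomp R J) := by
  intro x
  constructor
  · intro hx
    have hx' : LinearMap.ker g ≤ LinearMap.ker x := by
      intro y hy
      obtain ⟨z, rfl⟩ := (S y).1 hy
      exact LinearMap.congr_fun hx z
    obtain ⟨h, hh⟩ := Module.Injective.out ((LinearMap.ker g).liftQ g le_rfl)
      (LinearMap.ker_eq_bot.1 (Submodule.ker_liftQ_eq_bot _ _ _ le_rfl)) ((LinearMap.ker g).liftQ x hx')
    exact ⟨h, LinearMap.ext fun y => hh (Submodule.Quotient.mk y)⟩
  · rintro ⟨y, rfl⟩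
    ext z
    change y (g (f z)) = 0
    rw [S.apply_apply_eq_zero, map_zero]

lemma SES.hom {A B C : Type u} [AddCommGroup A] [Module R A] [AddCommGroup B] [Module R B] [AddCommGroup C] [Module R C]
    {f : A →ₗ[R] B} {g : B →ₗ[R] C} (S : SES f g) (J : Type u) [AddCommGroup J] [Module R J] [Module.Injective R J] :
    SES (g.lcomp R J) (f.lcomp R J) := by
  refine ⟨fun x y hxy => (LinearMap.cancel_right S.surj).1 hxy, fun x => ?_, hom_exact S.ex⟩
  obtain ⟨h, hh⟩ := Module.Injective.out f S.inj x
  exact ⟨h, LinearMap.ext hh⟩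

lemma hom_acyclic [IsNoetherianRing R] (a : Ideal R) (N J : Type u) [AddCommGroup N] [Module R N] [Module.Finite R N] [AddCommGroup J] [Module R J] [Module.Injective R J]
   (i : ℕ) : Subsingleton (HL a (i+1) (N →ₗ[R] J)) := by
  induction i generalizing N with
  | zero =>
    obtain ⟨n, q, hq⟩ := Module.Finite.exists_fin' R N
    have := hom_flat_injective (R := R) (Fin n → R) J
    refine ((SES.ofSurj q hq).hom J).vanish1 ?_ HL.inj_sub
    rintro x ⟨t, ht⟩
    obtain ⟨ψ, h1, s, hs⟩ := ar_extend a _ x t ht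
    exact ⟨ψ, ⟨s, hs⟩, LinearMap.ext h1⟩
  | succ i ih =>
    obtain ⟨n, q, hq⟩ := Module.Finite.exists_fin' R N
    have := hom_flat_injective (R := R) (Fin n → R) J
    exact ((SES.ofSurj q hq).hom J).vanishA (ih _) HL.inj_sub

end Hom
end LHV
end PartD

section PartE
set_option autoImplicit false
open scoped Pointwise

namespace LHV
variable {R : Type u} [CommRing R]

section
variable {M N : Type u} [AddCommGroup M] [Module R M] [AddCommGroup N] [Module R N]

/-- dimension less than `k` -/
def DL (R : Type u) [CommRing R] (M : Type u) [AddCommGroup M] [Module R M] (k : ℕ) : Prop := Module.supportDim R M < ((k : ℕ∞) : WithBot ℕ∞)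

lemma DL.zero (h : DL R M 0) : Subsingleton M := by
  rw [← Module.supportDim_eq_bot_iff_subsingleton R]
  have h' : Module.supportDim R M < (0 : WithBot ℕ∞) := h
  by_contra hb
  obtain ⟨a, ha⟩ := WithBot.ne_bot_iff_exists.1 hb
  rw [← ha] at h'
  exact absurd (WithBot.coe_lt_coe.1 h') (by simp)

lemma DL.of_subsingleton [Subsingleton M] (k : ℕ) : DL R M k := by
  unfold DL
  rw [Module.supportDim_eq_bot_of_subsingleton]
  exact WithBot.bot_lt_coe _

lemma succ_le_lt {x y : WithBot ℕ∞} {k : ℕ} (h : x + 1 ≤ y) (hy : y < (((k+1 : ℕ) : ℕ∞) : WithBot ℕ∞)) : x < ((k : ℕ∞) : WithBot ℕ∞) := by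
  have h1 := lt_of_le_of_lt h hy
  cases x with
  | bot => exact WithBot.bot_lt_coe _
  | coe x =>
    rw [← WithBot.coe_one, ← WithBot.coe_add, WithBot.coe_lt_coe] at h1
    rw [WithBot.coe_lt_coe]
    push_cast at h1
    exact lt_of_add_lt_add_right h1

lemma le_succ_lt {x y : WithBot ℕ∞} {k : ℕ} (h : y ≤ x + 1) (hy : x < ((k : ℕ∞) : WithBot ℕ∞)) : y < (((k+1 : ℕ) : ℕ∞) : WithBot ℕ∞) := by
  refine lt_of_le_of_lt h ?_
  cases x with
  | bot => exact WithBot.bot_lt_coe _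
  | coe x =>
    rw [WithBot.coe_lt_coe] at hy
    rw [← WithBot.coe_one, ← WithBot.coe_add, WithBot.coe_lt_coe]
    push_cast
    lift x to ℕ using ne_top_of_lt hy
    norm_cast at hy ⊢
    lia

lemma DL.mono {k l : ℕ} (h : DL R M k) (hkl : k ≤ l) : DL R M l :=
  lt_of_lt_of_le h (by norm_cast)

lemma DL.supp {k : ℕ} (h : DL R M k) (hs : Module.support R N ⊆ Module.support R M) : DL R N k :=
  lt_of_le_of_lt (Order.krullDim_le_of_strictMono (fun a ↦ (⟨a.1, hs a.2⟩ : Module.support R M)) (fun {_ _} lt ↦ lt)) h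

lemma DL.inj {k : ℕ} (h : DL R M k) (f : N →ₗ[R] M) (hf : Function.Injective f) : DL R N k :=
  h.supp (Module.support_subset_of_injective f hf)

lemma DL.surj {k : ℕ} (h : DL R M k) (f : M →ₗ[R] N) (hf : Function.Surjective f) : DL R N k :=
  h.supp (Module.support_subset_of_surjective f hf)

lemma DL.reg [IsNoetherianRing R] [Module.Finite R M] {k : ℕ} (h : DL R M (k+1)) {x : R} (hx : IsSMulRegular M x) : DL R (QuotSMulTop x M) k :=
  succ_le_lt (Module.supportDim_quotSMulTop_succ_le_of_notMem_minimalPrimes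
    (fun _ => hx.notMem_of_mem_minimalPrimes)) h

lemma DL.of_quot [IsNoetherianRing R] [IsLocalRing R] [Module.Finite R M] {k : ℕ} {x : R} (hx : x ∈ IsLocalRing.maximalIdeal R) (h : DL R (QuotSMulTop x M) k) : DL R M (k+1) :=
  le_succ_lt (Module.supportDim_le_supportDim_quotSMulTop_succ hx) h

lemma DL.prime [IsNoetherianRing R] {p : Ideal R} [p.IsPrime] {n : ℕ} (h : DL R (R ⧸ p) (n+1)) [Module.Finite R M]
    (hp : ∀ r ∈ p, ∀ m : M, r • m = 0) {x : R} (hx : x ∉ p) (hxM : ∀ m : M, x • m = 0) : DL R M n := by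
  have h1 : IsSMulRegular (R ⧸ p) x := by
    intro u v huv
    obtain ⟨u, rfl⟩ := Ideal.Quotient.mk_surjective u
    obtain ⟨v, rfl⟩ := Ideal.Quotient.mk_surjective v
    have : Ideal.Quotient.mk p (x * u) = Ideal.Quotient.mk p (x * v) := huv
    rw [Ideal.Quotient.eq, ← mul_sub] at this
    exact Ideal.Quotient.eq.2 ((Ideal.IsPrime.mem_or_mem ‹_› this).resolve_left hx)
  refine (h.reg h1).supp ?_
  rw [Module.support_quotSMulTop, Module.support_eq_zeroLocus, Module.support_eq_zeroLocus, Ideal.annihilator_quotient]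
  intro q hq
  rw [PrimeSpectrum.mem_zeroLocus] at hq
  refine ⟨fun r hr => hq (Module.mem_annihilator.2 (hp r hr)), ?_⟩
  rw [PrimeSpectrum.mem_zeroLocus, Set.singleton_subset_iff]
  exact hq (Module.mem_annihilator.2 hxM)

lemma HL.sub_of_sub {a : Ideal R} {i : ℕ} [Subsingleton M] : Subsingleton (HL a i M) :=
  subsingleton_of_forall_eq 0 fun x => by
    rw [← one_smul R x]; exact HL.smul_eq_zero_of 1 (fun m => Subsingleton.elim _ _) x

lemma Gam_quot [IsNoetherianRing R] (a : Ideal R) [Module.Finite R M] : Gam a (M ⧸ Gam a M) = ⊥ := by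
  rw [eq_bot_iff]
  rintro x ⟨t, ht⟩
  obtain ⟨x, rfl⟩ := Submodule.mkQ_surjective _ x
  simp only [← map_smul] at ht
  rw [Submodule.mem_bot, ← LinearMap.mem_ker, Submodule.ker_mkQ]
  have h1 : ∀ r ∈ a ^ t, r • x ∈ Gam a M := fun r hr => by
    have := ht r hr
    rwa [← LinearMap.mem_ker, Submodule.ker_mkQ] at this
  -- uniform exponent
  obtain ⟨s, hs⟩ : ∃ s : ℕ, ∀ y ∈ Gam a M, ∀ r ∈ a ^ s, r • y = 0 := by
    have h1 : ∀ S : Finset M, (S : Set M) ⊆ Gam a M → ∃ t : ℕ, ∀ x ∈ S, ∀ r ∈ a ^ t, r • x = 0 := by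
      classical
      intro s
      induction s using Finset.induction_on with
      | empty => intro _; exact ⟨0, by simp⟩
      | insert x s _ ih =>
        intro hS
        rw [Finset.coe_insert, Set.insert_subset_iff] at hS
        obtain ⟨t, ht⟩ := ih hS.2
        obtain ⟨v, hv⟩ := hS.1
        refine ⟨t + v, fun y hy r hr => ?_⟩
        rcases Finset.mem_insert.1 hy with rfl | hy
        · exact hv r (Ideal.pow_le_pow_right (by lia) hr)
        · exact ht y hy r (Ideal.pow_le_pow_right (by lia) hr)
    obtain ⟨S, hS⟩ := (IsNoetherian.noetherian (Gam a M) : (Gam a M).FG)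
    obtain ⟨t, ht⟩ := h1 S (by rw [← hS]; exact Submodule.subset_span)
    refine ⟨t, fun y hy r hr => ?_⟩
    rw [← hS] at hy
    induction hy using Submodule.span_induction with
    | mem x h => exact ht x h r hr
    | zero => simp
    | add x y _ _ hx hy => rw [smul_add, hx, hy, add_zero]
    | smul c x _ hx => rw [smul_comm, hx, smul_zero]
  refine ⟨s + t, fun r hr => ?_⟩
  rw [pow_add] at hr
  refine Submodule.mul_induction_on hr ?_ ?_
  · intro u hu v hv
    rw [mul_smul]; exact hs _ (h1 v hv) u hu
  · intro u v hu hv; rw [add_smul, hu, hv, add_zero]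

lemma exists_reg [IsNoetherianRing R] (a : Ideal R) [Module.Finite R M] (h : Gam a M = ⊥) : ∃ x ∈ a, IsSMulRegular M x := by
  by_contra! hc
  have h1 : (a : Set R) ⊆ ⋃ p ∈ associatedPrimes R M, p := by
    rw [biUnion_associatedPrimes_eq_compl_regular]
    intro x hx; exact hc x hx
  obtain ⟨p, hp, hap⟩ := (a.subset_union_prime_finite (associatedPrimes.finite R M) (f := id) 0 0 fun _ h _ _ ↦ h.1).1 h1
  rw [AssociatedPrimes.mem_iff, isAssociatedPrime_iff] at hp
  obtain ⟨hp, x, rfl⟩ := hp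
  have hx : x ∈ Gam a M := ⟨1, fun r hr => by
    rw [pow_one] at hr
    have := hap hr
    simpa [Submodule.mem_colon_singleton] using this⟩
  rw [h, Submodule.mem_bot] at hx
  apply hp.ne_top
  rw [Ideal.eq_top_iff_one]
  simp [Submodule.mem_colon_singleton, hx]

lemma SES.mulReg {x : R} (hx : IsSMulRegular M x) : SES (LinearMap.lsmul R M x) (Submodule.mkQ (x • (⊤ : Submodule R M))) := by
  refine ⟨hx, Submodule.mkQ_surjective _, ?_⟩
  rw [LinearMap.exact_iff, Submodule.ker_mkQ]
  ext y
  rw [Submodule.mem_smul_pointwise_iff_exists]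
  simp

lemma HL.map_lsmul (a : Ideal R) (i : ℕ) (x : R) (y : HL a i M) : HL.map a i (LinearMap.lsmul R M x) y = x • y := by
  have : LinearMap.lsmul R M x = x • LinearMap.id := by ext; simp
  rw [this, HL.map_smul, HL.map_id]; rfl

theorem grothendieck [IsNoetherianRing R] (a : Ideal R) (k : ℕ) [Module.Finite R M] (h : DL R M k) (i : ℕ) (hi : k ≤ i) : Subsingleton (HL a i M) := by
  induction k generalizing M i with
  | zero =>
    have := h.zero
    exact HL.sub_of_sub
  | succ k ih =>
    obtain ⟨i, rfl⟩ : ∃ j, i = j + 1 := ⟨i - 1, by lia⟩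
    refine (SES.quot (Gam a M)).vanishB ?_ ((Tor_Gam a M).vanish i)
    obtain ⟨x, hxa, hx⟩ := exists_reg a (Gam_quot (M := M) a)
    have h2 := ih ((h.surj _ (Submodule.mkQ_surjective (Gam a M))).reg hx) i (by lia)
    have hinj : ∀ y : HL a (i+1) (M ⧸ Gam a M), x • y = 0 → y = 0 := by
      intro y hy
      rw [← HL.map_lsmul] at hy
      obtain ⟨z, rfl⟩ := ((SES.mulReg hx).ex₁ (a := a) (i := i) y).1 hy
      rw [h2.elim z 0, _root_.map_zero]
    refine subsingleton_of_forall_eq 0 fun y => ?_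
    obtain ⟨t, ht⟩ := HL.torsion y
    have h3 : x ^ t • y = 0 := ht _ (Ideal.pow_mem_pow hxa t)
    clear ht
    induction t with
    | zero => simpa using h3
    | succ t iht =>
      rw [pow_succ', mul_smul] at h3
      exact iht (hinj _ h3)

/-- top local cohomology is right exact -/
lemma HL.right_exact [IsNoetherianRing R] (a : Ideal R) {n : ℕ} [Module.Finite R M] (h : DL R M (n+1)) (f : M →ₗ[R] N) (hf : Function.Surjective f) :
    Function.Surjective (HL.map a n f) :=
  HL.surj_of (SES.ofSurj f hf) (grothendieck a (n+1) (h.inj _ (Submodule.injective_subtype _)) _ le_rfl)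

/-- vanishing lemma -/
lemma HL.vanishV [IsNoetherianRing R] (a : Ideal R) {n : ℕ} (hM : Module.Finite R M)
    (hq : ∀ q : PrimeSpectrum R, q ∈ Module.support R M → Subsingleton (HL a n (R ⧸ q.1))) : Subsingleton (HL a n M) := by
  revert hq
  refine IsNoetherianRing.induction_on_isQuotientEquivQuotientPrime R hM (motive := fun N _ _ _ => (∀ q : PrimeSpectrum R, q ∈ Module.support R N → Subsingleton (HL a n (R ⧸ q.1))) → Subsingleton (HL a n N)) ?_ ?_ ?_
  · intro N _ _ _ _ _
    exact HL.sub_of_sub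
  · intro N _ _ _ p e h
    have := h p (by rw [e.support_eq, Module.mem_support_iff_of_finite, Ideal.annihilator_quotient])
    exact (HL.congr a n e).toEquiv.subsingleton
  · intro N₁ _ _ _ N₂ _ _ _ N₃ _ _ _ f g hf hg hex h1 h3 h
    exact SES.vanishB ⟨hf, hg, hex⟩ (h3 fun q hq => h q (Module.support_subset_of_surjective g hg hq))
      (h1 fun q hq => h q (Module.support_subset_of_injective f hf hq))

/-- divisibility -/
lemma HL.divisible [IsNoetherianRing R] (a : Ideal R) {p : Ideal R} [p.IsPrime] {n : ℕ} (h : DL R (R ⧸ p) (n+1)) [Module.Finite R M]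
    (hp : ∀ r ∈ p, ∀ m : M, r • m = 0) {x : R} (hx : x ∉ p) (y : HL a n M) : ∃ z, x • z = y := by
  have hM : DL R M (n+1) := h.supp (by
    rw [Module.support_eq_zeroLocus, Module.support_eq_zeroLocus, Ideal.annihilator_quotient]
    exact PrimeSpectrum.zeroLocus_anti_mono_ideal fun r hr => Module.mem_annihilator.2 (hp r hr))
  let f : M →ₗ[R] M := LinearMap.lsmul R M x
  let r : M →ₗ[R] LinearMap.range f := f.rangeRestrict
  have h1 : Function.Surjective (HL.map a n r) := HL.right_exact a hM _ f.surjective_rangeRestrict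
  have h2 : Subsingleton (HL a n (M ⧸ LinearMap.range f)) := by
    refine grothendieck a n (DL.prime h ?_ hx ?_) n le_rfl
    · intro r hr m
      obtain ⟨m, rfl⟩ := Submodule.mkQ_surjective _ m
      rw [← _root_.map_smul, hp r hr, _root_.map_zero]
    · intro m
      obtain ⟨m, rfl⟩ := Submodule.mkQ_surjective _ m
      rw [← _root_.map_smul, ← LinearMap.mem_ker, Submodule.ker_mkQ]
      exact ⟨m, rfl⟩
  obtain ⟨w, rfl⟩ := ((SES.quot (LinearMap.range f)).ex₂ (a := a) (i := n) y).1 (Subsingleton.elim _ _)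
  obtain ⟨z, rfl⟩ := h1 w
  refine ⟨z, ?_⟩
  rw [← HL.map_lsmul, ← LinearMap.comp_apply, ← HL.map_comp]
  rfl

end
end LHV
end PartE

section PartF
set_option autoImplicit false
open IsLocalRing

namespace LHV
variable {R : Type u} [CommRing R]

lemma zorn_disj {X : Type u} [AddCommGroup X] [Module R X] (A D : Submodule R X) (h : Disjoint A D) :
    ∃ N : Submodule R X, A ≤ N ∧ Disjoint N D ∧ ∀ N', N ≤ N' → Disjoint N' D → N' = N := by
  obtain ⟨N, hAN, hN⟩ := zorn_le_nonempty₀ {N : Submodule R X | Disjoint N D} (by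
    intro c hc hch y hy
    refine ⟨sSup c, ?_, fun z hz => le_sSup hz⟩
    rw [Set.mem_ofPred_eq, DirectedOn.disjoint_sSup_left hch.directedOn]
    exact fun z hz => hc hz) A h
  exact ⟨N, hAN, hN.prop, fun N' h1 h2 => le_antisymm (hN.2 h2 h1) h1⟩

/-- injective hull of the residue field -/
structure IsE (R : Type u) [CommRing R] [IsLocalRing R] (E : Type u) [AddCommGroup E] [Module R E] : Prop where
  inj : Module.Injective R E
  tor : Tor (maximalIdeal R) E
  soc : ∃ c : E, c ≠ 0 ∧ (∀ r ∈ maximalIdeal R, r • c = 0) ∧ ∀ e : E, (∀ r ∈ maximalIdeal R, r • e = 0) → ∃ r : R, e = r • c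

section
variable [IsLocalRing R]

lemma Tor.socle [IsNoetherianRing R] {X : Type u} [AddCommGroup X] [Module R X] (h : Tor (maximalIdeal R) X) (x : X) (hx : x ≠ 0) :
    ∃ r : R, r • x ≠ 0 ∧ ∀ s ∈ maximalIdeal R, s • r • x = 0 := by
  obtain ⟨t, ht⟩ := h x
  have : ∃ t : ℕ, ∀ r ∈ maximalIdeal R ^ t, r • x = 0 := ⟨t, ht⟩
  classical
  let k := Nat.find this
  have hk : ∀ r ∈ maximalIdeal R ^ k, r • x = 0 := Nat.find_spec this
  have hk0 : k ≠ 0 := by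
    intro h0
    rw [h0] at hk
    exact hx (by simpa using hk 1 (by simp))
  obtain ⟨l, hl⟩ := Nat.exists_eq_succ_of_ne_zero hk0
  have := Nat.find_min this (m := l) (by change l < k; lia)
  push Not at this
  obtain ⟨r, hr, hrx⟩ := this
  refine ⟨r, hrx, fun s hs => ?_⟩
  rw [← mul_smul]
  apply hk
  rw [hl, Nat.succ_eq_add_one, pow_succ']
  exact Ideal.mul_mem_mul hs hr

theorem exists_E (R : Type u) [CommRing R] [IsLocalRing R] [IsNoetherianRing R] :
    ∃ (E : Type u) (_ : AddCommGroup E) (_ : Module R E), IsE R E := by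
  obtain ⟨G, _, _, _, ι, hι, hG⟩ := Tor.embed (c := maximalIdeal R) (X := R ⧸ maximalIdeal R) (by
    intro x
    refine ⟨1, fun r hr => ?_⟩
    rw [pow_one] at hr
    obtain ⟨x, rfl⟩ := Ideal.Quotient.mk_surjective x
    change Ideal.Quotient.mk _ (r * x) = 0
    rw [Ideal.Quotient.eq_zero_iff_mem]
    exact Ideal.mul_mem_right _ _ hr)
  let c : G := ι 1
  have hc0 : c ≠ 0 := by
    intro h
    exact one_ne_zero (hι (h.trans (map_zero ι).symm))
  have hcm : ∀ r ∈ maximalIdeal R, r • c = 0 := by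
    intro r hr
    change r • ι 1 = 0
    rw [← map_smul]
    have : r • (1 : R ⧸ maximalIdeal R) = 0 := by
      change Ideal.Quotient.mk _ (r * 1) = 0
      rw [Ideal.Quotient.eq_zero_iff_mem, mul_one]; exact hr
    rw [this, map_zero]
  have unit : ∀ r : R, r ∉ maximalIdeal R → ∃ s, s * r = 1 := fun r hr => by
    have : IsUnit r := by simpa using hr
    exact this.exists_left_inv
  let k0 : Submodule R G := Submodule.span R {c}
  have k0disj : ∀ N : Submodule R G, c ∉ N → Disjoint N k0 := by
    intro N hN
    rw [Submodule.disjoint_def]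
    intro x hx hx'
    obtain ⟨r, rfl⟩ := Submodule.mem_span_singleton.1 hx'
    by_cases hr : r ∈ maximalIdeal R
    · exact hcm r hr
    · obtain ⟨s, hs⟩ := unit r hr
      exfalso; apply hN
      have := N.smul_mem s hx
      rwa [← mul_smul, hs, one_smul] at this
  have notdisj : ∀ N : Submodule R G, Disjoint N k0 → c ∉ N := by
    intro N hN hcN
    exact hc0 (Submodule.disjoint_def.1 hN c hcN (Submodule.mem_span_singleton_self c))
  let V : Submodule R G :=
    { carrier := {e | ∀ r ∈ maximalIdeal R, r • e = 0}
      add_mem' := fun {x y} hx hy r hr => by rw [smul_add, hx r hr, hy r hr, add_zero]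
      zero_mem' := fun r hr => smul_zero r
      smul_mem' := fun s x hx r hr => by rw [smul_comm, hx r hr, smul_zero] }
  -- complement in the socle
  obtain ⟨V0, -, hV0, hV0max⟩ := zorn_disj (⊥ : Submodule R V) (k0.comap V.subtype) disjoint_bot_left
  let V' : Submodule R G := V0.map V.subtype
  have hV'V : V' ≤ V := by rintro _ ⟨x, -, rfl⟩; exact x.2
  have hV'c : Disjoint V' k0 := by
    rw [Submodule.disjoint_def]
    rintro _ ⟨x, hx, rfl⟩ h2
    rw [Submodule.disjoint_def.1 hV0 x hx h2, map_zero]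
  have hsp : ∀ v ∈ V, ∃ r : R, v - r • c ∈ V' := by
    intro v hv
    by_cases hvV : (⟨v, hv⟩ : V) ∈ V0
    · exact ⟨0, by rw [zero_smul, sub_zero]; exact ⟨_, hvV, rfl⟩⟩
    have : ¬ Disjoint (V0 ⊔ Submodule.span R {⟨v, hv⟩}) (k0.comap V.subtype) := by
      intro hd
      have := hV0max _ le_sup_left hd
      apply hvV
      rw [← this]
      exact (le_sup_right : _ ≤ V0 ⊔ Submodule.span R {⟨v, hv⟩}) (Submodule.mem_span_singleton_self _)
    rw [Submodule.disjoint_def] at this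
    push Not at this
    obtain ⟨x, hx1, hx2, hx0⟩ := this
    obtain ⟨w, hw, z, hz, rfl⟩ := Submodule.mem_sup.1 hx1
    obtain ⟨r, rfl⟩ := Submodule.mem_span_singleton.1 hz
    obtain ⟨s, hs⟩ := Submodule.mem_span_singleton.1 hx2
    have hs' : s • c = (w : G) + r • v := hs
    by_cases hr : r ∈ maximalIdeal R
    · exfalso
      rw [hv r hr, add_zero] at hs'
      have h3 : (w : G) = 0 := Submodule.disjoint_def.1 hV'c _ ⟨w, hw, rfl⟩ (by rw [← hs']; exact Submodule.smul_mem _ _ (Submodule.mem_span_singleton_self c))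
      apply hx0
      apply Subtype.ext
      change (w : G) + r • v = 0
      rw [h3, hv r hr, add_zero]
    · obtain ⟨q, hq⟩ := unit r hr
      refine ⟨q * s, ?_⟩
      have : v - (q * s) • c = - (q • (w : G)) := by
        rw [mul_smul, hs', smul_add, ← mul_smul, hq, one_smul]; abel
      rw [this]
      exact V'.neg_mem (V'.smul_mem _ ⟨w, hw, rfl⟩)
  obtain ⟨E, hkE, hE, hEmax⟩ := zorn_disj k0 V' hV'c.symm
  have hcE : c ∈ E := hkE (Submodule.mem_span_singleton_self c)
  have hEsoc : ∀ e ∈ E, e ∈ V → ∃ r : R, e = r • c := by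
    intro e he heV
    obtain ⟨r, hr⟩ := hsp e heV
    exact ⟨r, sub_eq_zero.1 (Submodule.disjoint_def.1 hE _ (E.sub_mem he (E.smul_mem _ hcE)) hr)⟩
  obtain ⟨W, -, hW, hWmax⟩ := zorn_disj (⊥ : Submodule R G) k0 disjoint_bot_left
  -- essentiality
  have hess : ∀ x : G, x ∉ W → ∃ (r : R), ∃ w ∈ W, r • x = c + w := by
    intro x hx
    have : ¬ Disjoint (W ⊔ Submodule.span R {x}) k0 := by
      intro hd
      apply hx
      rw [← hWmax _ le_sup_left hd]
      exact (le_sup_right : _ ≤ W ⊔ Submodule.span R {x}) (Submodule.mem_span_singleton_self _)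
    have h2 : c ∈ W ⊔ Submodule.span R {x} := by
      by_contra h3
      exact this (k0disj _ h3)
    obtain ⟨w, hw, z, hz, h4⟩ := Submodule.mem_sup.1 h2
    obtain ⟨r, rfl⟩ := Submodule.mem_span_singleton.1 hz
    exact ⟨r, -w, W.neg_mem hw, by rw [← h4]; abel⟩
  have hWE : ∀ e ∈ E, e ∈ W → e = 0 := by
    intro e he heW
    by_contra h0
    obtain ⟨r, hr, hs⟩ := hG.socle e h0
    obtain ⟨s, hs⟩ := hEsoc _ (E.smul_mem r he) hs
    exact hr (Submodule.disjoint_def.1 hW _ (W.smul_mem r heW) (by rw [hs]; exact Submodule.smul_mem _ _ (Submodule.mem_span_singleton_self c)))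
  obtain ⟨h, hh⟩ := Module.Injective.out (W.mkQ ∘ₗ E.subtype) (by
    rw [← LinearMap.ker_eq_bot, eq_bot_iff]
    intro e he
    rw [LinearMap.mem_ker, LinearMap.comp_apply, ← LinearMap.mem_ker, Submodule.ker_mkQ] at he
    exact Subtype.ext (hWE _ e.2 he)) E.subtype
  have hhE : ∀ e ∈ E, h (W.mkQ e) = e := fun e he => hh ⟨e, he⟩
  have hN : LinearMap.range h = E := by
    refine hEmax _ (fun e he => ⟨W.mkQ e, hhE e he⟩) ?_
    rw [Submodule.disjoint_def]
    rintro _ ⟨x, rfl⟩ hx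
    obtain ⟨x, rfl⟩ := W.mkQ_surjective x
    by_contra h0
    have hxW : x ∉ W := by
      intro hxW
      apply h0
      rw [← Submodule.ker_mkQ W] at hxW
      rw [LinearMap.mem_ker.1 hxW, map_zero]
    obtain ⟨r, w, hw, hrw⟩ := hess x hxW
    have : r • h (W.mkQ x) = c := by
      rw [← map_smul, ← map_smul, hrw, map_add]
      rw [← Submodule.ker_mkQ W] at hw
      rw [LinearMap.mem_ker.1 hw, add_zero, hhE c hcE]
    apply notdisj V' hV'c
    rw [← this]
    exact V'.smul_mem _ hx
  refine ⟨E, inferInstance, inferInstance, ?_, ?_, ⟨c, hcE⟩, ?_, ?_, ?_⟩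
  · constructor
    intro X Y _ _ _ _ f hf g
    obtain ⟨q, hq⟩ := Module.Injective.out f hf (E.subtype ∘ₗ g)
    refine ⟨LinearMap.codRestrict E (h ∘ₗ W.mkQ ∘ₗ q) (fun y => by rw [← hN]; exact ⟨_, rfl⟩), fun x => ?_⟩
    apply Subtype.ext
    change h (W.mkQ (q (f x))) = _
    rw [hq]
    exact hhE _ (g x).2
  · intro e
    obtain ⟨t, ht⟩ := hG (e : G)
    exact ⟨t, fun r hr => Subtype.ext (ht r hr)⟩
  · exact fun h => hc0 (congrArg Subtype.val h)
  · exact fun r hr => Subtype.ext (hcm r hr)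
  · intro e he
    obtain ⟨r, hr⟩ := hEsoc e e.2 (fun r hr => congrArg Subtype.val (he r hr))
    exact ⟨r, Subtype.ext hr⟩

variable {E : Type u} [AddCommGroup E] [Module R E]

lemma IsE.cogen (hE : IsE R E) {X : Type u} [AddCommGroup X] [Module R X] (x : X) (hx : x ≠ 0) : ∃ φ : X →ₗ[R] E, φ x ≠ 0 := by
  obtain ⟨c, hc0, hcm, -⟩ := hE.soc
  have := hE.inj
  have hk : LinearMap.ker (LinearMap.toSpanSingleton R X x) ≤ LinearMap.ker (LinearMap.toSpanSingleton R E c) := by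
    intro r hr
    have hr' : r • x = 0 := hr
    change r • c = 0
    apply hcm
    rw [mem_maximalIdeal, mem_nonunits_iff]
    intro hu
    exact hx (by simpa using (hu.smul_eq_zero (x := x)).1 hr')
  obtain ⟨φ, hφ⟩ := Module.Injective.out ((LinearMap.ker (LinearMap.toSpanSingleton R X x)).liftQ _ le_rfl)
    (LinearMap.ker_eq_bot.1 (Submodule.ker_liftQ_eq_bot _ _ _ le_rfl)) ((LinearMap.ker (LinearMap.toSpanSingleton R X x)).liftQ _ hk)
  refine ⟨φ, ?_⟩
  have := hφ (Submodule.Quotient.mk 1)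
  simp only [Submodule.liftQ_apply, LinearMap.toSpanSingleton_apply, one_smul] at this
  rw [this]; exact hc0

lemma IsE.ann (hE : IsE R E) {X : Type u} [AddCommGroup X] [Module R X] {r : R} (h : ∀ φ : X →ₗ[R] E, r • φ = 0) (x : X) : r • x = 0 := by
  by_contra h0
  obtain ⟨φ, hφ⟩ := hE.cogen _ h0
  rw [map_smul] at hφ
  exact hφ (LinearMap.congr_fun (h φ) x)

lemma IsE.fin_len (hE : IsE R E) [IsNoetherianRing R] {X : Type u} [AddCommGroup X] [Module R X] [Module.Finite R X] (t : ℕ)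
    (ht : ∀ r ∈ maximalIdeal R ^ t, ∀ x : X, r • x = 0) : Module.Finite R (X →ₗ[R] E) := by
  obtain ⟨c, hc0, hcm, hc⟩ := hE.soc
  let Et : ℕ → Submodule R E := fun t =>
    { carrier := {e | ∀ r ∈ maximalIdeal R ^ t, r • e = 0}
      add_mem' := fun {x y} hx hy r hr => by rw [smul_add, hx r hr, hy r hr, add_zero]
      zero_mem' := fun r hr => smul_zero r
      smul_mem' := fun s x hx r hr => by rw [smul_comm, hx r hr, smul_zero] }
  have hEt : ∀ t, IsNoetherian R (Et t) := by
    intro t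
    induction t with
    | zero =>
      have : Subsingleton (Et 0) := subsingleton_of_forall_eq 0 fun x => Subtype.ext (by
        simpa using x.2 1 (by simp))
      infer_instance
    | succ t ih =>
      obtain ⟨S, hS⟩ := (IsNoetherian.noetherian (maximalIdeal R) : (maximalIdeal R).FG)
      have hSm : ∀ s : S, (s : R) ∈ maximalIdeal R := fun s => by rw [← hS]; exact Submodule.subset_span s.2
      let f : Et (t+1) →ₗ[R] (S → Et t) := LinearMap.pi fun s => LinearMap.codRestrict _ (LinearMap.lsmul R E (s : R) ∘ₗ (Et (t+1)).subtype)
        (fun x r hr => by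
          change r • (s : R) • (x : E) = 0
          rw [← mul_smul]
          apply x.2
          rw [pow_succ]
          exact Ideal.mul_mem_mul hr (hSm s))
      have hker : IsNoetherian R (LinearMap.ker f) := by
        let g : LinearMap.ker f →ₗ[R] (Submodule.span R {c}) := LinearMap.codRestrict _ ((Et (t+1)).subtype ∘ₗ (LinearMap.ker f).subtype) (by
          intro x
          obtain ⟨r, hr⟩ := hc (x.1 : E) (by
            intro r hr
            rw [← hS] at hr
            induction hr using Submodule.span_induction with
            | mem s hs => exact congrArg Subtype.val (congrFun (LinearMap.mem_ker.1 x.2) ⟨s, hs⟩)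
            | zero => simp
            | add u v _ _ hu hv => rw [add_smul, hu, hv, add_zero]
            | smul a u _ hu => rw [smul_assoc, hu, smul_zero])
          change (x.1 : E) ∈ _
          rw [hr]; exact Submodule.smul_mem _ _ (Submodule.mem_span_singleton_self c))
        refine isNoetherian_of_injective g fun x y hxy => ?_
        have h2 : (((x : Et (t+1)) : E)) = ((y : Et (t+1)) : E) := congrArg (fun z : Submodule.span R {c} => (z : E)) hxy
        exact Subtype.ext (Subtype.ext h2)
      exact isNoetherian_of_range_eq_ker (LinearMap.ker f).subtype f (by simp)
  have := hEt t
  obtain ⟨n, q, hq⟩ := Module.Finite.exists_fin' R X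
  let g : (X →ₗ[R] E) →ₗ[R] (Fin n → Et t) := LinearMap.pi fun i => LinearMap.codRestrict _ (LinearMap.applyₗ (q (Pi.single i 1))) (by
    intro φ r hr
    change r • φ _ = 0
    rw [← map_smul, ht r hr, map_zero])
  have : IsNoetherian R (X →ₗ[R] E) := isNoetherian_of_injective g fun φ ψ h => by
    rw [← LinearMap.cancel_right hq]
    refine LinearMap.pi_ext' fun i => LinearMap.ext_ring ?_
    exact congrArg Subtype.val (congrFun h i)
  infer_instance
end
end LHV
end PartF

section PartG
set_option autoImplicit false
open scoped TensorProduct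

namespace LHV
variable {R : Type u} [CommRing R]

/-- localization at an element -/
abbrev Loc (x : R) (M : Type u) [AddCommGroup M] [Module R M] : Type u := Localization.Away x ⊗[R] M

/-- localization map -/
def loc (x : R) (M : Type u) [AddCommGroup M] [Module R M] : M →ₗ[R] Loc x M := TensorProduct.mk R (Localization.Away x) M 1

instance (x : R) (M : Type u) [AddCommGroup M] [Module R M] : IsLocalizedModule (Submonoid.powers x) (loc x M) :=
  inferInstanceAs (IsLocalizedModule (Submonoid.powers x) (TensorProduct.mk R (Localization.Away x) M 1))

/-- functoriality -/
def Loc.map (x : R) {M N : Type u} [AddCommGroup M] [Module R M] [AddCommGroup N] [Module R N] (f : M →ₗ[R] N) : Loc x M →ₗ[R] Loc x N :=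
  f.lTensor (Localization.Away x)

/-- complexes of exact functors -/
structure CF (R : Type u) [CommRing R] where
  X : ℕ → (M : Type u) → [AddCommGroup M] → [Module R M] → Type u
  ac : ∀ (j : ℕ) (M : Type u) [AddCommGroup M] [Module R M], AddCommGroup (X j M)
  mo : ∀ (j : ℕ) (M : Type u) [AddCommGroup M] [Module R M], Module R (X j M)
  map : ∀ (j : ℕ) {M N : Type u} [AddCommGroup M] [Module R M] [AddCommGroup N] [Module R N], (M →ₗ[R] N) → (X j M →ₗ[R] X j N)
  map_id : ∀ (j : ℕ) {M : Type u} [AddCommGroup M] [Module R M], map j (LinearMap.id : M →ₗ[R] M) = LinearMap.id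
  map_comp : ∀ (j : ℕ) {M N P : Type u} [AddCommGroup M] [Module R M] [AddCommGroup N] [Module R N] [AddCommGroup P] [Module R P]
    (f : M →ₗ[R] N) (g : N →ₗ[R] P), map j (g ∘ₗ f) = map j g ∘ₗ map j f
  map_smul : ∀ (j : ℕ) {M N : Type u} [AddCommGroup M] [Module R M] [AddCommGroup N] [Module R N] (r : R) (f : M →ₗ[R] N), map j (r • f) = r • map j f
  ses : ∀ (j : ℕ) {M N P : Type u} [AddCommGroup M] [Module R M] [AddCommGroup N] [Module R N] [AddCommGroup P] [Module R P]
    {f : M →ₗ[R] N} {g : N →ₗ[R] P}, SES f g → SES (map j f) (map j g)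
  d : ∀ (j : ℕ) (M : Type u) [AddCommGroup M] [Module R M], X j M →ₗ[R] X (j+1) M
  d_nat : ∀ (j : ℕ) {M N : Type u} [AddCommGroup M] [Module R M] [AddCommGroup N] [Module R N] (f : M →ₗ[R] N) (u : X j M),
    d j N (map j f u) = map (j+1) f (d j M u)
  dd : ∀ (j : ℕ) {M : Type u} [AddCommGroup M] [Module R M] (u : X j M), d (j+1) M (d j M u) = 0
  e0 : ∀ (M : Type u) [AddCommGroup M] [Module R M], X 0 M ≃ₗ[R] M
  e0_nat : ∀ {M N : Type u} [AddCommGroup M] [Module R M] [AddCommGroup N] [Module R N] (f : M →ₗ[R] N) (u : X 0 M), e0 N (map 0 f u) = f (e0 M u)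

attribute [instance] CF.ac CF.mo

/-- base complex -/
def CF.base (R : Type u) [CommRing R] : CF R where
  X j M _ _ := match j with
    | 0 => M
    | _+1 => PUnit
  ac j M _ _ := match j with
    | 0 => inferInstanceAs (AddCommGroup M)
    | _+1 => inferInstanceAs (AddCommGroup PUnit.{u+1})
  mo j M _ _ := match j with
    | 0 => inferInstanceAs (Module R M)
    | _+1 => (inferInstance : Module R PUnit.{u+1})
  map j {M N} _ _ _ _ f := match j with
    | 0 => f
    | _+1 => (0 : PUnit.{u+1} →ₗ[R] PUnit.{u+1})
  map_id j {M} _ _ := by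
    cases j
    · rfl
    · ext
  map_comp j {M N P} _ _ _ _ _ _ f g := by
    cases j
    · rfl
    · ext
  map_smul j {M N} _ _ _ _ r f := by
    cases j
    · rfl
    · ext
  ses j {M N P} _ _ _ _ _ _ {f g} S := by
    cases j
    · exact S
    · exact ⟨fun x y _ => rfl, fun x => ⟨x, rfl⟩, fun x => ⟨fun _ => ⟨x, rfl⟩, fun _ => rfl⟩⟩
  d j M _ _ := 0
  d_nat j {M N} _ _ _ _ f u := by simp
  dd j {M} _ _ u := by simp
  e0 M _ _ := LinearEquiv.refl R M
  e0_nat {M N} _ _ _ _ f u := rfl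

lemma SES.loc (x : R) {M N P : Type u} [AddCommGroup M] [Module R M] [AddCommGroup N] [Module R N] [AddCommGroup P] [Module R P]
    {f : M →ₗ[R] N} {g : N →ₗ[R] P} (S : SES f g) : SES (Loc.map x f) (Loc.map x g) :=
  ⟨Module.Flat.lTensor_preserves_injective_linearMap f S.inj, LinearMap.lTensor_surjective _ S.surj,
    lTensor_exact _ S.ex S.surj⟩

lemma SES.prod {M N P : Type u} [AddCommGroup M] [Module R M] [AddCommGroup N] [Module R N] [AddCommGroup P] [Module R P]
    {f : M →ₗ[R] N} {g : N →ₗ[R] P} (S : SES f g) {M' N' P' : Type u} [AddCommGroup M'] [Module R M'] [AddCommGroup N'] [Module R N'] [AddCommGroup P'] [Module R P']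
    {f' : M' →ₗ[R] N'} {g' : N' →ₗ[R] P'} (S' : SES f' g') : SES (f.prodMap f') (g.prodMap g') := by
  refine ⟨Function.Injective.prodMap S.inj S'.inj, Function.Surjective.prodMap S.surj S'.surj, ?_⟩
  rintro ⟨u, v⟩
  rw [LinearMap.prodMap_apply, Prod.mk_eq_zero, S.ex u, S'.ex v]
  constructor
  · rintro ⟨⟨a, rfl⟩, b, rfl⟩
    exact ⟨(a, b), rfl⟩
  · rintro ⟨⟨a, b⟩, h⟩
    exact ⟨⟨a, congrArg Prod.fst h⟩, b, congrArg Prod.snd h⟩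

lemma Loc.map_loc (x : R) {M N : Type u} [AddCommGroup M] [Module R M] [AddCommGroup N] [Module R N] (f : M →ₗ[R] N) :
   Loc.map x f ∘ₗ loc x M = loc x N ∘ₗ f := by
  ext m; simp [Loc.map, loc]

/-- cone on localization -/
def CF.cone (C : CF R) (x : R) : CF R where
  X j M _ _ := match j with
    | 0 => C.X 0 M
    | j+1 => C.X (j+1) M × C.X j (Loc x M)
  ac j M _ _ := match j with
    | 0 => inferInstanceAs (AddCommGroup (C.X 0 M))
    | j+1 => inferInstanceAs (AddCommGroup (C.X (j+1) M × C.X j (Loc x M)))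
  mo j M _ _ := match j with
    | 0 => inferInstanceAs (Module R (C.X 0 M))
    | j+1 => inferInstanceAs (Module R (C.X (j+1) M × C.X j (Loc x M)))
  map j {M N} _ _ _ _ f := match j with
    | 0 => C.map 0 f
    | j+1 => (C.map (j+1) f).prodMap (C.map j (Loc.map x f))
  map_id j {M} _ _ := by
    cases j
    · exact C.map_id 0
    · simp only [Loc.map, LinearMap.lTensor_id, C.map_id, LinearMap.prodMap_id]
  map_comp j {M N P} _ _ _ _ _ _ f g := by
    cases j
    · exact C.map_comp 0 f g
    · simp only [Loc.map, LinearMap.lTensor_comp, C.map_comp]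
      exact (LinearMap.prodMap_comp _ _ _ _).symm
  map_smul j {M N} _ _ _ _ r f := by
    cases j
    · exact C.map_smul 0 r f
    · simp only [Loc.map, LinearMap.lTensor_smul, C.map_smul]; rfl
  ses j {M N P} _ _ _ _ _ _ {f g} S := by
    cases j
    · exact C.ses 0 S
    · exact (C.ses _ S).prod (C.ses _ (S.loc x))
  d j M _ _ := match j with
    | 0 => LinearMap.prod (C.d 0 M) (C.map 0 (loc x M))
    | j+1 => LinearMap.prod (C.d (j+1) M ∘ₗ LinearMap.fst R _ _)
        (C.map (j+1) (loc x M) ∘ₗ LinearMap.fst R _ _ - C.d j (Loc x M) ∘ₗ LinearMap.snd R _ _)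
  d_nat j {M N} _ _ _ _ f u := by
    have key : ∀ (i : ℕ) (u : C.X i M), C.map i (loc x N) (C.map i f u) = C.map i (Loc.map x f) (C.map i (loc x M) u) := by
      intro i u
      rw [← LinearMap.comp_apply, ← LinearMap.comp_apply, ← C.map_comp, ← C.map_comp, Loc.map_loc]
    cases j
    · exact Prod.ext (C.d_nat 0 f u) (key 0 u)
    · obtain ⟨u, v⟩ := u
      refine Prod.ext (C.d_nat _ f u) ?_
      change C.map _ (loc x N) (C.map _ f u) - C.d _ _ (C.map _ (Loc.map x f) v) = C.map _ (Loc.map x f) (C.map _ (loc x M) u - C.d _ _ v)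
      rw [key, C.d_nat, map_sub]
  dd j {M} _ _ u := by
    cases j
    · refine Prod.ext (C.dd 0 u) ?_
      change C.map _ (loc x M) (C.d 0 M u) - C.d 0 _ (C.map 0 (loc x M) u) = 0
      rw [C.d_nat, sub_self]
    · obtain ⟨u, v⟩ := u
      refine Prod.ext (C.dd _ u) ?_
      change C.map _ (loc x M) (C.d _ M u) - C.d _ _ (C.map _ (loc x M) u - C.d _ _ v) = 0
      rw [map_sub, C.dd, C.d_nat, sub_zero, sub_self]
  e0 M _ _ := C.e0 M
  e0_nat {M N} _ _ _ _ f u := C.e0_nat f u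

/-- Cech complex -/
def cech : List R → CF R
  | [] => CF.base R
  | x :: xs => (cech xs).cone x

end LHV
end PartG

section PartH
set_option autoImplicit false
open scoped TensorProduct

namespace LHV
variable {R : Type u} [CommRing R]
section CFbasic
variable (C : CF R) (j : ℕ) {M N : Type u} [AddCommGroup M] [Module R M] [AddCommGroup N] [Module R N]

lemma CF.map_zero' : C.map j (0 : M →ₗ[R] N) = 0 := by
  have := C.map_smul j (0:R) (0 : M →ₗ[R] N)
  rwa [zero_smul, zero_smul] at this

lemma CF.kill {r : R} (h : ∀ m : M, r • m = 0) (u : C.X j M) : r • u = 0 := by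
  have h1 : r • (LinearMap.id : M →ₗ[R] M) = 0 := by ext m; exact h m
  have h2 := C.map_smul j r (LinearMap.id : M →ₗ[R] M)
  rw [h1, C.map_zero', C.map_id] at h2
  exact (LinearMap.congr_fun h2 u).symm

lemma CF.sub (h : Subsingleton M) : Subsingleton (C.X j M) := by
  have : ∀ u : C.X j M, u = 0 := fun u => by
    have := C.kill j (M := M) (r := 1) (fun m => Subsingleton.elim _ _) u
    rwa [one_smul] at this
  exact ⟨fun a b => (this a).trans (this b).symm⟩

lemma CF.map_lsmul (x : R) (u : C.X j M) : C.map j (LinearMap.lsmul R M x) u = x • u := by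
  have h2 := C.map_smul j x (LinearMap.id : M →ₗ[R] M)
  have h1 : x • (LinearMap.id : M →ₗ[R] M) = LinearMap.lsmul R M x := by ext m; rfl
  rw [h1, C.map_id] at h2
  rw [h2]; rfl

/-- functoriality for equivalences -/
def CF.congr (e : M ≃ₗ[R] N) : C.X j M ≃ₗ[R] C.X j N :=
  LinearEquiv.ofLinearMap (C.map j e.toLinearMap) (C.map j e.symm.toLinearMap)
    (by rw [← C.map_comp]; simp [C.map_id]) (by rw [← C.map_comp]; simp [C.map_id])

lemma CF.smul_surj (x : R) (h : Function.Bijective (LinearMap.lsmul R M x)) (u : C.X j M) : ∃ v : C.X j M, x • v = u := by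
  let e := LinearEquiv.ofBijective (LinearMap.lsmul R M x) h
  refine ⟨(C.congr j e).symm u, ?_⟩
  have := (C.congr j e).apply_symm_apply u
  rw [← C.map_lsmul]
  exact this

/-- elementwise power torsion -/
def PT (x : R) (M : Type u) [AddCommGroup M] [Module R M] : Prop := ∀ m : M, ∃ t : ℕ, x ^ t • m = 0

lemma pow_kill_mono {x : R} {m : M} {s t : ℕ} (h : x ^ s • m = 0) (hst : s ≤ t) : x ^ t • m = 0 := by
  obtain ⟨k, rfl⟩ := Nat.exists_eq_add_of_le hst
  rw [pow_add, mul_comm, mul_smul, h, smul_zero]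

lemma PT.add {x : R} {a b : M} (ha : ∃ t : ℕ, x ^ t • a = 0) (hb : ∃ t : ℕ, x ^ t • b = 0) : ∃ t : ℕ, x ^ t • (a + b) = 0 := by
  obtain ⟨s, hs⟩ := ha
  obtain ⟨t, ht⟩ := hb
  refine ⟨s + t, ?_⟩
  rw [smul_add, pow_kill_mono hs (by lia), pow_kill_mono ht (by lia), add_zero]

lemma PT.loc {x : R} (h : PT x M) (y : R) : PT x (Loc y M) := by
  intro v
  induction v using TensorProduct.induction_on with
  | zero => exact ⟨0, smul_zero _⟩
  | tmul r m =>
    obtain ⟨t, ht⟩ := h m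
    refine ⟨t, ?_⟩
    rw [← TensorProduct.tmul_smul, ht, TensorProduct.tmul_zero]
  | add a b ha hb => exact PT.add ha hb

lemma PT.prod {x : R} (h : PT x M) (h' : PT x N) : PT x (M × N) := by
  rintro ⟨m, n⟩
  obtain ⟨s, hs⟩ := h m
  obtain ⟨t, ht⟩ := h' n
  exact ⟨s + t, Prod.ext (pow_kill_mono hs (by lia)) (pow_kill_mono ht (by lia))⟩

lemma loc_bij (x : R) (M : Type u) [AddCommGroup M] [Module R M] : Function.Bijective (LinearMap.lsmul R (Loc x M) x) := by
  have := IsLocalizedModule.map_units (S := Submonoid.powers x) (loc x M) ⟨x, 1, pow_one x⟩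
  exact (Module.End.isUnit_iff _).1 this

lemma loc_ker (x : R) {m : M} (h : loc x M m = 0) : ∃ t : ℕ, x ^ t • m = 0 := by
  obtain ⟨⟨_, t, rfl⟩, ht⟩ := (IsLocalizedModule.eq_zero_iff (Submonoid.powers x) (loc x M)).1 h
  exact ⟨t, ht⟩

lemma loc_coker (x : R) (v : Loc x M) : ∃ (t : ℕ) (m : M), loc x M m = x ^ t • v := by
  obtain ⟨⟨m, ⟨_, t, rfl⟩⟩, ht⟩ := IsLocalizedModule.surj (Submonoid.powers x) (loc x M) v
  exact ⟨t, m, ht.symm⟩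

lemma PT.loc_self {x : R} (h : PT x M) : Subsingleton (Loc x M) := by
  have : ∀ v : Loc x M, v = 0 := fun v => by
    obtain ⟨t, ht⟩ := h.loc x v
    have key : ∀ t (v : Loc x M), x ^ t • v = 0 → v = 0 := by
      intro t
      induction t with
      | zero => intro v hv; simpa using hv
      | succ t ih =>
        intro v hv
        rw [pow_succ, mul_smul] at hv
        exact (loc_bij x M).1 ((ih _ hv).trans (map_zero _).symm)
    exact key t v ht
  exact ⟨fun a b => (this a).trans (this b).symm⟩

end CFbasic

lemma cech_vanish (xs : List R) : ∀ (j : ℕ) (M : Type u) [AddCommGroup M] [Module R M], xs.length < j → Subsingleton ((cech xs).X j M) := by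
  induction xs with
  | nil =>
    intro j M _ _ h
    cases j with
    | zero => simp at h
    | succ j => exact (inferInstance : Subsingleton PUnit.{u+1})
  | cons x xs ih =>
    intro j M _ _ h
    cases j with
    | zero => simp at h
    | succ j =>
      simp only [List.length_cons] at h
      have h1 := ih (j+1) M (by lia)
      have h2 := ih j (Loc x M) (by lia)
      exact (inferInstance : Subsingleton ((cech xs).X (j+1) M × (cech xs).X j (Loc x M)))

lemma cech_PT (xs : List R) (y : R) : ∀ (j : ℕ) (M : Type u) [AddCommGroup M] [Module R M], PT y M → PT y ((cech xs).X j M) := by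
  induction xs with
  | nil =>
    intro j M _ _ h
    cases j with
    | zero => exact h
    | succ j => exact fun u => ⟨0, rfl⟩
  | cons x xs ih =>
    intro j M _ _ h
    cases j with
    | zero => exact ih 0 M h
    | succ j => exact (ih (j+1) M h).prod (ih j (Loc x M) (h.loc x))

section
variable {M N : Type u} [AddCommGroup M] [Module R M] [AddCommGroup N] [Module R N]

lemma CF.map_range (C : CF R) (j : ℕ) (f : M →ₗ[R] N) (u : C.X j M) :
    C.map j (LinearMap.range f).subtype (C.map j f.rangeRestrict u) = C.map j f u := by
  rw [← LinearMap.comp_apply, ← C.map_comp]; rfl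

lemma cech_ker (xs : List R) (y : R) (j : ℕ) (f : M →ₗ[R] N) (hf : ∀ m, f m = 0 → ∃ t : ℕ, y ^ t • m = 0) (u : (cech xs).X j M)
    (hu : (cech xs).map j f u = 0) : ∃ t : ℕ, y ^ t • u = 0 := by
  rw [← CF.map_range] at hu
  have h1 := ((cech xs).ses j (SES.quot (LinearMap.range f))).inj (hu.trans (map_zero _).symm)
  obtain ⟨w, rfl⟩ := (((cech xs).ses j (SES.ofSurj f.rangeRestrict f.surjective_rangeRestrict)).ex u).1 h1
  obtain ⟨t, ht⟩ := cech_PT xs y j (LinearMap.ker f.rangeRestrict) (fun m => by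
    obtain ⟨t, ht⟩ := hf m.1 (congrArg Subtype.val (LinearMap.mem_ker.1 m.2))
    exact ⟨t, Subtype.ext ht⟩) w
  exact ⟨t, by rw [← map_smul, ht, map_zero]⟩

lemma cech_coker (xs : List R) (y : R) (j : ℕ) (f : M →ₗ[R] N) (hf : ∀ n, ∃ (t : ℕ) (m : M), f m = y ^ t • n) (v : (cech xs).X j N) :
    ∃ (t : ℕ) (u : (cech xs).X j M), (cech xs).map j f u = y ^ t • v := by
  have S := (cech xs).ses j (SES.quot (LinearMap.range f))
  have S' := (cech xs).ses j (SES.ofSurj f.rangeRestrict f.surjective_rangeRestrict)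
  obtain ⟨t, ht⟩ := cech_PT xs y j (N ⧸ LinearMap.range f) (fun q => by
    obtain ⟨n, rfl⟩ := Submodule.mkQ_surjective _ q
    obtain ⟨t, m, h⟩ := hf n
    exact ⟨t, by rw [← map_smul, ← h]; simp⟩) ((cech xs).map j (LinearMap.range f).mkQ v)
  rw [← map_smul] at ht
  obtain ⟨w, hw⟩ := (S.ex _).1 ht
  obtain ⟨u, rfl⟩ := S'.surj w
  rw [CF.map_range] at hw
  exact ⟨t, u, hw⟩
end

/-- coboundaries -/
def CF.Bd (C : CF R) (j : ℕ) (M : Type u) [AddCommGroup M] [Module R M] : Submodule R (C.X j M) :=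
  match j with
  | 0 => ⊥
  | j+1 => LinearMap.range (C.d j M)

theorem cech_P (xs : List R) : ∀ y ∈ xs, ∀ (j : ℕ) (M : Type u) [AddCommGroup M] [Module R M] (z : (cech xs).X j M),
    (cech xs).d j M z = 0 → ∃ t : ℕ, y ^ t • z ∈ (cech xs).Bd j M := by
  induction xs with
  | nil => intro y hy; simp at hy
  | cons x xs ih =>
    intro y hy j M _ _ z hz
    set C := cech xs with hC
    cases j with
    | zero =>
      have h1 : C.d 0 M z = 0 := congrArg Prod.fst hz
      have h2 : C.map 0 (loc x M) z = 0 := congrArg Prod.snd hz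
      rcases List.mem_cons.1 hy with rfl | hy
      · obtain ⟨t, ht⟩ := cech_ker xs y 0 (loc y M) (fun m => loc_ker y) z h2
        exact ⟨t, ht⟩
      · exact ih y hy 0 M z h1
    | succ j =>
      obtain ⟨u, v⟩ := z
      have h1 : C.d (j+1) M u = 0 := congrArg Prod.fst hz
      have h2 : C.map (j+1) (loc x M) u - C.d j (Loc x M) v = 0 := congrArg Prod.snd hz
      rw [sub_eq_zero] at h2
      have fin : ∀ (s t : ℕ) (w : C.X j M), C.d j M (y ^ s • w) = y ^ (s + t) • u →
          C.map j (loc x M) (y ^ s • w) - y ^ (s + t) • v ∈ C.Bd j (Loc x M) → ∃ t : ℕ, y ^ t • ((u, v) : C.X (j+1) M × C.X j (Loc x M)) ∈ (cech (x :: xs)).Bd (j+1) M := by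
        intro s t w hw1 hw2
        refine ⟨s + t, ?_⟩
        cases j with
        | zero => exact ⟨y ^ s • w, Prod.ext hw1 (sub_eq_zero.1 hw2)⟩
        | succ j =>
          obtain ⟨v'', hv''⟩ := hw2
          refine ⟨(y ^ s • w, v''), Prod.ext hw1 ?_⟩
          change C.map (j+1) (loc x M) (y ^ s • w) - C.d j (Loc x M) v'' = y ^ (s+t) • v
          rw [hv'', sub_sub_cancel]
      rcases List.mem_cons.1 hy with rfl | hy
      · obtain ⟨t, w, hw⟩ := cech_coker xs y j (loc y M) (loc_coker y) v
        obtain ⟨s, hs⟩ := cech_ker xs y (j+1) (loc y M) (fun m => loc_ker y) (y ^ t • u - C.d j M w) (by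
          rw [map_sub, map_smul, ← C.d_nat, hw, map_smul, h2, sub_self])
        refine fin s t w ?_ ?_
        · rw [smul_sub, sub_eq_zero] at hs
          rw [map_smul, ← hs, pow_add, mul_smul]
        · rw [map_smul, hw, pow_add, mul_smul, sub_self]
          exact zero_mem _
      · obtain ⟨t, w, hw⟩ := ih y hy (j+1) M u h1
        obtain ⟨s, hs⟩ := ih y hy j (Loc x M) (C.map j (loc x M) w - y ^ t • v) (by
          rw [map_sub, C.d_nat, hw, map_smul, map_smul, h2, sub_self])
        refine fin s t w ?_ ?_
        · rw [map_smul, hw, pow_add, mul_smul]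
        · rwa [map_smul, pow_add, mul_smul, ← smul_sub]

lemma cech_tor (xs : List R) : ∀ (j : ℕ) (M : Type u) [AddCommGroup M] [Module R M], (∀ y ∈ xs, PT y M) → Subsingleton ((cech xs).X (j+1) M) := by
  induction xs with
  | nil => intro j M _ _ h; exact (inferInstance : Subsingleton PUnit.{u+1})
  | cons x xs ih =>
    intro j M _ _ h
    have h1 := ih j M (fun y hy => h y (List.mem_cons_of_mem _ hy))
    have h2 := (cech xs).sub j (h x List.mem_cons_self).loc_self
    exact (inferInstance : Subsingleton ((cech xs).X (j+1) M × (cech xs).X j (Loc x M)))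

lemma cech_div {E : Type u} [AddCommGroup E] [Module R E] (xs : List R) : ∀ (j : ℕ) (M : Type u) [AddCommGroup M] [Module R M] (φ : (cech xs).X (j+1) M →ₗ[R] E),
    (∀ y ∈ xs, ∃ t : ℕ, y ^ t • φ = 0) → φ = 0 := by
  induction xs with
  | nil => intro j M _ _ φ h; ext u; exact map_zero φ
  | cons x xs ih =>
    intro j M _ _ φ h
    let φ' : (cech xs).X (j+1) M × (cech xs).X j (Loc x M) →ₗ[R] E := φ
    have h' : ∀ y ∈ x :: xs, ∃ t : ℕ, y ^ t • φ' = 0 := h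
    have h1 := ih j M (φ' ∘ₗ LinearMap.inl R _ _) (fun y hy => by
      obtain ⟨t, ht⟩ := h' y (List.mem_cons_of_mem _ hy)
      exact ⟨t, by rw [← LinearMap.smul_comp, ht, LinearMap.zero_comp]⟩)
    have h2 : φ' ∘ₗ LinearMap.inr R _ _ = 0 := by
      obtain ⟨t, ht⟩ := h' x List.mem_cons_self
      have hs : ∀ (t : ℕ) (u : (cech xs).X j (Loc x M)), ∃ v, x ^ t • v = u := by
        intro t
        induction t with
        | zero => exact fun u => ⟨u, by simp⟩
        | succ t ih =>
          intro u
          obtain ⟨v, rfl⟩ := (cech xs).smul_surj j x (loc_bij x M) u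
          obtain ⟨w, rfl⟩ := ih v
          exact ⟨w, by rw [pow_succ', mul_smul]⟩
      ext u
      obtain ⟨v, rfl⟩ := hs t u
      rw [map_smul]
      exact LinearMap.congr_fun ht ((0, v))
    have : φ' = 0 := LinearMap.prod_ext h1 h2
    exact this

lemma cech_acyc [IsNoetherianRing R] (a : Ideal R) {E : Type u} [AddCommGroup E] [Module R E] [Module.Injective R E] (N : Type u) [AddCommGroup N] [Module R N] [Module.Finite R N] (xs : List R) :
    ∀ (j i : ℕ) (F : Type u) [AddCommGroup F] [Module R F] [Module.Flat R F], Subsingleton (HL a (i+1) ((cech xs).X j (F ⊗[R] N) →ₗ[R] E)) := by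
  induction xs with
  | nil =>
    intro j i F _ _ _
    cases j with
    | zero =>
      have := hom_flat_injective (R := R) F E
      have h := hom_acyclic a N (F →ₗ[R] E) i
      let e : (N →ₗ[R] (F →ₗ[R] E)) ≃ₗ[R] (F ⊗[R] N →ₗ[R] E) := (TensorProduct.lift.equiv (RingHom.id R) N F E) ≪≫ₗ (TensorProduct.comm R N F).congrLeft E R
      exact (HL.congr a (i+1) e).symm.toEquiv.subsingleton
    | succ j =>
      have : Subsingleton ((cech ([] : List R)).X (j+1) (F ⊗[R] N) →ₗ[R] E) := ⟨fun f g => by ext u; exact (map_zero f).trans (map_zero g).symm⟩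
      exact HL.sub_of_sub
  | cons x xs ih =>
    intro j i F _ _ _
    cases j with
    | zero => exact ih 0 i F
    | succ j =>
      have S : SES (LinearMap.inl R ((cech xs).X (j+1) (F ⊗[R] N)) ((cech xs).X j (Loc x (F ⊗[R] N)))) (LinearMap.snd R _ _) :=
        ⟨LinearMap.inl_injective, LinearMap.snd_surjective, LinearMap.exact_iff.2 (by ext ⟨u, v⟩; simp [eq_comm])⟩
      refine (S.hom E).vanishB (ih (j+1) i F) ?_
      have h := ih j i (Localization.Away x ⊗[R] F)
      let e : (cech xs).X j ((Localization.Away x ⊗[R] F) ⊗[R] N) ≃ₗ[R] (cech xs).X j (Loc x (F ⊗[R] N)) := (cech xs).congr j (TensorProduct.assoc R _ _ _)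
      exact (HL.congr a (i+1) (e.congrLeft E R)).symm.toEquiv.subsingleton

end LHV
end PartH

section PartI
set_option autoImplicit false
open scoped TensorProduct Pointwise
open IsLocalRing

namespace LHV
variable {R : Type u} [CommRing R]

section nak
lemma precomplete_pi (I : Ideal R) [IsPrecomplete I R] (k : ℕ) : IsPrecomplete I (Fin k → R) := by
  rw [← AdicCompletion.of_surjective_iff]
  intro y
  choose r hr using fun j => AdicCompletion.of_surjective I R (AdicCompletion.piEquivFin I k y j)
  refine ⟨r, (AdicCompletion.piEquivFin I k).injective ?_⟩
  funext j
  rw [← hr, AdicCompletion.piEquivFin_apply]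
  simp [AdicCompletion.pi, AdicCompletion.map_of]

lemma complete_nakayama [IsLocalRing R] [IsAdicComplete (maximalIdeal R) R] {Q : Type u} [AddCommGroup Q] [Module R Q] [IsHausdorff (maximalIdeal R) Q]
   {x : R} (hx : x ∈ maximalIdeal R) (h : Module.Finite R (QuotSMulTop x Q)) : Module.Finite R Q := by
  obtain ⟨k, s, hs⟩ := Module.Finite.exists_fin (R := R) (M := QuotSMulTop x Q)
  choose q hq using fun i => Submodule.mkQ_surjective _ (s i)
  have := precomplete_pi (maximalIdeal R) k
  have hsurj : Function.Surjective (Fintype.linearCombination R q) := by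
    apply surjective_of_mkQ_comp_surjective (I := maximalIdeal R)
    intro y
    obtain ⟨y, rfl⟩ := Submodule.mkQ_surjective _ y
    have : Submodule.mkQ (x • (⊤ : Submodule R Q)) y ∈ Submodule.span R (Set.range s) := by rw [hs]; trivial
    obtain ⟨c, hc⟩ := (Submodule.mem_span_range_iff_exists_fun R).1 this
    refine ⟨c, ?_⟩
    have h2 : Submodule.mkQ (x • (⊤ : Submodule R Q)) (Fintype.linearCombination R q c - y) = 0 := by
      rw [map_sub, ← hc, Fintype.linearCombination_apply, map_sum]
      simp only [map_smul, hq, sub_self]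
    rw [Submodule.mkQ_apply, Submodule.Quotient.mk_eq_zero] at h2
    rw [LinearMap.comp_apply, ← sub_eq_zero, ← map_sub, Submodule.mkQ_apply, Submodule.Quotient.mk_eq_zero]
    obtain ⟨w, -, hw⟩ := (Submodule.mem_smul_pointwise_iff_exists _ _ _).1 h2
    rw [← hw]
    exact Submodule.smul_mem_smul hx trivial
  exact Module.Finite.of_surjective _ hsurj
end nak

section coh
variable (C : CF R) (j : ℕ) (M : Type u) {N : Type u} [AddCommGroup M] [Module R M] [AddCommGroup N] [Module R N]

lemma CF.Bd_le : C.Bd j M ≤ LinearMap.ker (C.d j M) := by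
  cases j with
  | zero => exact bot_le
  | succ j =>
    rintro _ ⟨u, rfl⟩
    exact C.dd j u

lemma CF.Bd_map (f : M →ₗ[R] N) {u : C.X j M} (hu : u ∈ C.Bd j M) : C.map j f u ∈ C.Bd j N := by
  cases j with
  | zero =>
    have : u = 0 := hu
    rw [this, map_zero]; exact zero_mem _
  | succ j =>
    obtain ⟨w, rfl⟩ := hu
    exact ⟨C.map j f w, C.d_nat j f w⟩

lemma CF.Bd_surj (f : M →ₗ[R] N) (hf : Function.Surjective f) {v : C.X j N} (hv : v ∈ C.Bd j N) : ∃ u ∈ C.Bd j M, C.map j f u = v := by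
  cases j with
  | zero =>
    have : v = 0 := hv
    exact ⟨0, zero_mem _, by rw [this, map_zero]⟩
  | succ j =>
    obtain ⟨w, rfl⟩ := hv
    obtain ⟨w, rfl⟩ := (C.ses j (SES.ofSurj f hf)).surj w
    exact ⟨C.d j M w, ⟨w, rfl⟩, (C.d_nat j f w).symm⟩

/-- cohomology -/
abbrev CF.H : Type u := LinearMap.ker (C.d j M) ⧸ (C.Bd j M).submoduleOf (LinearMap.ker (C.d j M))

/-- map on cocycles -/
def CF.Zmap (f : M →ₗ[R] N) : LinearMap.ker (C.d j M) →ₗ[R] LinearMap.ker (C.d j N) :=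
  (C.map j f).restrict (fun u hu => by
    rw [LinearMap.mem_ker] at hu ⊢
    rw [C.d_nat, hu, map_zero])

/-- map on cohomology -/
def CF.Hmap (f : M →ₗ[R] N) : C.H j M →ₗ[R] C.H j N :=
  Submodule.mapQ _ _ (C.Zmap j M f) (fun _ hu => C.Bd_map j M f hu)

lemma CF.H_mk_zero (u : LinearMap.ker (C.d j M)) : (Submodule.Quotient.mk u : C.H j M) = 0 ↔ u.1 ∈ C.Bd j M := by
  rw [Submodule.Quotient.mk_eq_zero]; rfl

variable {M}
lemma CF.exists_delta {x : R} (hx : IsSMulRegular M x) : ∃ δ : C.H j (QuotSMulTop x M) →ₗ[R] C.H (j+1) M,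
    Function.Exact δ (LinearMap.lsmul R (C.H (j+1) M) x) := by
  have S := SES.mulReg hx
  have S0 := C.ses j S
  have S1 := C.ses (j+1) S
  set g : M →ₗ[R] QuotSMulTop x M := Submodule.mkQ (x • (⊤ : Submodule R M)) with hg
  let P : Submodule R (C.X j M) := (LinearMap.ker (C.d j (QuotSMulTop x M))).comap (C.map j g)
  have inj1 : ∀ u v : C.X (j+1) M, x • u = x • v → u = v := by
    intro u v h
    apply S1.inj
    rw [C.map_lsmul, C.map_lsmul, h]
  have inj2 : ∀ u v : C.X (j+2) M, x • u = x • v → u = v := by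
    intro u v h
    apply (C.ses (j+2) S).inj
    rw [C.map_lsmul, C.map_lsmul, h]
  have h1 : ∀ y : P, ∃ w : C.X (j+1) M, x • w = C.d j M y.1 := by
    intro y
    have := y.2
    rw [Submodule.mem_comap, LinearMap.mem_ker, C.d_nat] at this
    obtain ⟨w, hw⟩ := (S1.ex _).1 this
    exact ⟨w, by rw [← hw, C.map_lsmul]⟩
  choose w hw using h1
  have hwk : ∀ y, w y ∈ LinearMap.ker (C.d (j+1) M) := by
    intro y
    rw [LinearMap.mem_ker]
    apply inj2
    rw [← _root_.map_smul, hw, C.dd, smul_zero]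
  let α0 : P →ₗ[R] LinearMap.ker (C.d (j+1) M) :=
   { toFun := fun y => ⟨w y, hwk y⟩
     map_add' := fun y z => Subtype.ext (inj1 _ _ (by
      change x • w (y + z) = x • (w y + w z)
      rw [smul_add, hw, hw, hw]; simp))
     map_smul' := fun r y => Subtype.ext (inj1 _ _ (by
      change x • w (r • y) = x • (r • w y)
      rw [smul_comm, hw, hw]; simp)) }
  let α : P →ₗ[R] C.H (j+1) M := Submodule.mkQ _ ∘ₗ α0
  let β : P →ₗ[R] C.H j (QuotSMulTop x M) := Submodule.mkQ _ ∘ₗ ((C.map j g).restrict (fun u hu => hu))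
  have hβ : Function.Surjective β := by
    intro q
    obtain ⟨⟨z, hz⟩, rfl⟩ := Submodule.mkQ_surjective _ q
    obtain ⟨y, rfl⟩ := S0.surj z
    exact ⟨⟨y, hz⟩, rfl⟩
  have hker : LinearMap.ker β ≤ LinearMap.ker α := by
    intro y hy
    have hy' : C.map j g y.1 ∈ C.Bd j (QuotSMulTop x M) := (C.H_mk_zero _ _ _).1 hy
    obtain ⟨b, hb, hb'⟩ := C.Bd_surj j M g S.surj hy'
    have : C.map j g (y.1 - b) = 0 := by rw [map_sub, hb', sub_self]
    obtain ⟨v, hv⟩ := (S0.ex _).1 this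
    rw [C.map_lsmul] at hv
    refine (C.H_mk_zero _ _ _).2 ⟨v, ?_⟩
    apply inj1
    change x • C.d j M v = x • w y
    rw [hw, ← _root_.map_smul, hv, map_sub, LinearMap.mem_ker.1 (C.Bd_le j M hb), sub_zero]
  refine ⟨(LinearMap.ker β).liftQ α hker ∘ₗ (β.quotKerEquivOfSurjective hβ).symm.toLinearMap, ?_⟩
  have hδ : ∀ y, ((LinearMap.ker β).liftQ α hker ∘ₗ (β.quotKerEquivOfSurjective hβ).symm.toLinearMap) (β y) = α y := by
    intro y
    have : (β.quotKerEquivOfSurjective hβ).symm (β y) = Submodule.Quotient.mk y := by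
      rw [LinearEquiv.symm_apply_eq]; rfl
    simp only [LinearMap.comp_apply, LinearEquiv.coe_coe, this]
    rfl
  intro h
  constructor
  · intro hh
    obtain ⟨⟨a, ha⟩, rfl⟩ := Submodule.mkQ_surjective _ h
    obtain ⟨y, hy⟩ := (C.H_mk_zero (j+1) M (x • (⟨a, ha⟩ : LinearMap.ker (C.d (j+1) M)))).1 hh
    have hyP : y ∈ P := by
      rw [Submodule.mem_comap, LinearMap.mem_ker, C.d_nat, hy]
      change C.map (j+1) g (x • a) = 0
      rw [← C.map_lsmul]
      exact S1.ex.apply_apply_eq_zero a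
    refine ⟨β ⟨y, hyP⟩, ?_⟩
    rw [hδ]
    change Submodule.Quotient.mk _ = Submodule.Quotient.mk _
    congr 1
    apply Subtype.ext
    apply inj1
    change x • w ⟨y, hyP⟩ = x • a
    rw [hw]; exact hy
  · rintro ⟨b, rfl⟩
    obtain ⟨y, rfl⟩ := hβ b
    rw [hδ]
    refine (C.H_mk_zero (j+1) M (x • (⟨w y, hwk y⟩ : LinearMap.ker (C.d (j+1) M)))).2 ⟨y.1, ?_⟩
    exact (hw y).symm

/-- if the kernel is acyclic in positive degree -/
lemma CF.Hmap_inj (f : M →ₗ[R] N) (hf : Function.Surjective f) (h : Subsingleton (C.X (j+1) (LinearMap.ker f))) :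
    Function.Injective (C.Hmap (j+1) M f) := by
  rw [← LinearMap.ker_eq_bot, Submodule.eq_bot_iff]
  intro q hq
  obtain ⟨⟨u, hu⟩, rfl⟩ := Submodule.mkQ_surjective _ q
  have h1 : C.map (j+1) f u ∈ C.Bd (j+1) N := (C.H_mk_zero _ _ _).1 hq
  obtain ⟨v, hv, hv'⟩ := C.Bd_surj _ M f hf h1
  have : C.map (j+1) f (u - v) = 0 := by rw [map_sub, hv', sub_self]
  obtain ⟨w, hw⟩ := ((C.ses (j+1) (SES.ofSurj f hf)).ex _).1 this
  rw [Subsingleton.elim w 0, map_zero] at hw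
  refine (C.H_mk_zero _ _ _).2 ?_
  change u ∈ _
  rw [sub_eq_zero.1 hw.symm]; exact hv
end coh

section tors
variable {X : Type u} [AddCommGroup X] [Module R X]

lemma Tor.exp {c : Ideal R} (h : Tor c X) [Module.Finite R X] : ∃ t : ℕ, ∀ r ∈ c ^ t, ∀ x : X, r • x = 0 := by
  obtain ⟨k, s, hs⟩ := Module.Finite.exists_fin (R := R) (M := X)
  choose t ht using fun i => h (s i)
  refine ⟨∑ i, t i, fun r hr x => ?_⟩
  have : Submodule.span R (Set.range s) ≤ LinearMap.ker (LinearMap.lsmul R X r) := by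
    rw [Submodule.span_le]
    rintro _ ⟨i, rfl⟩
    exact ht i r (Ideal.pow_le_pow_right (Finset.single_le_sum (f := t) (fun _ _ => Nat.zero_le _) (Finset.mem_univ i)) hr)
  exact this (hs ▸ trivial)

lemma Tor.hausdorff {c : Ideal R} (h : Tor c X) (E : Type u) [AddCommGroup E] [Module R E] : IsHausdorff c (X →ₗ[R] E) := by
  constructor
  intro φ hφ
  ext x
  obtain ⟨t, ht⟩ := h x
  have h1 := hφ t
  rw [SModEq.zero] at h1
  have : c ^ t • (⊤ : Submodule R (X →ₗ[R] E)) ≤ LinearMap.ker (LinearMap.applyₗ x) := by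
    rw [Submodule.smul_le]
    intro r hr ψ _
    rw [LinearMap.mem_ker]
    change r • ψ x = 0
    rw [← map_smul, ht r hr, map_zero]
  exact this h1

lemma DL.one_of_pow [IsLocalRing R] (t : ℕ) (ht : ∀ r ∈ maximalIdeal R ^ t, ∀ x : X, r • x = 0) : DL R X 1 := by
  have hs : ∀ q ∈ Module.support R X, q = closedPoint R := by
    intro q hq
    have h1 := Module.annihilator_le_of_mem_support hq
    have h2 : maximalIdeal R ^ t ≤ q.asIdeal := fun r hr => h1 (Module.mem_annihilator.2 (ht r hr))
    have h3 := q.2.le_of_pow_le h2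
    exact PrimeSpectrum.ext (le_antisymm (le_maximalIdeal q.2.ne_top) h3)
  have : Subsingleton (Module.support R X) := ⟨fun a b => Subtype.ext ((hs a a.2).trans (hs b b.2).symm)⟩
  have h0 : Order.krullDim (Module.support R X) ≤ 0 := Order.krullDim_nonpos_of_subsingleton
  exact lt_of_le_of_lt h0 (by exact_mod_cast Nat.zero_lt_one)

end tors

section KJ
variable [IsNoetherianRing R] [IsLocalRing R] (p : Ideal R) (xs : List R)

lemma H_tor (hrad : maximalIdeal R ≤ (p ⊔ Ideal.span {y | y ∈ xs}).radical) (j : ℕ) (M : Type u) [AddCommGroup M] [Module R M] (hp : ∀ r ∈ p, ∀ m : M, r • m = 0) : Tor (maximalIdeal R) ((cech xs).H j M) := by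
  intro h
  obtain ⟨u, rfl⟩ := Submodule.mkQ_surjective _ h
  set h := Submodule.mkQ ((cech xs).Bd j M |>.submoduleOf (LinearMap.ker ((cech xs).d j M))) u
  let A : Ideal R := LinearMap.ker (LinearMap.toSpanSingleton R _ h)
  have h1 : p ⊔ Ideal.span {y | y ∈ xs} ≤ A.radical := by
    rw [sup_le_iff, Ideal.span_le]
    constructor
    · intro r hr
      apply Ideal.le_radical
      change r • h = 0
      rw [← map_smul]
      have : r • u = 0 := Subtype.ext ((cech xs).kill j (hp r hr) u.1)
      rw [this, map_zero]
    · intro y hy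
      obtain ⟨t, ht⟩ := cech_P xs y hy j M u.1 u.2
      refine ⟨t, ?_⟩
      change y ^ t • h = 0
      rw [← map_smul]
      exact ((cech xs).H_mk_zero j M (y ^ t • u)).2 ht
  have h2 := hrad.trans (Ideal.radical_le_radical_iff.2 h1)
  obtain ⟨t, ht⟩ := Ideal.exists_pow_le_of_le_radical_of_fg h2 (IsNoetherian.noetherian _)
  exact ⟨t, fun r hr => ht hr⟩

theorem KJ (hrad : maximalIdeal R ≤ (p ⊔ Ideal.span {y | y ∈ xs}).radical) [IsAdicComplete (maximalIdeal R) R] (hxs : ∀ y ∈ xs, y ∈ maximalIdeal R) {E : Type u} [AddCommGroup E] [Module R E] (hE : IsE R E) (j : ℕ) : ∀ (M : Type u) [AddCommGroup M] [Module R M] [Module.Finite R M] (_ : ∀ r ∈ p, ∀ m : M, r • m = 0),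
    Module.Finite R ((cech xs).H j M →ₗ[R] E) ∧ DL R ((cech xs).H j M →ₗ[R] E) (j+1) := by
  have := hE.inj
  induction j with
  | zero =>
    intro M _ _ _ hp
    have f0 : Module.Finite R ((cech xs).X 0 M) := Module.Finite.equiv ((cech xs).e0 M).symm
    have f1 : Module.Finite R ((cech xs).H 0 M) := inferInstance
    obtain ⟨t, ht⟩ := (H_tor p xs hrad 0 M hp).exp
    exact ⟨hE.fin_len t ht, DL.one_of_pow t (fun r hr φ => by
      refine LinearMap.ext fun h => ?_
      change r • φ h = 0
      rw [← map_smul, ht r hr, map_zero])⟩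
  | succ j ih =>
    intro M _ _ _ hp
    let M' := M ⧸ Gam (maximalIdeal R) M
    have hp' : ∀ r ∈ p, ∀ m : M', r • m = 0 := by
      intro r hr m
      obtain ⟨m, rfl⟩ := Submodule.mkQ_surjective _ m
      rw [← map_smul, hp r hr, map_zero]
    obtain ⟨x, hx, hreg⟩ := exists_reg (maximalIdeal R) (Gam_quot (M := M) (maximalIdeal R))
    obtain ⟨δ, hδ⟩ := (cech xs).exists_delta j (M := M') hreg
    have hex := hom_exact (J := E) hδ
    obtain ⟨ihf, ihd⟩ := ih (QuotSMulTop x M') (by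
      intro r hr m
      obtain ⟨m, rfl⟩ := Submodule.mkQ_surjective _ m
      rw [← map_smul, hp' r hr, map_zero])
    have : IsHausdorff (maximalIdeal R) ((cech xs).H (j+1) M' →ₗ[R] E) := (H_tor p xs hrad (j+1) M' hp').hausdorff E
    have hle : x • (⊤ : Submodule R ((cech xs).H (j+1) M' →ₗ[R] E)) = LinearMap.ker (δ.lcomp R E) := by
      ext φ
      rw [LinearMap.mem_ker, hex φ, Submodule.mem_smul_pointwise_iff_exists]
      constructor
      · rintro ⟨ψ, -, rfl⟩
        exact ⟨ψ, by ext h; simp⟩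
      · rintro ⟨ψ, rfl⟩
        exact ⟨ψ, trivial, by ext h; simp⟩
    let ι : QuotSMulTop x ((cech xs).H (j+1) M' →ₗ[R] E) →ₗ[R] ((cech xs).H j (QuotSMulTop x M') →ₗ[R] E) := Submodule.liftQ _ (δ.lcomp R E) hle.le
    have hι : Function.Injective ι := LinearMap.ker_eq_bot.1 (Submodule.ker_liftQ_eq_bot' _ _ hle)
    have fin1 : Module.Finite R (QuotSMulTop x ((cech xs).H (j+1) M' →ₗ[R] E)) := Module.Finite.of_injective ι hι
    have fin2 := complete_nakayama hx fin1
    have d2 := DL.of_quot hx (ihd.inj ι hι)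
    have hinj := (cech xs).Hmap_inj j (Gam (maximalIdeal R) M).mkQ (Submodule.mkQ_surjective _) (by
      apply cech_tor
      intro y hy m
      obtain ⟨t, ht⟩ : m.1 ∈ Gam (maximalIdeal R) M := (Submodule.Quotient.mk_eq_zero _).1 m.2
      exact ⟨t, Subtype.ext (ht _ (Ideal.pow_mem_pow (hxs y hy) t))⟩)
    have hs := ((SES.ofInj _ hinj).hom E).surj
    exact ⟨Module.Finite.of_surjective _ hs, d2.surj _ hs⟩

end KJ

end LHV
end PartI

section PartJ
set_option autoImplicit false
open scoped TensorProduct Pointwise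
open IsLocalRing

namespace LHV
variable {R : Type u} [CommRing R]

lemma DL.lt_prime [IsNoetherianRing R] {p q : Ideal R} [p.IsPrime] {n : ℕ} (h : DL R (R ⧸ p) (n+1)) (hpq : p ≤ q) (hne : ¬ q ≤ p) : DL R (R ⧸ q) n := by
  obtain ⟨x, hxq, hxp⟩ := SetLike.not_le_iff_exists.1 hne
  have key : ∀ r ∈ q, ∀ m : R ⧸ q, r • m = 0 := by
    intro r hr m
    obtain ⟨m, rfl⟩ := Ideal.Quotient.mk_surjective m
    exact Ideal.Quotient.eq_zero_iff_mem.2 (q.mul_mem_right m hr)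
  exact h.prime (fun r hr => key r (hpq hr)) hxp (key x hxq)

lemma DL.of_ann [IsNoetherianRing R] {p : Ideal R} {n : ℕ} {M : Type u} [AddCommGroup M] [Module R M] [Module.Finite R M] (h : DL R (R ⧸ p) n)
    (hp : ∀ r ∈ p, ∀ m : M, r • m = 0) : DL R M n := h.supp (by
    rw [Module.support_eq_zeroLocus, Module.support_eq_zeroLocus, Ideal.annihilator_quotient]
    exact PrimeSpectrum.zeroLocus_anti_mono_ideal fun r hr => Module.mem_annihilator.2 (hp r hr))

lemma DL.ann_not_le [IsNoetherianRing R] {p : Ideal R} {n : ℕ} {M : Type u} [AddCommGroup M] [Module R M] [Module.Finite R M] (h : ¬ DL R (R ⧸ p) n)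
    (hM : DL R M n) : ∃ f ∉ p, ∀ m : M, f • m = 0 := by
  by_contra! hc
  apply h
  refine hM.supp ?_
  rw [Module.support_eq_zeroLocus, Module.support_eq_zeroLocus, Ideal.annihilator_quotient]
  refine PrimeSpectrum.zeroLocus_anti_mono_ideal fun r hr => ?_
  by_contra hrp
  obtain ⟨m, hm⟩ := hc r hrp
  exact hm (Module.mem_annihilator.1 hr m)

section sop
variable [IsNoetherianRing R] [IsLocalRing R]

lemma exists_sop (p : Ideal R) [p.IsPrime] {n : ℕ} (h : DL R (R ⧸ p) (n+1)) :
    ∃ xs : List R, xs.length ≤ n ∧ (∀ y ∈ xs, y ∈ maximalIdeal R) ∧ maximalIdeal R ≤ (p ⊔ Ideal.span {y | y ∈ xs}).radical := by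
  have : IsLocalRing (R ⧸ p) := IsLocalRing.of_surjective' _ Ideal.Quotient.mk_surjective
  obtain ⟨s, hs, hcard⟩ := (maximalIdeal (R ⧸ p)).exists_finset_card_eq_height_of_isNoetherianRing
  have hle : s.card ≤ n := by
    have h1 : ringKrullDim (R ⧸ p) < (((n+1 : ℕ) : ℕ∞) : WithBot ℕ∞) := by
      rw [← Module.supportDim_quotient_eq_ringKrullDim]; exact h
    rw [← IsLocalRing.maximalIdeal_height_eq_ringKrullDim, ← hcard] at h1
    have h2 : s.card < n + 1 := by exact_mod_cast h1
    lia
  choose l hl using (Ideal.Quotient.mk_surjective (I := p))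
  have hmap : ∀ y, y ∈ maximalIdeal R ↔ Ideal.Quotient.mk p y ∈ maximalIdeal (R ⧸ p) := by
    intro y
    have hloc : IsLocalHom (Ideal.Quotient.mk p) := Function.Surjective.isLocalHom _ Ideal.Quotient.mk_surjective
    rw [mem_maximalIdeal, mem_maximalIdeal, mem_nonunits_iff, mem_nonunits_iff, not_iff_not]
    exact ⟨fun h => h.map _, fun h => hloc.map_nonunit _ h⟩
  refine ⟨s.toList.map l, by simpa using hle, ?_, ?_⟩
  · intro y hy
    obtain ⟨z, hz, rfl⟩ := List.mem_map.1 hy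
    rw [hmap, hl]
    exact hs.1.2 (Ideal.subset_span (Finset.mem_toList.1 hz))
  · intro y hy
    have h1 : maximalIdeal (R ⧸ p) ≤ (Ideal.span (s : Set (R ⧸ p))).radical := by
      rw [Ideal.radical_eq_sInf, le_sInf_iff]
      rintro q ⟨hq, hqp⟩
      exact hs.2 ⟨hqp, hq⟩ (le_maximalIdeal hqp.ne_top)
    obtain ⟨t, ht⟩ := h1 ((hmap y).1 hy)
    refine ⟨t, ?_⟩
    have h2 : Ideal.span (s : Set (R ⧸ p)) = (Ideal.span {y | y ∈ s.toList.map l}).map (Ideal.Quotient.mk p) := by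
      rw [Ideal.map_span]
      congr 1
      ext z
      simp only [Set.mem_image, Set.mem_ofPred_eq, List.mem_map, Finset.mem_toList, Finset.mem_coe]
      constructor
      · exact fun hz => ⟨l z, ⟨z, hz, rfl⟩, hl z⟩
      · rintro ⟨_, ⟨w, hw, rfl⟩, rfl⟩
        rwa [hl]
    rw [h2, ← map_pow, ← Ideal.mem_comap, Ideal.comap_map_of_surjective _ Ideal.Quotient.mk_surjective, ← RingHom.ker_eq_comap_bot, Ideal.mk_ker, sup_comm] at ht
    exact ht

theorem chevalley [IsAdicComplete (maximalIdeal R) R] (p : Ideal R) (Q : ℕ → Ideal R) (hQ : Antitone Q) (hi : ⨅ t, Q t ≤ p) (k : ℕ) :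
    ∃ t, Q t ≤ maximalIdeal R ^ k ⊔ p := by
  set m := maximalIdeal R with hm
  have stab : ∀ k, ∃ t, ∀ s, t ≤ s → Q t ⊔ m ^ k = Q s ⊔ m ^ k := by
    intro k
    cases k with
    | zero => exact ⟨0, fun s _ => by simp⟩
    | succ k =>
      have hA : IsArtinianRing (R ⧸ m ^ (k+1)) := by
        apply IsLocalRing.quotient_artinian_of_mem_minimalPrimes_of_isLocalRing
        refine ⟨⟨inferInstance, Ideal.pow_le_self (by lia)⟩, ?_⟩
        rintro q ⟨hq, hqm⟩ _
        exact hq.le_of_pow_le hqm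
      obtain ⟨t, ht⟩ := IsArtinian.monotone_stabilizes (R := R ⧸ m ^ (k+1)) (M := R ⧸ m ^ (k+1)) ⟨fun t => OrderDual.toDual ((Q t).map (Ideal.Quotient.mk (m ^ (k+1)))), fun s t hst => Ideal.map_mono (hQ hst)⟩
      refine ⟨t, fun s hs => ?_⟩
      have h1 : (Q t).map (Ideal.Quotient.mk (m ^ (k+1))) = (Q s).map (Ideal.Quotient.mk (m ^ (k+1))) := ht s hs
      have h2 := congrArg (Ideal.comap (Ideal.Quotient.mk (m ^ (k+1)))) h1
      rwa [Ideal.comap_map_of_surjective _ Ideal.Quotient.mk_surjective, Ideal.comap_map_of_surjective _ Ideal.Quotient.mk_surjective, ← RingHom.ker_eq_comap_bot, Ideal.mk_ker] at h2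
  choose T hT using stab
  have step : ∀ i, ∀ r ∈ Q (T i) ⊔ m ^ i, ∃ r' ∈ Q (T (i+1)) ⊔ m ^ (i+1), r - r' ∈ m ^ i := by
    intro i r hr
    rw [hT i (T i + T (i+1)) (by lia)] at hr
    obtain ⟨u, hu, v, hv, rfl⟩ := Submodule.mem_sup.1 hr
    exact ⟨u, Ideal.mem_sup_left (hQ (by lia) hu), by simpa using hv⟩
  choose! nx hnx1 hnx2 using step
  refine ⟨T k, fun r hr => ?_⟩
  let seq : ℕ → R := fun i => Nat.rec r (fun i r => nx (k + i) r) i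
  have hseq : ∀ i, seq i ∈ Q (T (k + i)) ⊔ m ^ (k + i) := by
    intro i
    induction i with
    | zero => exact Ideal.mem_sup_left hr
    | succ i ih => exact hnx1 (k+i) _ ih
  have hd : ∀ i, seq i - seq (i+1) ∈ m ^ (k + i) := fun i => hnx2 (k+i) _ (hseq i)
  have hd2 : ∀ i j, seq i - seq (i + j) ∈ m ^ (k + i) := by
    intro i j
    induction j with
    | zero => simp
    | succ j ih =>
      have := (m ^ (k+i)).add_mem ih (Ideal.pow_le_pow_right (by lia) (hd (i+j)))
      simpa [add_assoc] using this
  obtain ⟨L, hL⟩ := IsPrecomplete.prec (I := m) (M := R) inferInstance (f := seq) (by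
    intro i j hij
    obtain ⟨j, rfl⟩ := Nat.exists_eq_add_of_le hij
    rw [SModEq.sub_mem]
    simpa using Ideal.pow_le_pow_right (by lia) (hd2 i j))
  have hL' : ∀ i, seq i - L ∈ m ^ i := fun i => by
    have := hL i
    rw [SModEq.sub_mem] at this
    simpa using this
  have hLQ : ∀ t, L ∈ Q t := by
    intro t
    by_cases htop : Q t = ⊤
    · rw [htop]; trivial
    have h1 : ∀ i, L ∈ Q t ⊔ m ^ i := by
      intro i
      have h2 : seq i ∈ Q t ⊔ m ^ i := by
        have h3 := hseq i
        rw [hT (k+i) (T (k+i) + t) (by lia)] at h3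
        exact sup_le_sup (hQ (by lia)) (Ideal.pow_le_pow_right (by lia)) h3
      have := (Q t ⊔ m ^ i).sub_mem h2 (Ideal.mem_sup_right (hL' i))
      simpa using this
    have hh : IsHausdorff m (R ⧸ Q t) := inferInstance
    rw [← Ideal.Quotient.eq_zero_iff_mem]
    refine hh.haus _ (fun i => ?_)
    rw [SModEq.zero]
    obtain ⟨u, hu, v, hv, huv⟩ := Submodule.mem_sup.1 (h1 i)
    have : Ideal.Quotient.mk (Q t) L = v • (1 : R ⧸ Q t) := by
      rw [← huv, map_add, Ideal.Quotient.eq_zero_iff_mem.2 hu, zero_add, Algebra.smul_def, mul_one]; rfl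
    rw [this]
    exact Submodule.smul_mem_smul hv trivial
  have hLp : L ∈ p := hi (Submodule.mem_iInf _ |>.2 hLQ)
  have h5 : r - L ∈ m ^ k := by
    have h6 := hd2 0 k
    have h7 := hL' k
    have h8 : seq 0 - seq k ∈ m ^ k := by simpa using h6
    have : seq 0 - L ∈ m ^ k := by simpa using (m ^ k).add_mem h8 h7
    exact this
  have := (m ^ k ⊔ p).add_mem (Ideal.mem_sup_left h5) (Ideal.mem_sup_right hLp)
  simpa using this

end sop

/-- symbolic powers modulo `p` -/
def SP (p P : Ideal R) [P.IsPrime] (t : ℕ) : Ideal R where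
  carrier := {r | ∃ s ∉ P, s * r ∈ P ^ t ⊔ p}
  zero_mem' := ⟨1, fun h => (Ideal.ne_top_iff_one P).1 (Ideal.IsPrime.ne_top inferInstance) h, by simp⟩
  add_mem' := by
    rintro a b ⟨s, hs, hsa⟩ ⟨t, ht, htb⟩
    refine ⟨s * t, fun h => (Ideal.IsPrime.mem_or_mem inferInstance h).elim hs ht, ?_⟩
    rw [mul_add]
    refine Ideal.add_mem _ ?_ ?_
    · rw [mul_comm s, mul_assoc]; exact Ideal.mul_mem_left _ _ hsa
    · rw [mul_assoc]; exact Ideal.mul_mem_left _ _ htb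
  smul_mem' := by
    rintro c a ⟨s, hs, hsa⟩
    exact ⟨s, hs, by rw [smul_eq_mul, mul_left_comm]; exact Ideal.mul_mem_left _ _ hsa⟩

section SP
variable (p P : Ideal R) [P.IsPrime]

lemma SP_anti : Antitone (SP p P) := by
  rintro s t hst r ⟨x, hx, hr⟩
  exact ⟨x, hx, (sup_le_sup (Ideal.pow_le_pow_right hst) le_rfl : P ^ t ⊔ p ≤ P ^ s ⊔ p) hr⟩

lemma SP_le (t : ℕ) : P ^ t ⊔ p ≤ SP p P t := fun r hr =>
  ⟨1, fun h => (Ideal.ne_top_iff_one P).1 (Ideal.IsPrime.ne_top inferInstance) h, by rwa [one_mul]⟩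

lemma SP_nzd (t : ℕ) {y r : R} (hy : y ∉ P) (h : y * r ∈ SP p P t) : r ∈ SP p P t := by
  obtain ⟨s, hs, h⟩ := h
  exact ⟨s * y, fun h => (Ideal.IsPrime.mem_or_mem inferInstance h).elim hs hy, by rwa [mul_assoc]⟩

lemma SP_inf [IsNoetherianRing R] [p.IsPrime] (hpP : p ≤ P) : ⨅ t, SP p P t ≤ p := by
  intro r hr
  rw [Submodule.mem_iInf] at hr
  have hP : (P.map (Ideal.Quotient.mk p)).IsPrime := Ideal.map_isPrime_of_surjective Ideal.Quotient.mk_surjective (by rwa [Ideal.mk_ker])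
  have hmem : ∀ s, s ∉ P → Ideal.Quotient.mk p s ∉ P.map (Ideal.Quotient.mk p) := by
    intro s hs h
    rw [← Ideal.mem_comap, Ideal.comap_map_of_surjective _ Ideal.Quotient.mk_surjective, ← RingHom.ker_eq_comap_bot, Ideal.mk_ker, sup_eq_left.2 hpP] at h
    exact hs h
  set A := Localization.AtPrime (P.map (Ideal.Quotient.mk p))
  have hA : IsNoetherianRing A := IsLocalization.isNoetherianRing (P.map (Ideal.Quotient.mk p)).primeCompl _ inferInstance
  let φ : R →+* A := (algebraMap (R ⧸ p) A).comp (Ideal.Quotient.mk p)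
  have hφP : P.map φ ≤ maximalIdeal A := by
    rw [Ideal.map_le_iff_le_comap]
    intro x hx
    have : Ideal.Quotient.mk p x ∈ P.map (Ideal.Quotient.mk p) := Ideal.mem_map_of_mem _ hx
    exact (IsLocalization.AtPrime.to_map_mem_maximal_iff A (P.map (Ideal.Quotient.mk p)) (Ideal.Quotient.mk p x)).2 this
  have hφp : p.map φ ≤ ⊥ := by
    rw [Ideal.map_le_iff_le_comap]
    intro x hx
    change φ x = 0
    simp [φ, Ideal.Quotient.eq_zero_iff_mem.2 hx]
  have h0 : φ r ∈ ⨅ t, (maximalIdeal A) ^ t := by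
    rw [Submodule.mem_iInf]
    intro t
    obtain ⟨s, hs, hsr⟩ := hr t
    have h1 : φ (s * r) ∈ (maximalIdeal A) ^ t := by
      have h2 := Ideal.mem_map_of_mem φ hsr
      rw [Ideal.map_sup, Ideal.map_pow] at h2
      exact (sup_le (Ideal.pow_right_mono hφP t) (hφp.trans bot_le)) h2
    have hu : IsUnit (φ s) := IsLocalization.map_units A (⟨_, hmem s hs⟩ : (P.map (Ideal.Quotient.mk p)).primeCompl)
    rw [map_mul] at h1
    exact (Ideal.unit_mul_mem_iff_mem _ hu).1 h1
  rw [Ideal.iInf_pow_eq_bot_of_isLocalRing _ (maximalIdeal.isMaximal A).ne_top] at h0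
  have h3 : φ r = 0 := h0
  have h4 : Ideal.Quotient.mk p r = 0 := by
    refine IsLocalization.injective A (M := (P.map (Ideal.Quotient.mk p)).primeCompl) ?_ (h3.trans (map_zero _).symm)
    exact Ideal.primeCompl_le_nonZeroDivisors _
  exact Ideal.Quotient.eq_zero_iff_mem.1 h4

end SP

lemma exists_map_domain [IsNoetherianRing R] (p : Ideal R) [p.IsPrime] (M : Type u) [AddCommGroup M] [Module R M] [Module.Finite R M]
    (hp : ∀ r ∈ p, ∀ m : M, r • m = 0) (hann : ∀ r : R, (∀ m : M, r • m = 0) → r ∈ p) : ∃ θ : M →ₗ[R] (R ⧸ p), θ ≠ 0 := by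
  obtain ⟨k, s, hs⟩ := Module.Finite.exists_fin (R := R) (M := M)
  have spankill : ∀ (N : Type u) [AddCommGroup N] [Module R N] (f : M →ₗ[R] N), (∀ i, f (s i) = 0) → ∀ m, f m = 0 := by
    intro N _ _ f h m
    have : Submodule.span R (Set.range s) ≤ LinearMap.ker f := by
      rw [Submodule.span_le]
      rintro _ ⟨i, rfl⟩
      exact h i
    exact this (hs ▸ trivial)
  -- an element with annihilator `p`
  obtain ⟨m0, hm0⟩ : ∃ m0 : M, ∀ r : R, r • m0 = 0 → r ∈ p := by
    by_contra! hc
    choose r hr hrp using fun i => hc (s i)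
    have : ∏ i, r i ∈ p := by
      apply hann
      refine spankill M (LinearMap.lsmul R M (∏ i, r i)) (fun i => ?_)
      change (∏ i, r i) • s i = 0
      rw [← Finset.prod_erase_mul _ _ (Finset.mem_univ i), mul_smul, hr, smul_zero]
    rw [Ideal.IsPrime.prod_mem_iff] at this
    obtain ⟨i, -, hi⟩ := this
    exact hrp i hi
  obtain ⟨N, -, hN, hmax⟩ := zorn_disj ⊥ (Submodule.span R {m0}) disjoint_bot_left
  have hdisj : ∀ r : R, r • m0 ∈ N → r ∈ p := fun r hr => hm0 r
    (Submodule.disjoint_def.1 hN _ hr (Submodule.smul_mem _ _ (Submodule.mem_span_singleton_self m0)))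
  have h1 : ∀ m : M, ∃ r ∉ p, ∃ c : R, r • m - c • m0 ∈ N := by
    intro m
    by_cases hmN : m ∈ N
    · exact ⟨1, (Ideal.ne_top_iff_one p).1 (Ideal.IsPrime.ne_top inferInstance), 0, by simpa using hmN⟩
    · by_contra! hc
      apply hmN
      have h2 : N ⊔ Submodule.span R {m} = N := by
        apply hmax _ le_sup_left
        rw [Submodule.disjoint_def]
        intro x hx hx'
        obtain ⟨c, rfl⟩ := Submodule.mem_span_singleton.1 hx'
        obtain ⟨n, hn, z, hz, hnz⟩ := Submodule.mem_sup.1 hx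
        obtain ⟨r, rfl⟩ := Submodule.mem_span_singleton.1 hz
        have h3 : r ∈ p := by
          by_contra hr
          apply hc r hr c
          rw [← hnz]
          simpa using hn
        rw [hp r h3, add_zero] at hnz
        rw [hnz] at hn
        exact hp c (hdisj c hn) m0
      rw [← h2]
      exact Submodule.mem_sup_right (Submodule.mem_span_singleton_self m)
  choose r hr c hrc using fun i => h1 (s i)
  have hprod : ∏ i, r i ∉ p := by
    rw [Ideal.IsPrime.prod_mem_iff]
    rintro ⟨i, -, hi⟩
    exact hr i hi
  let g : (R ⧸ p) →ₗ[R] (M ⧸ N) := Submodule.liftQ p (LinearMap.toSpanSingleton R _ (N.mkQ m0)) (fun x hx => by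
    rw [LinearMap.mem_ker, LinearMap.toSpanSingleton_apply, ← map_smul, hp x hx, map_zero])
  have hg : Function.Injective g := by
    rw [← LinearMap.ker_eq_bot, Submodule.eq_bot_iff]
    intro x hx
    obtain ⟨x, rfl⟩ := Submodule.mkQ_surjective _ x
    have h2 : x • N.mkQ m0 = 0 := hx
    rw [← map_smul, Submodule.mkQ_apply, Submodule.Quotient.mk_eq_zero] at h2
    exact Ideal.Quotient.eq_zero_iff_mem.2 (hdisj x h2)
  let f : M →ₗ[R] (M ⧸ N) := (∏ i, r i) • N.mkQ
  have hf : ∀ m, f m ∈ LinearMap.range g := by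
    intro m
    have := spankill _ ((LinearMap.range g).mkQ ∘ₗ f) (fun i => by
      rw [LinearMap.comp_apply, Submodule.mkQ_apply, Submodule.Quotient.mk_eq_zero]
      change (∏ i, r i) • N.mkQ (s i) ∈ _
      rw [← Finset.prod_erase_mul _ _ (Finset.mem_univ i), mul_smul]
      apply Submodule.smul_mem
      refine ⟨Ideal.Quotient.mk p (c i), ?_⟩
      change c i • N.mkQ m0 = _
      rw [← map_smul, ← map_smul, eq_comm, ← sub_eq_zero, ← map_sub, Submodule.mkQ_apply, Submodule.Quotient.mk_eq_zero]
      exact hrc i) m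
    rwa [LinearMap.comp_apply, Submodule.mkQ_apply, Submodule.Quotient.mk_eq_zero] at this
  let θ : M →ₗ[R] (R ⧸ p) := (LinearEquiv.ofInjective g hg).symm.toLinearMap ∘ₗ f.codRestrict _ hf
  refine ⟨θ, fun h0 => hprod (hdisj _ ?_)⟩
  have h1 : (LinearEquiv.ofInjective g hg).symm (f.codRestrict _ hf m0) = 0 := LinearMap.congr_fun h0 m0
  rw [LinearEquiv.symm_apply_eq, map_zero] at h1
  have h2 : f m0 = 0 := congrArg Subtype.val h1
  have h3 : N.mkQ ((∏ i, r i) • m0) = 0 := by rw [map_smul]; exact h2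
  rwa [Submodule.mkQ_apply, Submodule.Quotient.mk_eq_zero] at h3

end LHV
end PartJ

section PartK
set_option autoImplicit false
open scoped TensorProduct Pointwise
open IsLocalRing
namespace LHV
variable {R : Type u} [CommRing R]

/-- dual cocycles -/
def CF.W (C : CF R) (j : ℕ) (M E : Type u) [AddCommGroup M] [Module R M] [AddCommGroup E] [Module R E] :
    Submodule R (C.X j M →ₗ[R] E) where
  carrier := {φ | ∀ b ∈ C.Bd j M, φ b = 0}
  zero_mem' := fun _ _ => rfl
  add_mem' := fun ha hb u hu => by rw [LinearMap.add_apply, ha u hu, hb u hu, add_zero]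
  smul_mem' := fun c a ha u hu => by rw [LinearMap.smul_apply, ha u hu, smul_zero]

/-- dual differential -/
abbrev CF.D (C : CF R) (j : ℕ) (M E : Type u) [AddCommGroup M] [Module R M] [AddCommGroup E] [Module R E] :
    (C.X (j+1) M →ₗ[R] E) →ₗ[R] (C.X j M →ₗ[R] E) := LinearMap.lcomp R E (C.d j M)

section WD
variable (C : CF R) (j : ℕ) (M E : Type u) [AddCommGroup M] [Module R M] [AddCommGroup E] [Module R E]

lemma CF.V_le_W : LinearMap.range (C.D j M E) ≤ C.W j M E := by
  rintro _ ⟨ψ, rfl⟩ u hu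
  have : C.d j M u = 0 := C.Bd_le j M hu
  change ψ (C.d j M u) = 0
  rw [this, _root_.map_zero]

lemma CF.ker_D : LinearMap.ker (C.D j M E) = C.W (j+1) M E := by
  ext φ
  constructor
  · rintro h _ ⟨u, rfl⟩
    exact LinearMap.congr_fun h u
  · intro h
    ext u
    exact h _ ⟨u, rfl⟩

lemma CF.W_ses : SES (C.W (j+1) M E).subtype (C.D j M E).rangeRestrict where
  inj := Subtype.val_injective
  surj := LinearMap.surjective_rangeRestrict _
  ex := by
    intro φ
    have : φ ∈ LinearMap.ker (C.D j M E) ↔ φ ∈ C.W (j+1) M E := by rw [C.ker_D]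
    constructor
    · intro h
      exact ⟨⟨φ, this.1 (congrArg Subtype.val h)⟩, rfl⟩
    · rintro ⟨⟨φ, h⟩, rfl⟩
      exact Subtype.ext (this.2 h)

variable {E}
lemma CF.W_smul [Module.Injective R E] {f : R} (hf : ∀ h : C.H j M, f • h = 0) (φ : C.X j M →ₗ[R] E) (hφ : φ ∈ C.W j M E) :
    f • φ ∈ LinearMap.range (C.D j M E) := by
  have hex : Function.Exact (LinearMap.ker (C.d j M)).subtype (C.d j M) := by
    intro u
    constructor
    · intro h; exact ⟨⟨u, h⟩, rfl⟩
    · rintro ⟨⟨u, h⟩, rfl⟩; exact h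
  have := (hom_exact (J := E) hex (f • φ)).1 (by
    ext u
    have h1 : (Submodule.Quotient.mk (f • u) : C.H j M) = 0 := hf (Submodule.Quotient.mk u)
    rw [C.H_mk_zero] at h1
    have := hφ _ h1
    change f • φ u = 0
    rw [← _root_.map_smul]
    exact this)
  exact this

end WD

section main
variable [IsNoetherianRing R] [IsLocalRing R] [IsAdicComplete (maximalIdeal R) R]
variable {E : Type u} [AddCommGroup E] [Module R E]

lemma acyc (hE : IsE R E) (a : Ideal R) (N : Type u) [AddCommGroup N] [Module R N] [Module.Finite R N] (xs : List R) (j i : ℕ) :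
    Subsingleton (HL a (i+1) ((cech xs).X j N →ₗ[R] E)) := by
  have := hE.inj
  have h := cech_acyc (E := E) a N xs j i R
  exact (HL.congr a (i+1) (LinearEquiv.congrLeft E R ((cech xs).congr j (TensorProduct.lid R N)))).symm.toEquiv.subsingleton

lemma kill_quot (p : Ideal R) : ∀ r ∈ p, ∀ m : R ⧸ p, r • m = 0 := by
  intro r hr m
  rw [Algebra.smul_def]
  have : algebraMap R (R ⧸ p) r = 0 := Ideal.Quotient.eq_zero_iff_mem.2 hr
  rw [this, zero_mul]

lemma quot_ann (p : Ideal R) {r : R} (h : ∀ m : R ⧸ p, r • m = 0) : r ∈ p := by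
  have := h 1
  rw [Algebra.smul_def, mul_one] at this
  exact Ideal.Quotient.eq_zero_iff_mem.1 this

lemma exists_f (hE : IsE R E) (p : Ideal R) [p.IsPrime] {n : ℕ} (hn : ¬ DL R (R ⧸ p) n) (xs : List R) (hxs : ∀ y ∈ xs, y ∈ maximalIdeal R)
    (hrad : maximalIdeal R ≤ (p ⊔ Ideal.span {y | y ∈ xs}).radical) :
    ∃ f ∉ p, ∀ j < n, ∀ h : (cech xs).H j (R ⧸ p), f • h = 0 := by
  have h1 : ∀ j < n, ∃ f ∉ p, ∀ h : (cech xs).H j (R ⧸ p), f • h = 0 := by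
    intro j hj
    obtain ⟨hfin, hdl⟩ := KJ p xs hrad hxs hE j (R ⧸ p) (kill_quot p)
    obtain ⟨f, hf, hf'⟩ := DL.ann_not_le hn (hdl.mono hj)
    exact ⟨f, hf, hE.ann hf'⟩
  choose! f hf hf' using h1
  refine ⟨∏ j ∈ Finset.range n, f j, ?_, ?_⟩
  · rw [Ideal.IsPrime.prod_mem_iff]
    rintro ⟨j, hj, h⟩
    exact hf j (Finset.mem_range.1 hj) h
  · intro j hj h
    rw [← Finset.prod_erase_mul _ _ (Finset.mem_range.2 hj), mul_smul, hf' j hj, smul_zero]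

/-- the key lifting -/
lemma lift0 (hE : IsE R E) (p a P : Ideal R) [p.IsPrime] [P.IsPrime] (hpP : p ≤ P) (haP : a ≤ P) (hmP : ¬ maximalIdeal R ≤ P) (xs : List R)
    (hrad : maximalIdeal R ≤ (p ⊔ Ideal.span {y | y ∈ xs}).radical) (φ : (cech xs).X 0 (R ⧸ p) →ₗ[R] E) :
    ∃ ψ ∈ Gam a ((cech xs).X 1 (R ⧸ p) →ₗ[R] E), (cech xs).D 0 (R ⧸ p) E ψ = φ := by
  have := hE.inj
  obtain ⟨y, hyx, hyP⟩ : ∃ y ∈ xs, y ∉ P := by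
    by_contra! hc
    apply hmP
    refine hrad.trans ?_
    rw [Ideal.IsRadical.radical_le_iff (Ideal.IsPrime.isRadical inferInstance)]
    exact sup_le hpP (Ideal.span_le.2 hc)
  set e1 : (cech xs).X 0 (R ⧸ p) := ((cech xs).e0 (R ⧸ p)).symm 1 with he1
  have hgen : ∀ u : (cech xs).X 0 (R ⧸ p), ∃ r : R, u = r • e1 := by
    intro u
    obtain ⟨r, hr⟩ := Ideal.Quotient.mk_surjective ((cech xs).e0 (R ⧸ p) u)
    refine ⟨r, ((cech xs).e0 (R ⧸ p)).injective ?_⟩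
    rw [_root_.map_smul, he1, LinearEquiv.apply_symm_apply, ← hr, Algebra.smul_def, mul_one]; rfl
  obtain ⟨k, hk⟩ := hE.tor (φ e1)
  obtain ⟨t, ht⟩ := chevalley p (SP p P) (SP_anti p P) (SP_inf p P hpP) k
  have hpe : ∀ r ∈ p, r • e1 = 0 := fun r hr => by
    rw [he1, ← _root_.map_smul, kill_quot p r hr, _root_.map_zero]
  have hQ : ∀ r ∈ SP p P t, r • φ e1 = 0 := by
    intro r hr
    obtain ⟨u, hu, v, hv, rfl⟩ := Submodule.mem_sup.1 (ht hr)
    rw [add_smul, hk u hu, ← _root_.map_smul, hpe v hv, _root_.map_zero, add_zero]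
  have hpQ : p ≤ SP p P t := le_sup_right.trans (SP_le p P t)
  let π : (R ⧸ p) →ₗ[R] (R ⧸ SP p P t) := Submodule.mapQ p (SP p P t) LinearMap.id hpQ
  have hπ : Function.Surjective π := by
    intro x
    obtain ⟨x, rfl⟩ := Submodule.mkQ_surjective _ x
    exact ⟨Submodule.mkQ _ x, rfl⟩
  have S := (cech xs).ses 0 (SES.ofSurj π hπ)
  obtain ⟨φ', hφ'⟩ := (hom_exact (J := E) S.ex φ).1 (by
    ext w
    change φ ((cech xs).map 0 _ w) = 0
    set u := (cech xs).map 0 (LinearMap.ker π).subtype w with hu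
    obtain ⟨r, hr⟩ := hgen u
    have h1 : (cech xs).map 0 π u = 0 := (S.ex u).2 ⟨w, rfl⟩
    have h2 := (cech xs).e0_nat π u
    rw [h1, _root_.map_zero, hr, _root_.map_smul, he1, LinearEquiv.apply_symm_apply] at h2
    have h3 : r ∈ SP p P t := by
      have h4 : π (r • (1 : R ⧸ p)) = Ideal.Quotient.mk _ r := by
        rw [Algebra.smul_def, mul_one]; rfl
      rw [h4] at h2
      exact Ideal.Quotient.eq_zero_iff_mem.1 h2.symm
    rw [hr, _root_.map_smul]
    exact hQ r h3)
  have hinj : Function.Injective ((cech xs).d 0 (R ⧸ SP p P t)) := by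
    rw [← LinearMap.ker_eq_bot, Submodule.eq_bot_iff]
    intro z hz
    obtain ⟨s, hs⟩ := cech_P xs y hyx 0 _ z hz
    have hs : y ^ s • z = 0 := hs
    apply ((cech xs).e0 _).injective
    rw [_root_.map_zero]
    obtain ⟨r, hr⟩ := Ideal.Quotient.mk_surjective ((cech xs).e0 _ z)
    have h5 := congrArg ((cech xs).e0 _) hs
    rw [_root_.map_smul, _root_.map_zero, ← hr, Algebra.smul_def] at h5
    have h6 : y ^ s * r ∈ SP p P t := Ideal.Quotient.eq_zero_iff_mem.1 h5
    rw [← hr]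
    refine Ideal.Quotient.eq_zero_iff_mem.2 (SP_nzd p P t (fun h => hyP (Ideal.IsPrime.mem_of_pow_mem inferInstance s h)) h6)
  obtain ⟨ψ', hψ2⟩ := Module.Injective.out (self := hE.inj) ((cech xs).d 0 (R ⧸ SP p P t)) hinj φ'
  refine ⟨ψ' ∘ₗ (cech xs).map 1 π, ⟨t, fun r hr => ?_⟩, ?_⟩
  · ext u
    have h7 : r ∈ SP p P t := SP_le p P t (Ideal.mem_sup_left (Ideal.pow_right_mono haP t hr))
    change r • ψ' ((cech xs).map 1 π u) = 0
    rw [← _root_.map_smul, (cech xs).kill 1 (kill_quot _ r h7), _root_.map_zero]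
  · rw [← hφ']
    ext u
    change ψ' ((cech xs).map 1 π ((cech xs).d 0 _ u)) = φ' ((cech xs).map 0 π u)
    rw [← (cech xs).d_nat 0, hψ2]

lemma kill_V (C : CF R) (j : ℕ) (M : Type u) [AddCommGroup M] [Module R M] [Module.Injective R E] {f g : R} (hf : ∀ h : C.H j M, f • h = 0)
    (a : Ideal R) (i : ℕ) (hg : ∀ h : HL a i (C.W j M E), g • h = 0) (v : HL a i (LinearMap.range (C.D j M E))) : (f * g) • v = 0 := by
  let ι := Submodule.inclusion (C.V_le_W j M E)
  let μ : C.W j M E →ₗ[R] LinearMap.range (C.D j M E) :=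
    ((LinearMap.lsmul R _ f) ∘ₗ (C.W j M E).subtype).codRestrict _ (fun φ => C.W_smul j M hf φ.1 φ.2)
  have h1 : μ ∘ₗ ι = LinearMap.lsmul R _ f := by ext; rfl
  have h2 := HL.map_lsmul a i f v
  rw [← h1, HL.map_comp] at h2
  rw [mul_comm, mul_smul, ← h2, LinearMap.comp_apply, ← _root_.map_smul, hg, _root_.map_zero]

lemma kill_W (C : CF R) (j : ℕ) (M : Type u) [AddCommGroup M] [Module R M] [Module.Injective R E] {f g : R} (hf : ∀ h : C.H j M, f • h = 0)
    (a : Ideal R) (i : ℕ) (hg : ∀ h : HL a i (LinearMap.range (C.D j M E)), g • h = 0) (v : HL a i (C.W j M E)) : (f * g) • v = 0 := by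
  let ι := Submodule.inclusion (C.V_le_W j M E)
  let μ : C.W j M E →ₗ[R] LinearMap.range (C.D j M E) :=
    ((LinearMap.lsmul R _ f) ∘ₗ (C.W j M E).subtype).codRestrict _ (fun φ => C.W_smul j M hf φ.1 φ.2)
  have h1 : ι ∘ₗ μ = LinearMap.lsmul R _ f := by ext; rfl
  have h2 := HL.map_lsmul a i f v
  rw [← h1, HL.map_comp] at h2
  rw [mul_comm, mul_smul, ← h2, LinearMap.comp_apply, ← _root_.map_smul, hg, _root_.map_zero]

lemma up (hE : IsE R E) (p a P : Ideal R) [p.IsPrime] [P.IsPrime] (hpP : p ≤ P) (haP : a ≤ P) (hmP : ¬ maximalIdeal R ≤ P) (xs : List R)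
    (hrad : maximalIdeal R ≤ (p ⊔ Ideal.span {y | y ∈ xs}).radical) {f : R} {n : ℕ} (hf : ∀ j < n, ∀ h : (cech xs).H j (R ⧸ p), f • h = 0)
    (j : ℕ) (hj : j < n) (w : HL a (j+1) ((cech xs).W (j+1) (R ⧸ p) E)) : f ^ j • w = 0 := by
  have := hE.inj
  induction j with
  | zero =>
    have := ((cech xs).W_ses 0 (R ⧸ p) E).vanish1 (a := a) (fun x _ => by
      obtain ⟨ψ, hψ, h⟩ := lift0 hE p a P hpP haP hmP xs hrad x.1
      exact ⟨ψ, hψ, Subtype.ext h⟩) (acyc hE a _ xs 1 0)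
    exact Subsingleton.elim _ _
  | succ j ih =>
    have hs := acyc hE a (R ⧸ p) xs (j+2) (j+1)
    obtain ⟨v, rfl⟩ := (((cech xs).W_ses (j+1) (R ⧸ p) E).ex₁ (a := a) (i := j+1) w).1 (Subsingleton.elim _ _)
    rw [← _root_.map_smul, pow_succ', kill_V (cech xs) (j+1) (R ⧸ p) (hf (j+1) hj) a (j+1) (ih (by lia)), _root_.map_zero]

lemma down (hE : IsE R E) (p : Ideal R) [p.IsPrime] (xs : List R) (hxs : ∀ y ∈ xs, y ∈ maximalIdeal R)
    {f : R} {n : ℕ} (hf : ∀ j < n, ∀ h : (cech xs).H j (R ⧸ p), f • h = 0) (g : R)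
    (hg : ∀ φ : (cech xs).W n (R ⧸ p) E, g • φ = 0) (j : ℕ) (hj : j ≤ n) :
    ∀ w : HL (maximalIdeal R) (n-j) ((cech xs).W (n-j) (R ⧸ p) E), (f ^ j * g) • w = 0 := by
  have := hE.inj
  induction j with
  | zero =>
    intro w
    rw [pow_zero, one_mul]
    exact HL.smul_eq_zero_of g hg w
  | succ j ih =>
    obtain ⟨i, hi, hin⟩ : ∃ i, n - j = i + 1 ∧ i < n := ⟨n - j - 1, by lia, by lia⟩
    have hi' : n - (j+1) = i := by lia
    have ih := ih (by lia)
    rw [hi] at ih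
    rw [hi', pow_succ', mul_assoc]
    refine kill_W (cech xs) i (R ⧸ p) (hf i hin) _ i (fun v => ?_)
    have hJ : Subsingleton (HL (maximalIdeal R) i ((cech xs).X (i+1) (R ⧸ p) →ₗ[R] E)) := by
      cases i with
      | succ i => exact acyc hE _ _ _ _ _
      | zero =>
        have : Subsingleton (Gam (maximalIdeal R) ((cech xs).X (0+1) (R ⧸ p) →ₗ[R] E)) := by
          refine subsingleton_of_forall_eq 0 ?_
          rintro ⟨φ, t, ht⟩
          exact Subtype.ext (cech_div xs 0 _ φ (fun y hy => ⟨t, ht _ (Ideal.pow_mem_pow (hxs y hy) t)⟩))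
        exact (HL.zeroEquiv _ _).toEquiv.subsingleton
    have S := (cech xs).W_ses i (R ⧸ p) E
    have h0 : S.δ (maximalIdeal R) i ((f ^ j * g) • v) = 0 := by rw [_root_.map_smul, ih]
    obtain ⟨z, hz⟩ := (S.ex₃ _).1 h0
    rw [← hz, Subsingleton.elim z 0, _root_.map_zero]

/-- Lichtenbaum--Hartshorne for `R ⧸ p`. -/
theorem LHVT (p a P : Ideal R) [p.IsPrime] [P.IsPrime] (hpP : p ≤ P) (haP : a ≤ P) (hmP : ¬ maximalIdeal R ≤ P) {n : ℕ}
    (h1 : DL R (R ⧸ p) (n+1)) (h0 : ¬ DL R (R ⧸ p) n) : Subsingleton (HL a n (R ⧸ p)) := by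
  obtain ⟨E, _, _, hE⟩ := exists_E R
  have hinjE := hE.inj
  obtain ⟨xs, hlen, hxs, hrad⟩ := exists_sop p h1
  obtain ⟨f, hfp, hf⟩ := exists_f hE p h0 xs hxs hrad
  have hn : n ≠ 0 := by
    rintro rfl
    have hq : ¬ maximalIdeal R ≤ p := fun h => hmP (h.trans hpP)
    have := (DL.lt_prime h1 (le_maximalIdeal (Ideal.IsPrime.ne_top (I := p) inferInstance)) hq).zero
    exact not_subsingleton_iff_nontrivial.2 (Ideal.Quotient.nontrivial_iff.2 (maximalIdeal.isMaximal R).ne_top) this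
  obtain ⟨n, rfl⟩ := Nat.exists_eq_succ_of_ne_zero hn
  set C := cech xs with hC
  set W := C.W (n+1) (R ⧸ p) E with hW
  have hkW : ∀ r ∈ p, ∀ φ : W, r • φ = 0 := by
    intro r hr φ
    ext u
    change r • φ.1 u = 0
    rw [← map_smul, C.kill (n+1) (kill_quot p r hr), map_zero]
  have hfin : Module.Finite R W := by
    have := (KJ p xs hrad hxs hE (n+1) (R ⧸ p) (kill_quot p)).1
    have hs := cech_vanish xs (n+2) (R ⧸ p) (by lia)
    let θ : C.X (n+1) (R ⧸ p) →ₗ[R] C.H (n+1) (R ⧸ p) :=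
      (Submodule.mkQ _) ∘ₗ LinearMap.id.codRestrict (LinearMap.ker (C.d (n+1) (R ⧸ p))) (fun u => hs.elim _ _)
    have hr : LinearMap.range (LinearMap.lcomp R E θ) = W := by
      have hex : Function.Exact (C.Bd (n+1) (R ⧸ p)).subtype θ := by
        intro u
        have h2 : θ u = 0 ↔ u ∈ C.Bd (n+1) (R ⧸ p) := C.H_mk_zero _ _ _
        rw [h2]
        constructor
        · intro h; exact ⟨⟨u, h⟩, rfl⟩
        · rintro ⟨u, rfl⟩; exact u.2
      ext φ
      have := hom_exact (J := E) hex φ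
      constructor
      · intro h b hb
        exact LinearMap.congr_fun (this.2 h) ⟨b, hb⟩
      · intro h
        exact this.1 (by ext b; exact h b.1 b.2)
    rw [← hr]
    infer_instance
  have hvan : Subsingleton (HL a (n+1) W) := by
    refine subsingleton_of_forall_eq 0 (fun w => ?_)
    have hfn : f ^ n ∉ p := fun h => hfp (Ideal.IsPrime.mem_of_pow_mem inferInstance n h)
    obtain ⟨z, rfl⟩ := HL.divisible a h1 hkW hfn w
    exact up hE p a P hpP haP hmP xs hrad hf n (by lia) z
  have hann : ∀ r : R, (∀ φ : W, r • φ = 0) → r ∈ p := by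
    intro g hg
    have h2 := down hE p xs hxs hf g hg (n+1) le_rfl
    rw [Nat.sub_self] at h2
    have h3 : ∀ φ : C.X 0 (R ⧸ p) →ₗ[R] E, (f ^ (n+1) * g) • φ = 0 := by
      intro φ
      have hφW : φ ∈ C.W 0 (R ⧸ p) E := by
        intro b hb
        have : b = 0 := hb
        rw [this, map_zero]
      have hG : (⟨φ, hφW⟩ : C.W 0 (R ⧸ p) E) ∈ Gam (maximalIdeal R) (C.W 0 (R ⧸ p) E) := by
        obtain ⟨t, ht⟩ := hE.tor (φ ((C.e0 _).symm 1))
        refine ⟨t, fun r hr => ?_⟩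
        ext u
        change r • φ u = 0
        obtain ⟨c, hc⟩ := Ideal.Quotient.mk_surjective (C.e0 _ u)
        have : u = c • (C.e0 _).symm 1 := by
          apply (C.e0 _).injective
          rw [map_smul, LinearEquiv.apply_symm_apply, ← hc, Algebra.smul_def, mul_one]; rfl
        rw [this, map_smul, smul_comm, ht r hr, smul_zero]
      have h4 := h2 ((HL.zeroEquiv _ _).symm ⟨_, hG⟩)
      rw [← map_smul, LinearEquiv.map_eq_zero_iff] at h4
      exact congrArg (fun x => x.1.1) h4
    have h5 : ∀ m : R ⧸ p, (f ^ (n+1) * g) • m = 0 := by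
      intro m
      have := hE.ann h3 ((C.e0 _).symm m)
      rwa [← map_smul, LinearEquiv.map_eq_zero_iff] at this
    rcases Ideal.IsPrime.mem_or_mem inferInstance (quot_ann p h5) with h | h
    · exact absurd (Ideal.IsPrime.mem_of_pow_mem inferInstance _ h) hfp
    · exact h
  obtain ⟨θ, hθ⟩ := exists_map_domain p W hkW hann
  have hrg : Subsingleton (HL a (n+1) (LinearMap.range θ)) := by
    have := HL.right_exact a (DL.of_ann h1 hkW) θ.rangeRestrict (LinearMap.surjective_rangeRestrict _)
    exact this.subsingleton
  have hco : Subsingleton (HL a (n+1) ((R ⧸ p) ⧸ LinearMap.range θ)) := by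
    obtain ⟨φ, hφ⟩ : ∃ φ, θ φ ≠ 0 := by
      by_contra! hc
      exact hθ (LinearMap.ext hc)
    obtain ⟨x, hx⟩ := Ideal.Quotient.mk_surjective (θ φ)
    have hxp : x ∉ p := fun h => hφ (hx ▸ Ideal.Quotient.eq_zero_iff_mem.2 h)
    refine grothendieck a (n+1) (DL.prime h1 (x := x) ?_ hxp ?_) _ le_rfl
    · intro r hr m
      obtain ⟨m, rfl⟩ := Submodule.mkQ_surjective _ m
      rw [← map_smul, kill_quot p r hr, map_zero]
    · intro m
      obtain ⟨m, rfl⟩ := Submodule.mkQ_surjective _ m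
      rw [← map_smul, Submodule.mkQ_apply, Submodule.Quotient.mk_eq_zero]
      obtain ⟨c, rfl⟩ := Ideal.Quotient.mk_surjective m
      refine ⟨c • φ, ?_⟩
      rw [map_smul, ← hx, Algebra.smul_def, Algebra.smul_def, mul_comm]; rfl
  exact (SES.ofInj (LinearMap.range θ).subtype Subtype.val_injective).vanishB (by
    rw [Submodule.range_subtype]; exact hco) hrg

end main
end LHV
end PartK

section PartL
set_option autoImplicit false
open scoped Pointwise
open IsLocalRing
namespace LHV
section L1
variable {R : Type u} [CommRing R] {M N : Type u} [AddCommGroup M] [Module R M] [AddCommGroup N] [Module R N]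

lemma HL.map_add (a : Ideal R) (i : ℕ) (g h : M →ₗ[R] N) : HL.map a i (g + h) = HL.map a i g + HL.map a i h := by
  ext x; obtain ⟨t, y, rfl⟩ := HL.exists_of x
  rw [LinearMap.add_apply, HL.map_of, HL.map_of, HL.map_of]
  have : ModuleCat.ofHom (g + h) = ModuleCat.ofHom g + ModuleCat.ofHom h := rfl
  rw [this, CategoryTheory.Abelian.Ext.mk₀_add, CategoryTheory.Abelian.Ext.comp_add, _root_.map_add]

lemma HL.map_sum (a : Ideal R) (i : ℕ) {ι : Type} (s : Finset ι) (r : ι → R) (g : ι → M →ₗ[R] N) (z : HL a i M) :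
    HL.map a i (∑ j ∈ s, r j • g j) z = ∑ j ∈ s, r j • HL.map a i (g j) z := by
  classical
  induction s using Finset.induction_on with
  | empty => simp [HL.map_zero]
  | insert j s hj ih => rw [Finset.sum_insert hj, Finset.sum_insert hj, HL.map_add, LinearMap.add_apply, ih, HL.map_smul]; rfl

variable [IsNoetherianRing R]

lemma DL.of_supp [Module.Finite R M] {k : ℕ} (h : DL R M k) {q : PrimeSpectrum R} (hq : q ∈ Module.support R M) : DL R (R ⧸ q.asIdeal) k := by
  refine h.supp (fun q' hq' => ?_)
  have h1 := Module.annihilator_le_of_mem_support hq'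
  rw [Ideal.annihilator_quotient] at h1
  exact Module.mem_support_mono h1 hq

variable (a : Ideal R) {n : ℕ}

/-- nonvanishing top local cohomology of `R ⧸ p` is a quotient of that of `M` -/
lemma att_i [Module.Finite R M] (hM : DL R M (n+1)) {q : PrimeSpectrum R} (hq : q ∈ Module.support R M) :
    ∃ g : HL a n M →ₗ[R] HL a n (R ⧸ q.asIdeal), Function.Surjective g := by
  have h1 := hM.of_supp hq
  set p := q.asIdeal with hp
  have hqs : q ∈ Module.support R (M ⧸ p • (⊤ : Submodule R M)) := by
    rw [Module.support_quotient]
    exact ⟨hq, by rw [PrimeSpectrum.mem_zeroLocus]⟩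
  have hann := Module.annihilator_le_of_mem_support hqs
  have hk : ∀ r ∈ p, ∀ m : M ⧸ p • (⊤ : Submodule R M), r • m = 0 := by
    intro r hr m
    obtain ⟨m, rfl⟩ := Submodule.mkQ_surjective _ m
    rw [← _root_.map_smul, Submodule.mkQ_apply, Submodule.Quotient.mk_eq_zero]
    exact Submodule.smul_mem_smul hr trivial
  obtain ⟨θ, hθ⟩ := exists_map_domain p _ hk (fun r hr => hann (Module.mem_annihilator.2 hr))
  let θ' := θ ∘ₗ (p • (⊤ : Submodule R M)).mkQ
  have hco : Subsingleton (HL a n ((R ⧸ p) ⧸ LinearMap.range θ')) := by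
    obtain ⟨φ, hφ⟩ : ∃ φ, θ' φ ≠ 0 := by
      by_contra! hc
      apply hθ
      refine LinearMap.ext fun m => ?_
      obtain ⟨m, rfl⟩ := Submodule.mkQ_surjective _ m
      exact hc m
    obtain ⟨x, hx⟩ := Ideal.Quotient.mk_surjective (θ' φ)
    have hxp : x ∉ p := fun h => hφ (hx ▸ Ideal.Quotient.eq_zero_iff_mem.2 h)
    refine grothendieck a n (DL.prime h1 (x := x) ?_ hxp ?_) _ le_rfl
    · intro r hr m
      obtain ⟨m, rfl⟩ := Submodule.mkQ_surjective _ m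
      obtain ⟨m, rfl⟩ := Ideal.Quotient.mk_surjective m
      have : r • (Ideal.Quotient.mk p m) = 0 := Ideal.Quotient.eq_zero_iff_mem.2 (p.mul_mem_right m hr)
      rw [← _root_.map_smul, this, _root_.map_zero]
    · intro m
      obtain ⟨m, rfl⟩ := Submodule.mkQ_surjective _ m
      rw [← _root_.map_smul, Submodule.mkQ_apply, Submodule.Quotient.mk_eq_zero]
      obtain ⟨c, rfl⟩ := Ideal.Quotient.mk_surjective m
      refine ⟨c • φ, ?_⟩
      rw [_root_.map_smul, ← hx, Algebra.smul_def, Algebra.smul_def, mul_comm]; rfl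
  have s1 := HL.right_exact a hM θ'.rangeRestrict (LinearMap.surjective_rangeRestrict _)
  have s2 : Function.Surjective (HL.map a n (LinearMap.range θ').subtype) := by
    have S := SES.quot (LinearMap.range θ')
    intro y
    exact (S.ex₂ (a := a) (i := n) y).1 (Subsingleton.elim _ _)
  exact ⟨HL.map a n (LinearMap.range θ').subtype ∘ₗ HL.map a n θ'.rangeRestrict, s2.comp s1⟩

lemma ann_top {q : PrimeSpectrum R} (h1 : DL R (R ⧸ q.asIdeal) (n+1)) (h : ¬ Subsingleton (HL a n (R ⧸ q.asIdeal))) :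
    Module.annihilator R (HL a n (R ⧸ q.asIdeal)) = q.asIdeal := by
  have hk : ∀ r ∈ q.asIdeal, ∀ m : R ⧸ q.asIdeal, r • m = 0 := by
    intro r hr m
    obtain ⟨m, rfl⟩ := Ideal.Quotient.mk_surjective m
    exact Ideal.Quotient.eq_zero_iff_mem.2 (q.asIdeal.mul_mem_right m hr)
  ext r
  rw [Module.mem_annihilator]
  constructor
  · intro hr
    by_contra hrq
    apply h
    refine subsingleton_of_forall_eq 0 (fun y => ?_)
    obtain ⟨z, rfl⟩ := HL.divisible a h1 hk hrq y
    exact hr z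
  · intro hr
    exact HL.smul_eq_zero_of r (hk r hr)

lemma att_ii [Module.Finite R M] (hM : DL R M (n+1)) {q : PrimeSpectrum R} (hq : q ∈ Module.support R M)
    (T : Type u) [AddCommGroup T] [Module R T] (g : HL a n M →ₗ[R] T) (hg : Function.Surjective g) (hT : Module.annihilator R T = q.asIdeal) :
    ¬ Subsingleton (HL a n (R ⧸ q.asIdeal)) := by
  intro hs
  obtain ⟨k, r, hr⟩ := Submodule.fg_iff_exists_fin_generating_family.1 (IsNoetherian.noetherian q.asIdeal)
  have hrq : ∀ i, r i ∈ q.asIdeal := fun i => hr ▸ Submodule.subset_span ⟨i, rfl⟩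
  let μ : (Fin k → M) →ₗ[R] M := ∑ i, r i • LinearMap.proj i
  have hμ : ∀ i m, r i • m ∈ LinearMap.range μ := by
    intro i m
    refine ⟨Pi.single i m, ?_⟩
    simp only [μ, LinearMap.sum_apply, LinearMap.smul_apply, LinearMap.proj_apply]
    rw [Finset.sum_eq_single i]
    · rw [Pi.single_eq_same]
    · intro j _ hj; rw [Pi.single_eq_of_ne hj, smul_zero]
    · simp
  have hkill : q.asIdeal ≤ Module.annihilator R (M ⧸ LinearMap.range μ) := by
    rw [← hr, Submodule.span_le]
    rintro _ ⟨i, rfl⟩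
    refine Module.mem_annihilator.2 (fun m => ?_)
    obtain ⟨m, rfl⟩ := Submodule.mkQ_surjective _ m
    rw [← _root_.map_smul, Submodule.mkQ_apply, Submodule.Quotient.mk_eq_zero]
    exact hμ i m
  have hco : Subsingleton (HL a n (M ⧸ LinearMap.range μ)) := by
    refine HL.vanishV a inferInstance (fun q' hq' => ?_)
    have h1 := hkill.trans (Module.annihilator_le_of_mem_support hq')
    by_cases h2 : q'.asIdeal ≤ q.asIdeal
    · have : q' = q := PrimeSpectrum.ext (le_antisymm h2 h1)
      rw [this]; exact hs
    · exact grothendieck a n (DL.lt_prime (hM.of_supp hq) h1 h2) n le_rfl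
  have hdl : DL R (Fin k → M) (n+1) := by
    refine hM.supp (fun q' hq' => ?_)
    have h1 := Module.annihilator_le_of_mem_support hq'
    rw [Module.mem_support_iff_of_finite]
    refine le_trans (fun x hx => Module.mem_annihilator.2 (fun m => ?_)) h1
    funext i
    exact Module.mem_annihilator.1 hx (m i)
  have s1 := HL.right_exact a hdl μ.rangeRestrict (LinearMap.surjective_rangeRestrict _)
  have s2 : Function.Surjective (HL.map a n (LinearMap.range μ).subtype) := by
    have S := SES.quot (LinearMap.range μ)
    intro y
    exact (S.ex₂ (a := a) (i := n) y).1 (Subsingleton.elim _ _)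
  have s3 : Function.Surjective (HL.map a n μ) := by
    have h3 : μ = (LinearMap.range μ).subtype ∘ₗ μ.rangeRestrict := rfl
    rw [h3, HL.map_comp]
    exact s2.comp s1
  have : (1 : R) ∈ q.asIdeal := by
    rw [← hT]
    refine Module.mem_annihilator.2 (fun t => ?_)
    obtain ⟨w, rfl⟩ := hg t
    obtain ⟨z, rfl⟩ := s3 w
    rw [one_smul, HL.map_sum, _root_.map_sum]
    refine Finset.sum_eq_zero (fun i _ => ?_)
    rw [_root_.map_smul]
    have := hrq i
    rw [← hT] at this
    exact Module.mem_annihilator.1 this _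
  exact (Ideal.ne_top_iff_one _).1 q.2.ne_top this

end L1

theorem main {R : Type u} [CommRing R] [IsNoetherianRing R] [IsLocalRing R] [IsAdicComplete (maximalIdeal R) R]
    {M : Type u} [AddCommGroup M] [Module R M] [Module.Finite R M] {n : ℕ} (a b : Ideal R) (ha : a ≠ ⊤) (hb : b ≠ ⊤) (hM : DL R M (n+1))
    (hatt : ∀ q : PrimeSpectrum R,
      (∃ (T : Type u) (_ : AddCommGroup T) (_ : Module R T) (g : HL a n M →ₗ[R] T), Function.Surjective g ∧ Module.annihilator R T = q.asIdeal) →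
      (∃ (T : Type u) (_ : AddCommGroup T) (_ : Module R T) (g : HL b n M →ₗ[R] T), Function.Surjective g ∧ Module.annihilator R T = q.asIdeal)) :
    ∃ f : HL b n M →ₗ[R] HL a n M, Function.Surjective f := by
  classical
  let S : Set (PrimeSpectrum R) := {q | q ∈ Module.support R M ∧ ¬ Subsingleton (HL a n (R ⧸ q.asIdeal))}
  have hSb : ∀ q ∈ S, ¬ Subsingleton (HL b n (R ⧸ q.asIdeal)) := by
    rintro q ⟨hq, hqa⟩
    obtain ⟨g, hg⟩ := att_i a hM hq
    obtain ⟨T, _, _, g', hg', hT⟩ := hatt q ⟨_, _, _, g, hg, ann_top a (hM.of_supp hq) hqa⟩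
    exact att_ii b hM hq T g' hg' hT
  have hSn : ∀ q ∈ S, ¬ DL R (R ⧸ q.asIdeal) n := fun q hq h => hq.2 (grothendieck a n h n le_rfl)
  set I := Module.annihilator R M with hI
  have hSmin : ∀ q ∈ S, q.asIdeal ∈ I.minimalPrimes := by
    intro q hq
    refine ⟨⟨q.2, Module.annihilator_le_of_mem_support hq.1⟩, ?_⟩
    rintro P ⟨hP, hIP⟩ hPq
    by_contra hc
    obtain ⟨P', rfl⟩ : ∃ P' : PrimeSpectrum R, P = P'.asIdeal := ⟨⟨P, hP⟩, rfl⟩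
    have hPs : P' ∈ Module.support R M := by
      rw [Module.mem_support_iff_of_finite]; exact hIP
    have h9 := hM.of_supp hPs
    have h10 := DL.lt_prime (p := P'.asIdeal) (q := q.asIdeal) h9 hPq hc
    exact hSn q hq h10
  have hfin := Ideal.finite_minimalPrimes_of_isNoetherianRing R I
  have hSfin : S.Finite := by
    refine Set.Finite.of_finite_image (f := PrimeSpectrum.asIdeal) (hfin.subset ?_) (fun x _ y _ h => PrimeSpectrum.ext h)
    rintro _ ⟨q, hq, rfl⟩
    exact hSmin q hq
  let c : Ideal R := hSfin.toFinset.inf PrimeSpectrum.asIdeal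
  have hc : ∀ q ∈ S, c ≤ q.asIdeal := fun q hq => Finset.inf_le (hSfin.mem_toFinset.2 hq)
  have hcP : ∀ P : Ideal R, P.IsPrime → c ≤ P → ∃ q ∈ S, q.asIdeal ≤ P := by
    intro P hP h
    obtain ⟨q, hq, h⟩ := (Ideal.IsPrime.inf_le' hP).1 h
    exact ⟨q, hSfin.mem_toFinset.1 hq, h⟩
  obtain ⟨k, hk⟩ := Ideal.exists_radical_pow_le_of_fg I (IsNoetherian.noetherian _)
  have hs : ∀ q ∈ S, ∃ s ∉ q.asIdeal, ∀ r ∈ q.asIdeal, s * r ∈ I.radical := by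
    intro q hq
    let e : Ideal R := (hfin.toFinset.erase q.asIdeal).inf id
    have he : ¬ e ≤ q.asIdeal := by
      intro h
      obtain ⟨P, hP, hPq⟩ := (Ideal.IsPrime.inf_le' q.2).1 h
      rw [Finset.mem_erase, Set.Finite.mem_toFinset] at hP
      exact hP.1 (le_antisymm hPq ((hSmin q hq).2 hP.2.1 hPq))
    obtain ⟨s, hse, hsq⟩ := SetLike.not_le_iff_exists.1 he
    refine ⟨s, hsq, fun r hr => ?_⟩
    rw [← Ideal.sInf_minimalPrimes, Submodule.mem_sInf]
    intro P hP
    by_cases hPq : P = q.asIdeal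
    · rw [hPq]; exact Ideal.mul_mem_left _ _ hr
    · refine Ideal.mul_mem_right _ _ ?_
      have : e ≤ P := Finset.inf_le (f := id) (Finset.mem_erase.2 ⟨hPq, hfin.mem_toFinset.2 hP⟩)
      exact this hse
  let N : Submodule R M := c ^ k • (⊤ : Submodule R M)
  have hN : ∀ q ∈ S, q ∉ Module.support R N := by
    intro q hq hqN
    obtain ⟨s, hsq, hsr⟩ := hs q hq
    have h1 : (Ideal.span {s} * c) ^ k ≤ I := by
      refine le_trans (Ideal.pow_right_mono ?_ k) hk
      rw [Ideal.span_singleton_mul_le_iff]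
      exact fun r hr => hsr r (hc q hq hr)
    rw [mul_pow] at h1
    have h2 : s ^ k ∈ Module.annihilator R N := by
      refine Module.mem_annihilator.2 ?_
      rintro ⟨x, hx⟩
      apply Subtype.ext
      change s ^ k • x = 0
      refine Submodule.smul_induction_on hx ?_ ?_
      · intro r hr m _
        rw [← mul_smul]
        exact Module.mem_annihilator.1 (h1 (Ideal.mul_mem_mul (Ideal.pow_mem_pow (Ideal.mem_span_singleton_self s) k) hr)) m
      · intro x y hx hy
        rw [smul_add, hx, hy, add_zero]
    exact hsq (q.2.mem_of_pow_mem k (Module.annihilator_le_of_mem_support hqN h2))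
  have hTN : Subsingleton (HL a n N) := by
    refine HL.vanishV a inferInstance (fun q hq => ?_)
    by_contra hc
    exact hN q ⟨Module.support_subset_of_injective N.subtype Subtype.val_injective hq, hc⟩ hq
  have SX := SES.quot N
  have ba : Function.Bijective (HL.map a n N.mkQ) := by
    refine ⟨?_, HL.right_exact a hM _ (Submodule.mkQ_surjective _)⟩
    rw [← LinearMap.ker_eq_bot, Submodule.eq_bot_iff]
    intro x hx
    obtain ⟨y, rfl⟩ := (SX.ex₂ x).1 hx
    rw [Subsingleton.elim y 0, map_zero]
  have sb := HL.right_exact b hM N.mkQ (Submodule.mkQ_surjective _)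
  have hX : Tor c (M ⧸ N) := by
    intro x
    refine ⟨k, fun r hr => ?_⟩
    obtain ⟨m, rfl⟩ := Submodule.mkQ_surjective _ x
    rw [← map_smul, Submodule.mkQ_apply, Submodule.Quotient.mk_eq_zero]
    exact Submodule.smul_mem_smul hr trivial
  have key : ∀ d : Ideal R, (∀ q ∈ S, ¬ Subsingleton (HL d n (R ⧸ q.asIdeal))) → ∀ P : Ideal R, P.IsPrime → d ⊔ c ≤ P → maximalIdeal R ≤ P := by
    intro d hd P hP hdc
    obtain ⟨q, hq, hqP⟩ := hcP P hP (le_sup_right.trans hdc)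
    by_contra hm
    exact hd q hq (LHVT q.asIdeal d P hqP (le_sup_left.trans hdc) hm (hM.of_supp hq.1) (hSn q hq))
  have hrad : (a ⊔ c).radical = (b ⊔ c).radical := by
    rw [Ideal.radical_eq_sInf, Ideal.radical_eq_sInf]
    congr 1
    ext P
    constructor
    · rintro ⟨h, hP⟩
      exact ⟨sup_le ((le_maximalIdeal hb).trans (key a (fun q hq => hq.2) P hP h)) (le_sup_right.trans h), hP⟩
    · rintro ⟨h, hP⟩
      exact ⟨sup_le ((le_maximalIdeal ha).trans (key b hSb P hP h)) (le_sup_right.trans h), hP⟩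
  obtain ⟨e⟩ := indep (Gam_eq_of_radical hrad) hX n
  refine ⟨(LinearEquiv.ofBijective _ ba).symm.toLinearMap ∘ₗ e.symm.toLinearMap ∘ₗ HL.map b n N.mkQ, ?_⟩
  exact (LinearEquiv.ofBijective _ ba).symm.surjective.comp (e.symm.surjective.comp sb)

end LHV
end PartL

theorem stmt7 (R : Type u) [CommRing R] [IsNoetherianRing R] [IsLocalRing R]
    [IsAdicComplete (IsLocalRing.maximalIdeal R) R]
    (a b : Ideal R) (ha : a ≠ ⊤) (hb : b ≠ ⊤)
    (M : Type u) [AddCommGroup M] [Module R M] [Module.Finite R M]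
    (n : ℕ) (hdim : mdim R M = (n : ℕ∞))
    (hatt : Att R (LC a n M) ⊆ Att R (LC b n M)) :
    ∃ f : (LC b n M) →ₗ[R] (LC a n M), Function.Surjective f := by
  have hM : LHV.DL R M (n+1) := by
    change mdim R M < _
    rw [hdim]
    exact_mod_cast Nat.lt_succ_self n
  obtain ⟨f, hf⟩ := LHV.main a b ha hb hM (by
    rintro q ⟨T, _, _, g, hg, hT⟩
    let g' : (LC a n M) →ₗ[R] T := g ∘ₗ (LHV.LCequiv a n M).toLinearMap
    have hg' : Function.Surjective g' := hg.comp (LHV.LCequiv a n M).surjective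
    obtain ⟨-, U, hU⟩ := hatt (show q.asIdeal ∈ Att R (LC a n M) from ⟨q.2, LinearMap.ker g', by
      rw [← hT]
      exact (g'.quotKerEquivOfSurjective hg').annihilator_eq.symm⟩)
    exact ⟨_, _, _, U.mkQ ∘ₗ (LHV.LCequiv b n M).symm.toLinearMap,
      (Submodule.mkQ_surjective U).comp (LHV.LCequiv b n M).symm.surjective, hU.symm⟩)
  exact ⟨(LHV.LCequiv a n M).symm.toLinearMap ∘ₗ f ∘ₗ (LHV.LCequiv b n M).toLinearMap,
    (LHV.LCequiv a n M).symm.surjective.comp (hf.comp (LHV.LCequiv b n M).surjective)⟩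

end
end

section
/- Let R be a commutative Noetherian ring, a an ideal, r ≥ 0 an integer, and M a finitely generated R-module such that H_a^r(R/p) = 0 for all p ∈ Supp(M). Then H_a^r(N) = 0 for every finitely generated R-module N with Supp(N) ⊆ Supp(M); in particular H_a^r(M) = 0. -/
noncomputable section

universe u

open CategoryTheory

open Limits Opposite

/-- Applying `Hom(P, -)` with `P` projective to a short exact sequence. -/
theorem aux_hom_shortExact {R : Type u} [CommRing R] (S : ShortComplex (ModuleCat.{u} R))
    (hS : S.ShortExact) (P : ModuleCat.{u} R) [Projective P] :
    (S.map ((linearYoneda R (ModuleCat.{u} R)).flip.obj (op P))).ShortExact := by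
  have := hS.mono_f
  have := hS.epi_g
  apply ModuleCat.shortComplex_shortExact
  · intro (x : P ⟶ S.X₂)
    constructor
    · intro (h : x ≫ S.g = 0)
      exact ⟨hS.exact.lift x h, hS.exact.lift_f x h⟩
    · rintro ⟨y, rfl⟩
      change P ⟶ S.X₁ at y
      change (y ≫ S.f) ≫ S.g = 0
      simp
  · intro (x : P ⟶ S.X₁) (y : P ⟶ S.X₁) (h : x ≫ S.f = y ≫ S.f)
    exact (cancel_mono S.f).1 h
  · intro (x : P ⟶ S.X₃)
    exact ⟨Projective.factorThru x S.g, Projective.factorThru_comp x S.g⟩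

theorem aux_ext_exact {R : Type u} [CommRing R] (S : ShortComplex (ModuleCat.{u} R))
    (hS : S.ShortExact) (X : ModuleCat.{u} R) (n : ℕ) :
    Function.Exact (((Ext R (ModuleCat.{u} R) n).obj (op X)).map S.f)
      (((Ext R (ModuleCat.{u} R) n).obj (op X)).map S.g) := by
  let P := projectiveResolution X
  let L := linearYoneda R (ModuleCat.{u} R)
  let α := NatTrans.rightOp (L.map S.g)
  let β := NatTrans.rightOp (L.map S.f)
  have hαβ : α ≫ β = 0 := by
    ext Y : 2
    apply Quiver.Hom.unop_inj
    ext (x : Y ⟶ S.X₁)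
    change (x ≫ S.f) ≫ S.g = 0
    simp
  let T : ShortComplex (ChainComplex (ModuleCat.{u} R)ᵒᵖ ℕ) :=
    ShortComplex.mk ((NatTrans.mapHomologicalComplex α (ComplexShape.down ℕ)).app P.complex)
      ((NatTrans.mapHomologicalComplex β (ComplexShape.down ℕ)).app P.complex) (by
        ext i : 1
        exact congr_app hαβ (P.complex.X i))
  have hT : T.ShortExact := by
    apply HomologicalComplex.shortExact_of_degreewise_shortExact
    intro i
    have : Projective (P.complex.X i) := P.projective i
    exact (aux_hom_shortExact S hS (P.complex.X i)).op
  have hE := hT.homology_exact₂ n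
  have hα : (NatTrans.leftDerived α n).app X ≫ (P.isoLeftDerivedObj _ n).hom =
      (P.isoLeftDerivedObj _ n).hom ≫
        (HomologicalComplex.homologyFunctor _ _ n).map T.f := by
    rw [P.leftDerived_app_eq α, Category.assoc, Category.assoc, Iso.inv_hom_id, Category.comp_id]
  have hβ : (NatTrans.leftDerived β n).app X ≫ (P.isoLeftDerivedObj _ n).hom =
      (P.isoLeftDerivedObj _ n).hom ≫
        (HomologicalComplex.homologyFunctor _ _ n).map T.g := by
    rw [P.leftDerived_app_eq β, Category.assoc, Category.assoc, Iso.inv_hom_id, Category.comp_id]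
  have w : (NatTrans.leftDerived α n).app X ≫ (NatTrans.leftDerived β n).app X = 0 := by
    rw [← cancel_mono (P.isoLeftDerivedObj _ n).hom, Category.assoc, hβ, ← Category.assoc, hα,
      Category.assoc, ← Functor.map_comp, T.zero, Functor.map_zero, comp_zero, zero_comp]
  have hF : (ShortComplex.mk _ _ w).Exact := by
    refine (ShortComplex.exact_iff_of_iso ?_).2 hE
    exact ShortComplex.isoMk (P.isoLeftDerivedObj _ n) (P.isoLeftDerivedObj _ n)
      (P.isoLeftDerivedObj _ n) hα.symm hβ.symm
  exact (ShortComplex.ShortExact.moduleCat_exact_iff_function_exact _).1 hF.unop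

theorem aux_LC_middle {R : Type u} [CommRing R] (a : Ideal R) (r : ℕ)
    (S : ShortComplex (ModuleCat.{u} R)) (hS : S.ShortExact)
    (h1 : Subsingleton ((localCohomology a r).obj S.X₁))
    (h3 : Subsingleton ((localCohomology a r).obj S.X₃)) :
    Subsingleton ((localCohomology a r).obj S.X₂) := by
  have : PreservesFilteredColimitsOfSize.{0, 0} (forget (ModuleCat.{u} R)) :=
    preservesFilteredColimitsOfSize_shrink.{0, u, 0, u} _
  let D := localCohomology.diagram (localCohomology.idealPowersDiagram a) r
  have hc (N : ModuleCat.{u} R) :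
      IsColimit (((evaluation _ _).obj N).mapCocone (colimit.cocone D)) :=
    isColimitOfPreserves _ (colimit.isColimit D)
  have key : ∀ x : (localCohomology a r).obj S.X₂, x = 0 := by
    intro x
    obtain ⟨j, y, hy⟩ := Concrete.isColimit_exists_rep _ (hc S.X₂) x
    have h0 : ((colimit.cocone D).ι.app j).app S.X₃ ((D.obj j).map S.g y) =
        ((colimit.cocone D).ι.app j).app S.X₃ 0 := h3.elim _ _
    obtain ⟨k, s, t, hst⟩ := Concrete.isColimit_exists_of_rep_eq _ (hc S.X₃) _ _ h0
    change (D.map s).app S.X₃ ((D.obj j).map S.g y) = (D.map t).app S.X₃ 0 at hst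
    rw [map_zero, ← ConcreteCategory.comp_apply, (D.map s).naturality,
      ConcreteCategory.comp_apply] at hst
    have hex : Function.Exact ((D.obj k).map S.f) ((D.obj k).map S.g) := aux_ext_exact S hS _ r
    obtain ⟨z, hz⟩ := (hex _).1 hst
    have h1' : ((colimit.cocone D).ι.app k).app S.X₁ z = 0 := h1.elim _ _
    have h2 : ((colimit.cocone D).ι.app k).app S.X₂ ((D.obj k).map S.f z) = 0 := by
      rw [← ConcreteCategory.comp_apply, ((colimit.cocone D).ι.app k).naturality,
        ConcreteCategory.comp_apply, h1', map_zero]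
    rw [hz, ← ConcreteCategory.comp_apply, ← NatTrans.comp_app, Cocone.w] at h2
    exact hy.symm.trans h2
  exact ⟨fun x y => (key x).trans (key y).symm⟩

theorem aux_ext_zero {R : Type u} [CommRing R]
    (N : ModuleCat.{u} R) [Subsingleton N] (X : ModuleCat.{u} R) (r : ℕ)
    (y : ((Ext R (ModuleCat.{u} R) r).obj (op X)).obj N) : y = 0 := by
  let S : ShortComplex (ModuleCat.{u} R) := ShortComplex.mk (𝟙 N) (𝟙 N)
    (by ext x; exact Subsingleton.elim (α := N) _ _)
  have hS : S.ShortExact := ModuleCat.shortComplex_shortExact _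
    (fun x => ⟨fun _ => ⟨x, rfl⟩, fun _ => Subsingleton.elim (α := N) _ _⟩)
    (fun x y h => h) (fun x => ⟨x, rfl⟩)
  have hid : (((Ext R (ModuleCat.{u} R) r).obj (op X)).map (𝟙 N)) y = y := by
    rw [CategoryTheory.Functor.map_id]; rfl
  have := (aux_ext_exact S hS X r y).2 ⟨y, hid⟩
  exact hid.symm.trans this

theorem aux_LC_zero {R : Type u} [CommRing R] (a : Ideal R) (r : ℕ)
    (N : Type u) [AddCommGroup N] [Module R N] [Subsingleton N] : Subsingleton (LC a r N) := by
  have : Subsingleton (ModuleCat.of R N) := ‹Subsingleton N›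
  have hid : ∀ (j : _) (y : ((localCohomology.diagram
      (localCohomology.idealPowersDiagram a) r).obj j).obj (ModuleCat.of R N)), y = 0 :=
    fun j y => aux_ext_zero _ _ r y
  have : PreservesFilteredColimitsOfSize.{0, 0} (forget (ModuleCat.{u} R)) :=
    preservesFilteredColimitsOfSize_shrink.{0, u, 0, u} _
  let D := localCohomology.diagram (localCohomology.idealPowersDiagram a) r
  have hc : IsColimit (((evaluation _ _).obj (ModuleCat.of R N)).mapCocone (colimit.cocone D)) :=
    isColimitOfPreserves _ (colimit.isColimit D)
  have key : ∀ x : LC a r N, x = 0 := by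
    intro x
    obtain ⟨j, y, hy⟩ := Concrete.isColimit_exists_rep _ hc x
    rw [hid j y, map_zero] at hy
    exact hy.symm
  exact ⟨fun x y => (key x).trans (key y).symm⟩

theorem stmt12 (R : Type u) [CommRing R] [IsNoetherianRing R]
    (a : Ideal R) (ha : a ≠ ⊤) (r : ℕ)
    (M : Type u) [AddCommGroup M] [Module R M] [Module.Finite R M]
    (hvan : ∀ p ∈ Module.support R M, Subsingleton (LC a r (R ⧸ p.asIdeal))) :
    (∀ (N : Type u) [AddCommGroup N] [Module R N], Module.Finite R N →
        Module.support R N ⊆ Module.support R M → Subsingleton (LC a r N)) ∧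
      Subsingleton (LC a r M) := by
  have main : ∀ (N : Type u) [AddCommGroup N] [Module R N], Module.Finite R N →
        Module.support R N ⊆ Module.support R M → Subsingleton (LC a r N) := by
    intro N _ _ hN
    induction hN using IsNoetherianRing.induction_on_isQuotientEquivQuotientPrime R with
    | subsingleton N => exact fun _ => aux_LC_zero a r N
    | quotient N p e =>
      intro h
      have hp : p ∈ Module.support R M := by
        apply h
        rw [e.support_eq, Module.mem_support_iff_of_finite, Ideal.annihilator_quotient]
      have := hvan p hp
      exact (((localCohomology a r).mapIso e.toModuleIso).toLinearEquiv.toEquiv).subsingleton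
    | exact N₁ N₂ N₃ f g hf hg hfg h₁ h₃ =>
      intro h
      rw [Module.support_of_exact hfg hf hg, Set.union_subset_iff] at h
      let S : ShortComplex (ModuleCat.{u} R) :=
        ShortComplex.mk (ModuleCat.ofHom f) (ModuleCat.ofHom g)
          (by ext x; exact hfg.apply_apply_eq_zero x)
      exact aux_LC_middle a r S (ModuleCat.shortComplex_shortExact S hfg hf hg)
        (h₁ h.1) (h₃ h.2)
  exact ⟨main, main M inferInstance le_rfl⟩

end
end
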